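/- There exists a universal constant C > 0 such that for every N ≥ 1, if A is Haar-distributed on the compact symplectic group USp(2N) and Q_N(A) = 2 Σ_{k≥1} Tr(A^k)²/k², then |E[Q_N(A)] − 2 log(2N) − (2γ + 2 + π²/12)| ≤ C/N and |Var(Q_N(A)) − (4π²/3 + 2 ζ(3))| ≤ C/N, where γ is the Euler–Mascheroni constant and ζ is the Riemann zeta function. -/

import Mathlib

open MeasureTheory ProbabilityTheory Matrix

noncomputable section

instance matrixMeasurableSpace {m n α : Type*} [MeasurableSpace α] :
    MeasurableSpace (Matrix m n α) :=
  show MeasurableSpace (m → n → α) from inferInstance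

/-- The standard `2N×2N` skew-symmetric symplectic form `J = [[0, I], [−I, 0]]`. -/
def J (N : ℕ) : Matrix (Fin (2 * N)) (Fin (2 * N)) ℂ :=
  Matrix.of fun i j =>
    if (i : ℕ) + N = (j : ℕ) then 1 else if (j : ℕ) + N = (i : ℕ) then -1 else 0

/-- The compact symplectic group `USp(2N)`: unitary `2N×2N` complex matrices `A` with
`Aᵀ J A = J`. -/
def USp (N : ℕ) : Set (Matrix (Fin (2 * N)) (Fin (2 * N)) ℂ) :=
  {A | A ∈ Matrix.unitaryGroup (Fin (2 * N)) ℂ ∧ Aᵀ * J N * A = J N}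

/-- `Q_N(A) = 2 Σ_{k≥1} Tr(A^k)²/k²` (the trace of `A^k ∈ USp(2N)` is real, so it is recorded
here by its real part). -/
def Q (N : ℕ) (A : Matrix (Fin (2 * N)) (Fin (2 * N)) ℂ) : ℝ :=
  2 * ∑' k : ℕ, ((A ^ (k + 1)).trace.re) ^ 2 / ((k : ℝ) + 1) ^ 2

namespace SymplecticHaar

theorem J_apply (N : ℕ) (i j : Fin (2 * N)) : J N i j =
    if (i : ℕ) + N = (j : ℕ) then 1 else if (j : ℕ) + N = (i : ℕ) then -1 else 0 := rfl

/-- The symplectic form squares to minus the identity. -/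
theorem J_mul_J (N : ℕ) : J N * J N = -1 := by
  ext i j
  rw [Matrix.mul_apply]
  simp only [J_apply, Matrix.neg_apply, Matrix.one_apply, Fin.ext_iff]
  have hi := i.2
  have hj := j.2
  by_cases h : (i : ℕ) < N
  · rw [Finset.sum_eq_single (⟨i + N, by omega⟩ : Fin (2 * N))]
    · simp only
      split_ifs <;> first | omega | simp
    · intro b _ hb
      have : (i : ℕ) + N ≠ b := fun h => hb (Fin.ext (by simp [h]))
      rw [if_neg this, if_neg (by omega), zero_mul]
    · simp
  · rw [Finset.sum_eq_single (⟨i - N, by omega⟩ : Fin (2 * N))]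
    · simp only
      split_ifs <;> first | omega | simp
    · intro b _ hb
      have : (b : ℕ) + N ≠ i := fun h => hb (Fin.ext (by simp; omega))
      rw [if_neg (by omega), if_neg (by omega), zero_mul]
    · simp

theorem J_transpose (N : ℕ) : (J N)ᵀ = -J N := by
  ext i j
  simp only [J_apply, Matrix.transpose_apply, Matrix.neg_apply]
  have hi := i.2
  have hj := j.2
  split_ifs <;> first | omega | simp

theorem J_conjTranspose (N : ℕ) : (J N)ᴴ = -J N := by
  ext i j
  simp only [J_apply, Matrix.conjTranspose_apply, Matrix.neg_apply]
  have hi := i.2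
  have hj := j.2
  split_ifs <;> first | omega | simp

theorem isUnit_J (N : ℕ) : IsUnit (J N) :=
  IsUnit.of_mul_eq_one (-J N) (by rw [mul_neg, J_mul_J, neg_neg])

theorem J_inv (N : ℕ) : (J N)⁻¹ = -J N :=
  Matrix.inv_eq_right_inv (by rw [mul_neg, J_mul_J, neg_neg])

/-- Exponentials of skew-Hermitian elements of the symplectic Lie algebra are in `USp`. -/
theorem exp_mem_USp {N : ℕ} {X : Matrix (Fin (2 * N)) (Fin (2 * N)) ℂ}
    (h1 : Xᴴ = -X) (h2 : Xᵀ * J N + J N * X = 0) : NormedSpace.exp X ∈ USp N := by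
  constructor
  · rw [Matrix.mem_unitaryGroup_iff', Matrix.star_eq_conjTranspose, ← Matrix.exp_conjTranspose, h1,
      Matrix.exp_neg]
    exact Matrix.nonsing_inv_mul _ ((Matrix.isUnit_iff_isUnit_det _).1 (Matrix.isUnit_exp X))
  · have h3 : Xᵀ = J N * (-X) * (J N)⁻¹ := by
      rw [J_inv]
      have : Xᵀ * J N = - (J N * X) := eq_neg_of_add_eq_zero_left h2
      have h4 : Xᵀ * (J N * J N) = - (J N * X) * J N := by rw [← mul_assoc, this]
      rw [J_mul_J] at h4
      simp only [mul_neg, mul_one, neg_mul] at h4 ⊢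
      rw [neg_inj] at h4
      rw [h4, neg_neg]
    rw [← Matrix.exp_transpose, h3, Matrix.exp_conj _ _ (isUnit_J N), Matrix.exp_neg, J_inv]
    have h5 : (NormedSpace.exp X)⁻¹ * NormedSpace.exp X = 1 :=
      Matrix.nonsing_inv_mul _ ((Matrix.isUnit_iff_isUnit_det _).1 (Matrix.isUnit_exp X))
    calc J N * (NormedSpace.exp X)⁻¹ * -J N * J N * NormedSpace.exp X
        = J N * (NormedSpace.exp X)⁻¹ * (-(J N * J N)) * NormedSpace.exp X := by
          simp only [mul_assoc, mul_neg, neg_mul]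
      _ = J N * ((NormedSpace.exp X)⁻¹ * NormedSpace.exp X) := by
          rw [J_mul_J, neg_neg, mul_one, mul_assoc]
      _ = J N := by rw [h5, mul_one]

theorem USp_mul_mem {N : ℕ} {A B : Matrix (Fin (2 * N)) (Fin (2 * N)) ℂ}
    (hA : A ∈ USp N) (hB : B ∈ USp N) : A * B ∈ USp N := by
  refine ⟨mul_mem hA.1 hB.1, ?_⟩
  calc (A * B)ᵀ * J N * (A * B) = Bᵀ * (Aᵀ * J N * A) * B := by
        rw [Matrix.transpose_mul]; simp only [mul_assoc]
    _ = J N := by rw [hA.2, hB.2]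

theorem isClosed_USp (N : ℕ) : IsClosed (USp N) := by
  have h : USp N = {A | A * star A = 1} ∩ {A | Aᵀ * J N * A = J N} := by
    ext A
    simp [USp, Matrix.mem_unitaryGroup_iff]
  rw [h]
  refine IsClosed.inter (isClosed_eq ?_ continuous_const) (isClosed_eq ?_ continuous_const)
  · exact continuous_id.mul (Continuous.matrix_conjTranspose continuous_id)
  · exact ((Continuous.matrix_transpose continuous_id).mul continuous_const).mul continuous_id

theorem isCompact_USp (N : ℕ) : IsCompact (USp N) := by
  have h : IsCompact (Set.univ.pi fun _ => Set.univ.pi fun _ => Metric.closedBall 0 1 :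
      Set (Fin (2 * N) → Fin (2 * N) → ℂ)) :=
    isCompact_univ_pi fun _ => isCompact_univ_pi fun _ => isCompact_closedBall _ _
  refine IsCompact.of_isClosed_subset (X := Fin (2 * N) → Fin (2 * N) → ℂ) h (isClosed_USp N) ?_
  intro A hA i _ j _
  simpa using entry_norm_bound_of_unitary hA.1 i j

instance matrixBorelSpace {m n : Type*} [Countable m] [Countable n] : BorelSpace (Matrix m n ℂ) :=
  show BorelSpace (m → n → ℂ) from inferInstance

instance matrixSecondCountable {m n : Type*} [Countable m] [Countable n] :
    SecondCountableTopology (Matrix m n ℂ) :=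
  show SecondCountableTopology (m → n → ℂ) from inferInstance

theorem ae_mem_USp {N : ℕ} {μ : Measure (Matrix (Fin (2 * N)) (Fin (2 * N)) ℂ)}
    [IsProbabilityMeasure μ] (h : μ (USp N) = 1) : ∀ᵐ A ∂μ, A ∈ USp N :=
  (prob_compl_eq_zero_iff (isClosed_USp N).measurableSet).2 h

theorem integrable_of_continuous {N : ℕ} {μ : Measure (Matrix (Fin (2 * N)) (Fin (2 * N)) ℂ)}
    [IsProbabilityMeasure μ] (h : μ (USp N) = 1)
    {F : Matrix (Fin (2 * N)) (Fin (2 * N)) ℂ → ℂ} (hF : Continuous F) : Integrable F μ := by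
  obtain ⟨K, hK⟩ := (isCompact_USp N).exists_bound_of_continuousOn hF.continuousOn
  exact Integrable.of_bound hF.aestronglyMeasurable K ((ae_mem_USp h).mono fun A hA => hK A hA)

open scoped Matrix.Norms.Operator in
/-- Integration by parts on the group: the mean of the derivative along a one-parameter subgroup
vanishes. -/
theorem integral_deriv_eq_zero {N : ℕ} {μ : Measure (Matrix (Fin (2 * N)) (Fin (2 * N)) ℂ)}
    [IsProbabilityMeasure μ] (h : μ (USp N) = 1)
    (hinv : ∀ g ∈ USp N, μ.map (fun A => g * A) = μ)
    {X : Matrix (Fin (2 * N)) (Fin (2 * N)) ℂ}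
    (h1 : Xᴴ = -X) (h2 : Xᵀ * J N + J N * X = 0)
    {F F' : Matrix (Fin (2 * N)) (Fin (2 * N)) ℂ → ℂ} (hF : Continuous F) (hF' : Continuous F')
    (hd : ∀ B, HasDerivAt (fun t : ℝ => F (NormedSpace.exp (t • X) * B)) (F' B) 0) :
    ∫ A, F' A ∂μ = 0 := by
  have hmem : ∀ t : ℝ, NormedSpace.exp (t • X) ∈ USp N := fun t => by
    refine exp_mem_USp (by rw [Matrix.conjTranspose_smul, h1]; simp) ?_
    rw [Matrix.transpose_smul, Matrix.smul_mul, Matrix.mul_smul, ← smul_add, h2, smul_zero]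
  have hd' : ∀ B, ∀ t : ℝ, HasDerivAt (fun t : ℝ => F (NormedSpace.exp (t • X) * B))
      (F' (NormedSpace.exp (t • X) * B)) t := by
    intro B t
    have := hd (NormedSpace.exp (t • X) * B)
    rw [← sub_self t] at this
    have h3 := HasDerivAt.comp_sub_const t t this
    have h4 : ∀ x : ℝ, NormedSpace.exp ((x - t) • X) * (NormedSpace.exp (t • X) * B)
        = NormedSpace.exp (x • X) * B := fun x => by
      rw [← mul_assoc, ← Matrix.exp_add_of_commute _ _
        (((Commute.refl X).smul_left _).smul_right _), ← add_smul, sub_add_cancel]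
    simpa only [h4] using h3
  obtain ⟨K, hK⟩ := (isCompact_USp N).exists_bound_of_continuousOn hF'.continuousOn
  have key := (hasDerivAt_integral_of_dominated_loc_of_deriv_le (μ := μ) (𝕜 := ℝ) (x₀ := 0)
    (F := fun t A => F (NormedSpace.exp (t • X) * A))
    (F' := fun t A => F' (NormedSpace.exp (t • X) * A)) (s := Set.univ) (bound := fun _ => K)
    Filter.univ_mem
    (Filter.Eventually.of_forall fun t =>
      (hF.comp (continuous_const.mul continuous_id)).aestronglyMeasurable)
    (integrable_of_continuous h (hF.comp (continuous_const.mul continuous_id)))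
    (hF'.comp (continuous_const.mul continuous_id)).aestronglyMeasurable
    ((ae_mem_USp h).mono fun A hA t _ => hK _ (USp_mul_mem (hmem t) hA))
    (integrable_const _)
    (Filter.Eventually.of_forall fun A t _ => hd' A t)).2
  have hc : (fun t : ℝ => ∫ A, F (NormedSpace.exp (t • X) * A) ∂μ) = fun _ => ∫ A, F A ∂μ := by
    ext t
    conv_rhs => rw [← hinv _ (hmem t)]
    rw [integral_map (by exact (continuous_const.mul continuous_id).measurable.aemeasurable)
      hF.aestronglyMeasurable]
  rw [hc] at key
  have := key.unique (hasDerivAt_const _ _)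
  simpa using this

end SymplecticHaar

namespace SymplecticHaar

/-- A derivation of a polynomial ring is determined by its partial derivatives. -/
theorem derivation_eq_sum_pderiv {σ R M : Type*} [CommRing R] [AddCommGroup M] [Module R M]
    [Module (MvPolynomial σ R) M] [IsScalarTower R (MvPolynomial σ R) M]
    (d : Derivation R (MvPolynomial σ R) M) (h : MvPolynomial σ R) :
    d h = ∑ m ∈ h.vars, MvPolynomial.pderiv m h • d (MvPolynomial.X m) := by
  classical
  let e : σ → Derivation R (MvPolynomial σ R) M := fun m =>
    (LinearMap.toSpanSingleton (MvPolynomial σ R) M (d (MvPolynomial.X m))).compDer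
      (MvPolynomial.pderiv m)
  have hsum : ∀ (s : Finset σ) (p : MvPolynomial σ R), (∑ m ∈ s, e m) p = ∑ m ∈ s, e m p :=
    fun s p => map_sum ((Pi.evalAddMonoidHom (fun _ => M) p).comp Derivation.coeFnAddMonoidHom) _ _
  have key : d h = (∑ m ∈ h.vars, e m) h := by
    apply MvPolynomial.derivation_eq_of_forall_mem_vars
    intro i hi
    rw [hsum, Finset.sum_eq_single i]
    · simp [e]
    · intro b _ hb
      simp [e, MvPolynomial.pderiv_X_of_ne hb.symm]
    · exact fun h => absurd hi h
  rw [key, hsum]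
  rfl

/-- Evaluation of a polynomial in the variables `X k` at the power traces `Tr (A ^ k)`. -/
def traceEval {n : Type*} [Fintype n] [DecidableEq n] (A : Matrix n n ℂ) :
    MvPolynomial ℕ ℂ →ₐ[ℂ] ℂ :=
  MvPolynomial.aeval fun k => (A ^ k).trace

theorem traceEval_X {n : Type*} [Fintype n] [DecidableEq n] (A : Matrix n n ℂ) (k : ℕ) :
    traceEval A (MvPolynomial.X k) = (A ^ k).trace := by
  simp [traceEval]

theorem continuous_trace_pow {n : Type*} [Fintype n] [DecidableEq n] (Y : Matrix n n ℂ) (k : ℕ) :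
    Continuous fun A : Matrix n n ℂ => (Y * A ^ k).trace :=
  (continuous_const.mul (continuous_id.pow k)).matrix_trace

theorem continuous_traceEval {n : Type*} [Fintype n] [DecidableEq n] (h : MvPolynomial ℕ ℂ) :
    Continuous fun A : Matrix n n ℂ => traceEval A h := by
  induction h using MvPolynomial.induction_on with
  | C a => simpa using continuous_const
  | add p q hp hq => simp only [map_add]; exact hp.add hq
  | mul_X p k hp =>
    simp only [map_mul, traceEval_X]
    exact hp.mul (by simpa using continuous_trace_pow (1 : Matrix n n ℂ) k)

section Deriv
open scoped Matrix.Norms.Operator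

variable {n : Type*} [Fintype n] [DecidableEq n]

theorem hasDerivAt_exp_mul_pow (X B : Matrix n n ℂ) (k : ℕ) :
    HasDerivAt (fun t : ℝ => (NormedSpace.exp (t • X) * B) ^ k)
      (∑ l ∈ Finset.range k, B ^ l * X * B ^ (k - l)) 0 := by
  have h1 : HasDerivAt (fun t : ℝ => NormedSpace.exp (t • X) * B) (X * B) 0 := by
    have := (hasDerivAt_exp_smul_const (𝕂 := ℝ) X (0 : ℝ)).mul_const B
    simp only [zero_smul, NormedSpace.exp_zero, one_mul] at this
    exact this
  induction k with
  | zero =>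
    simp only [pow_zero, Finset.range_zero, Finset.sum_empty]
    exact hasDerivAt_const _ _
  | succ k ih =>
    have h2 := ih.mul h1
    simp only [pow_succ _ k]
    refine h2.congr_deriv ?_
    simp only [zero_smul, NormedSpace.exp_zero, one_mul]
    rw [Finset.sum_range_succ, Finset.sum_mul]
    congr 1
    · refine Finset.sum_congr rfl fun l hl => ?_
      have := Finset.mem_range.1 hl
      rw [mul_assoc, ← pow_succ]
      congr 2
      omega
    · simp [mul_assoc]

theorem hasDerivAt_trace_exp_mul_pow (X Y B : Matrix n n ℂ) (k : ℕ) :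
    HasDerivAt (fun t : ℝ => (Y * (NormedSpace.exp (t • X) * B) ^ k).trace)
      (∑ l ∈ Finset.range k, (Y * (B ^ l * X * B ^ (k - l))).trace) 0 := by
  let φ : Matrix n n ℂ →L[ℝ] ℂ :=
    LinearMap.toContinuousLinearMap
      ((Matrix.traceLinearMap n ℝ ℂ).comp (LinearMap.mulLeft ℝ Y))
  have := φ.hasFDerivAt.comp_hasDerivAt 0 (hasDerivAt_exp_mul_pow X B k)
  refine this.congr_deriv ?_
  change (Y * ∑ l ∈ Finset.range k, B ^ l * X * B ^ (k - l)).trace = _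
  rw [Finset.mul_sum, Matrix.trace_sum]

theorem hasDerivAt_traceEval (X B : Matrix n n ℂ) (h : MvPolynomial ℕ ℂ) :
    HasDerivAt (fun t : ℝ => traceEval (NormedSpace.exp (t • X) * B) h)
      (∑ m ∈ h.vars, traceEval B (MvPolynomial.pderiv m h) * (m * (X * B ^ m).trace)) 0 := by
  let d : Derivation ℂ (MvPolynomial ℕ ℂ) (MvPolynomial ℕ ℂ) :=
    MvPolynomial.mkDerivation ℂ fun m => MvPolynomial.C (m * (X * B ^ m).trace)
  have h1 : ∑ m ∈ h.vars, traceEval B (MvPolynomial.pderiv m h) * (m * (X * B ^ m).trace)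
      = traceEval B (d h) := by
    rw [derivation_eq_sum_pderiv d h, map_sum]
    refine Finset.sum_congr rfl fun m _ => ?_
    rw [smul_eq_mul, map_mul, MvPolynomial.mkDerivation_X]
    congr 1
    simp [traceEval]
  rw [h1]
  clear h1
  induction h using MvPolynomial.induction_on with
  | C a =>
    have : d (MvPolynomial.C a) = 0 := MvPolynomial.derivation_C d a
    rw [this, map_zero]
    have : ∀ A : Matrix n n ℂ, traceEval A (MvPolynomial.C a) = a := fun A => by simp [traceEval]
    simp only [this]
    exact hasDerivAt_const _ _
  | add p q hp hq => simp only [map_add]; exact hp.add hq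
  | mul_X p k hp =>
    have h2 := hasDerivAt_trace_exp_mul_pow X 1 B k
    simp only [map_mul, traceEval_X]
    simp only [one_mul] at h2
    have h3 := hp.mul h2
    refine h3.congr_deriv ?_
    have h4 : ∑ l ∈ Finset.range k, (B ^ l * X * B ^ (k - l)).trace = k * (X * B ^ k).trace := by
      rw [Finset.sum_congr rfl (g := fun _ => (X * B ^ k).trace)]
      · simp
      · intro l hl
        have := Finset.mem_range.1 hl
        rw [Matrix.trace_mul_comm, ← mul_assoc, ← pow_add, Matrix.trace_mul_comm]
        congr 3
        omega
    rw [h4, Derivation.leibniz, MvPolynomial.mkDerivation_X]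
    simp [traceEval]
    ring

/-- Derivative of `A ↦ Tr(Y A^k) h(A)` in the direction `X`. -/
def dirDeriv (Y : Matrix n n ℂ) (k : ℕ) (h : MvPolynomial ℕ ℂ) (X A : Matrix n n ℂ) : ℂ :=
  (∑ l ∈ Finset.range k, (Y * (A ^ l * X * A ^ (k - l))).trace) * traceEval A h +
    (Y * A ^ k).trace *
      ∑ m ∈ h.vars, traceEval A (MvPolynomial.pderiv m h) * (m * (X * A ^ m).trace)

theorem continuous_dirDeriv (Y : Matrix n n ℂ) (k : ℕ) (h : MvPolynomial ℕ ℂ) (X : Matrix n n ℂ) :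
    Continuous (dirDeriv Y k h X) := by
  unfold dirDeriv
  refine Continuous.add (Continuous.mul (continuous_finsetSum _ fun l _ => ?_)
    (continuous_traceEval h)) (Continuous.mul (continuous_trace_pow Y k)
    (continuous_finsetSum _ fun m _ => (continuous_traceEval _).mul
      (continuous_const.mul (continuous_trace_pow X m))))
  exact (continuous_const.mul (((continuous_id.pow l).mul continuous_const).mul
    (continuous_id.pow (k - l)))).matrix_trace

theorem dirDeriv_add_smul (Y : Matrix n n ℂ) (k : ℕ) (h : MvPolynomial ℕ ℂ)
    (X X' : Matrix n n ℂ) (c : ℂ) (A : Matrix n n ℂ) :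
    dirDeriv Y k h (X + c • X') A = dirDeriv Y k h X A + c * dirDeriv Y k h X' A := by
  simp only [dirDeriv, mul_add, add_mul, Matrix.trace_add, Matrix.mul_smul, Matrix.smul_mul,
    Matrix.trace_smul, Finset.sum_add_distrib, Finset.mul_sum, Finset.sum_mul, smul_eq_mul]
  have : ∀ a b c d a' b' c' d' : ℂ, a = a' → b = b' → c = c' → d = d' →
      a + b + (c + d) = a' + c' + (b' + d') := by
    rintro a b c d _ _ _ _ rfl rfl rfl rfl; ring
  apply this <;> refine Finset.sum_congr rfl fun _ _ => ?_ <;> ring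

end Deriv

section SD

variable {N : ℕ} {μ : Measure (Matrix (Fin (2 * N)) (Fin (2 * N)) ℂ)}
    [IsProbabilityMeasure μ]

theorem integral_dirDeriv_skew (hμ : μ (USp N) = 1)
    (hinv : ∀ g ∈ USp N, μ.map (fun A => g * A) = μ)
    {X : Matrix (Fin (2 * N)) (Fin (2 * N)) ℂ}
    (h1 : Xᴴ = -X) (h2 : Xᵀ * J N + J N * X = 0) (Y : Matrix (Fin (2 * N)) (Fin (2 * N)) ℂ)
    (k : ℕ) (h : MvPolynomial ℕ ℂ) : ∫ A, dirDeriv Y k h X A ∂μ = 0 := by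
  refine integral_deriv_eq_zero hμ hinv h1 h2
    (F := fun A => (Y * A ^ k).trace * traceEval A h)
    ((continuous_trace_pow Y k).mul (continuous_traceEval h)) (continuous_dirDeriv Y k h X) ?_
  intro B
  refine ((hasDerivAt_trace_exp_mul_pow X Y B k).mul (hasDerivAt_traceEval X B h)).congr_deriv ?_
  simp [dirDeriv]

theorem integral_dirDeriv (hμ : μ (USp N) = 1)
    (hinv : ∀ g ∈ USp N, μ.map (fun A => g * A) = μ)
    {X : Matrix (Fin (2 * N)) (Fin (2 * N)) ℂ}
    (h2 : Xᵀ * J N + J N * X = 0) (Y : Matrix (Fin (2 * N)) (Fin (2 * N)) ℂ)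
    (k : ℕ) (h : MvPolynomial ℕ ℂ) : ∫ A, dirDeriv Y k h X A ∂μ = 0 := by
  have h3 : (Xᴴ)ᵀ * J N + J N * Xᴴ = 0 := by
    have h4 := congrArg Matrix.conjTranspose h2
    rw [Matrix.conjTranspose_add, Matrix.conjTranspose_mul, Matrix.conjTranspose_mul,
      J_conjTranspose, Matrix.conjTranspose_zero] at h4
    have h5 : (Xᵀ)ᴴ = (Xᴴ)ᵀ := rfl
    rw [h5] at h4
    have h6 := congrArg (fun M => J N * M * J N) h4
    simp only [mul_add, add_mul, mul_neg, neg_mul, ← mul_assoc, J_mul_J, mul_zero, zero_mul] at h6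
    rw [mul_assoc _ (J N) (J N), J_mul_J] at h6
    simpa using h6
  set X₁ := (1 / 2 : ℂ) • (X - Xᴴ) with hX₁
  set X₂ := (-Complex.I / 2 : ℂ) • (X + Xᴴ) with hX₂
  have hX : X = X₁ + Complex.I • X₂ := by
    rw [hX₁, hX₂, smul_smul]
    have : Complex.I * (-Complex.I / 2) = 1 / 2 := by
      linear_combination (-1 / 2 : ℂ) * Complex.I_mul_I
    rw [this, ← smul_add, sub_add_add_cancel, ← two_smul ℂ X, smul_smul]
    norm_num
  have e1 := integral_dirDeriv_skew hμ hinv (X := X₁)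
    (by rw [hX₁]; simp [Matrix.conjTranspose_smul, ← smul_neg])
    (by
      rw [hX₁, Matrix.transpose_smul, Matrix.smul_mul, Matrix.mul_smul, ← smul_add,
        Matrix.transpose_sub, sub_mul, mul_sub, sub_add_sub_comm, h2, h3]; simp) Y k h
  have e2 := integral_dirDeriv_skew hμ hinv (X := X₂)
    (by rw [hX₂]; simp [Matrix.conjTranspose_smul, ← neg_smul, add_comm, neg_div])
    (by
      rw [hX₂, Matrix.transpose_smul, Matrix.smul_mul, Matrix.mul_smul, ← smul_add,
        Matrix.transpose_add, add_mul, mul_add, add_add_add_comm, h2, h3]; simp) Y k h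
  rw [hX]
  simp only [dirDeriv_add_smul]
  rw [integral_add (integrable_of_continuous hμ (continuous_dirDeriv _ _ _ _))
    ((integrable_of_continuous hμ (continuous_dirDeriv _ _ _ _)).const_mul _), e1,
    integral_const_mul, e2]
  simp

end SD
end SymplecticHaar

namespace SymplecticHaar

variable {N : ℕ}

theorem pow_transpose_mul_J_mul_pow {A : Matrix (Fin (2 * N)) (Fin (2 * N)) ℂ}
    (hA : Aᵀ * J N * A = J N) (k : ℕ) : (A ^ k)ᵀ * J N * A ^ k = J N := by
  induction k with
  | zero => simp
  | succ k ih =>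
    rw [pow_succ, Matrix.transpose_mul]
    calc Aᵀ * (A ^ k)ᵀ * J N * (A ^ k * A) = Aᵀ * ((A ^ k)ᵀ * J N * A ^ k) * A := by
          simp only [mul_assoc]
      _ = J N := by rw [ih, hA]

theorem trace_transpose_J_J {A : Matrix (Fin (2 * N)) (Fin (2 * N)) ℂ}
    (hA : Aᵀ * J N * A = J N) (b c : ℕ) :
    ((A ^ b)ᵀ * J N * A ^ c * J N).trace = -(A ^ (Nat.dist b c)).trace := by
  rcases le_total b c with h | h
  · obtain ⟨d, rfl⟩ := Nat.exists_eq_add_of_le h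
    rw [pow_add, ← mul_assoc, pow_transpose_mul_J_mul_pow hA b, mul_assoc, Matrix.trace_mul_comm,
      mul_assoc, J_mul_J, Nat.dist_eq_sub_of_le h]
    simp
  · obtain ⟨d, rfl⟩ := Nat.exists_eq_add_of_le h
    rw [pow_add, Matrix.transpose_mul, mul_assoc, mul_assoc, ← mul_assoc _ (A ^ c), ← mul_assoc,
      ← mul_assoc, mul_assoc _ (A ^ c)ᵀ, mul_assoc, mul_assoc, ← mul_assoc (_ * _) (A ^ c),
      pow_transpose_mul_J_mul_pow hA c, J_mul_J, Nat.dist_eq_sub_of_le_right h, ← Matrix.trace_transpose]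
    simp

/-- Spanning elements of the complex symplectic Lie algebra. -/
def spElem (i j : Fin (2 * N)) : Matrix (Fin (2 * N)) (Fin (2 * N)) ℂ :=
  Matrix.single i j 1 + J N * Matrix.single j i 1 * J N

theorem spElem_mem (i j : Fin (2 * N)) :
    (spElem i j)ᵀ * J N + J N * spElem i j = 0 := by
  simp only [spElem, Matrix.transpose_add, Matrix.transpose_mul, J_transpose,
    Matrix.transpose_single, add_mul, mul_add]
  simp only [neg_mul, mul_neg, neg_neg, ← mul_assoc, J_mul_J]
  rw [mul_assoc _ (J N) (J N), J_mul_J]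
  simp

theorem trace_single_mul {n : Type*} [Fintype n] [DecidableEq n] (i j : n) (M : Matrix n n ℂ) :
    (Matrix.single j i 1 * M).trace = M i j := by
  simp [Matrix.trace_single_mul]

theorem mul_single_mul_apply {n : Type*} [Fintype n] [DecidableEq n] (i j a b : n)
    (B C : Matrix n n ℂ) :
    ((B * Matrix.single i j (1 : ℂ) * C : Matrix n n ℂ)) a b = B a i * C j b := by
  rw [Matrix.mul_apply, Finset.sum_eq_single j]
  · rw [Matrix.mul_single_apply_same, mul_one]
  · intro c _ hc
    rw [Matrix.mul_single_apply_of_ne _ _ _ _ _ hc, zero_mul]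
  · simp

theorem sum_trace_spElem_left {A : Matrix (Fin (2 * N)) (Fin (2 * N)) ℂ}
    (hA : Aᵀ * J N * A = J N) (b c : ℕ) :
    ∑ i, ∑ j, (Matrix.single j i 1 * (A ^ b * spElem i j * A ^ c)).trace =
      (A ^ b).trace * (A ^ c).trace + (A ^ (Nat.dist b c)).trace := by
  have h : ∀ i j : Fin (2 * N), (Matrix.single j i (1 : ℂ) * (A ^ b * spElem i j * A ^ c)).trace =
      (A ^ b) i i * (A ^ c) j j + (A ^ b * J N) i j * (J N * A ^ c) i j := by
    intro i j
    rw [trace_single_mul, spElem, mul_add, add_mul, Matrix.add_apply, mul_single_mul_apply]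
    congr 1
    rw [← mul_single_mul_apply]
    simp only [mul_assoc]
  simp only [h, Finset.sum_add_distrib]
  congr 1
  · rw [Matrix.trace, Matrix.trace, Finset.sum_mul_sum]
    rfl
  · have h2 := trace_transpose_J_J hA b c
    have h3 : ∑ i, ∑ j, (A ^ b * J N) i j * (J N * A ^ c) i j =
        ((A ^ b * J N)ᵀ * (J N * A ^ c)).trace := by
      rw [Matrix.trace, Finset.sum_comm]
      rfl
    rw [h3, Matrix.transpose_mul, J_transpose, neg_mul, neg_mul, Matrix.trace_neg, mul_assoc,
      Matrix.trace_mul_comm, ← mul_assoc, h2, neg_neg]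

theorem sum_trace_spElem_right {A : Matrix (Fin (2 * N)) (Fin (2 * N)) ℂ}
    (hA : Aᵀ * J N * A = J N) (k m : ℕ) :
    ∑ i, ∑ j, (Matrix.single j i 1 * A ^ k).trace * (spElem i j * A ^ m).trace =
      (A ^ (k + m)).trace - (A ^ (Nat.dist k m)).trace := by
  have h : ∀ i j : Fin (2 * N),
      (Matrix.single j i 1 * A ^ k).trace * (spElem i j * A ^ m).trace =
      (A ^ k) i j * (A ^ m) j i + (A ^ k) i j * (J N * A ^ m * J N) i j := by
    intro i j
    rw [trace_single_mul, spElem, add_mul, Matrix.trace_add, trace_single_mul, mul_add]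
    congr 2
    rw [mul_assoc, mul_assoc, Matrix.trace_mul_comm, mul_assoc, trace_single_mul]
  simp only [h, Finset.sum_add_distrib]
  rw [sub_eq_add_neg]
  congr 1
  · rw [pow_add]; rfl
  · have h3 : ∑ i, ∑ j, (A ^ k) i j * (J N * A ^ m * J N) i j =
        ((A ^ k)ᵀ * (J N * A ^ m * J N)).trace := by
      rw [Matrix.trace, Finset.sum_comm]
      rfl
    rw [h3, ← trace_transpose_J_J hA k m]
    simp only [mul_assoc]

/-- The two-body part of the loop equations. -/
def loopPoly (k : ℕ) : MvPolynomial ℕ ℂ :=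
  ∑ l ∈ Finset.range k,
    (MvPolynomial.X l * MvPolynomial.X (k - l) + MvPolynomial.X (Nat.dist l (k - l)))

/-- The polynomial whose mean vanishes by the loop equation indexed by `k` and `h`. -/
def loopEq (k : ℕ) (h : MvPolynomial ℕ ℂ) : MvPolynomial ℕ ℂ :=
  loopPoly k * h + ∑ m ∈ h.vars, MvPolynomial.pderiv m h *
    ((m : MvPolynomial ℕ ℂ) * (MvPolynomial.X (k + m) - MvPolynomial.X (Nat.dist k m)))

theorem sum_dirDeriv {A : Matrix (Fin (2 * N)) (Fin (2 * N)) ℂ}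
    (hA : Aᵀ * J N * A = J N) (k : ℕ) (h : MvPolynomial ℕ ℂ) :
    ∑ i, ∑ j, dirDeriv (Matrix.single j i 1) k h (spElem i j) A = traceEval A (loopEq k h) := by
  simp only [dirDeriv, Finset.sum_add_distrib, loopEq, map_add, map_mul]
  congr 1
  · simp only [← Finset.sum_mul]
    congr 1
    rw [loopPoly, map_sum, Finset.sum_congr rfl fun i _ => Finset.sum_comm, Finset.sum_comm]
    refine Finset.sum_congr rfl fun l _ => ?_
    rw [sum_trace_spElem_left hA]
    simp [traceEval_X]
  · rw [map_sum]
    simp only [Finset.mul_sum]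
    rw [Finset.sum_congr rfl fun i _ => Finset.sum_comm, Finset.sum_comm]
    refine Finset.sum_congr rfl fun m _ => ?_
    simp only [map_mul, map_sub, traceEval_X, map_natCast]
    rw [← sum_trace_spElem_right hA]
    simp only [Finset.mul_sum]
    refine Finset.sum_congr rfl fun i _ => Finset.sum_congr rfl fun j _ => ?_
    ring

/-- The loop (Schwinger–Dyson) equations for Haar measure on `USp N`. -/
theorem integral_loopEq {μ : Measure (Matrix (Fin (2 * N)) (Fin (2 * N)) ℂ)}
    [IsProbabilityMeasure μ] (hμ : μ (USp N) = 1)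
    (hinv : ∀ g ∈ USp N, μ.map (fun A => g * A) = μ) (k : ℕ) (h : MvPolynomial ℕ ℂ) :
    ∫ A, traceEval A (loopEq k h) ∂μ = 0 := by
  have h1 : ∫ A, traceEval A (loopEq k h) ∂μ =
      ∫ A, ∑ i, ∑ j, dirDeriv (Matrix.single j i 1) k h (spElem i j) A ∂μ :=
    integral_congr_ae ((ae_mem_USp hμ).mono fun A hA => (sum_dirDeriv hA.2 k h).symm)
  have h2 : ∀ i j : Fin (2 * N), Integrable
      (fun A => dirDeriv (Matrix.single j i 1) k h (spElem i j) A) μ := fun i j =>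
    integrable_of_continuous hμ (continuous_dirDeriv _ _ _ _)
  rw [h1, integral_finsetSum _ fun i _ => integrable_finsetSum _ fun j _ => h2 i j]
  refine Finset.sum_eq_zero fun i _ => ?_
  rw [integral_finsetSum _ fun j _ => h2 i j]
  exact Finset.sum_eq_zero fun j _ => integral_dirDeriv hμ hinv (spElem_mem i j) _ _ _

end SymplecticHaar

namespace SymplecticHaar

variable {N : ℕ}

theorem det_aeval_eq_prod_roots {n : Type*} [Fintype n] [DecidableEq n] (A : Matrix n n ℂ)
    (p : Polynomial ℂ) :
    (Polynomial.aeval A p).det = (A.charpoly.roots.map fun z => p.eval z).prod := by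
  have hchar : ∀ c : ℂ, A.charpoly.eval c = (A.charpoly.roots.map fun z => c - z).prod := by
    intro c
    conv_lhs => rw [(IsAlgClosed.splits A.charpoly).eq_prod_roots_of_monic A.charpoly_monic]
    rw [Polynomial.eval_multiset_prod, Multiset.map_map]
    simp
  have hcard : A.charpoly.roots.card = Fintype.card n := by
    rw [← A.charpoly_natDegree_eq_dim]
    exact (IsAlgClosed.splits A.charpoly).natDegree_eq_card_roots.symm
  let φ : Polynomial ℂ →* ℂ := (Matrix.detMonoidHom).comp (Polynomial.aeval A : Polynomial ℂ →ₐ[ℂ] Matrix n n ℂ).toRingHom.toMonoidHom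
  let ψ : Polynomial ℂ →* ℂ :=
    { toFun := fun p => (A.charpoly.roots.map fun z => p.eval z).prod
      map_one' := by simp
      map_mul' := fun p q => by simp [Multiset.prod_map_mul] }
  have hC : ∀ c : ℂ, φ (Polynomial.C c) = ψ (Polynomial.C c) := by
    intro c
    simp [φ, ψ, hcard, Matrix.algebraMap_eq_diagonal, Matrix.det_diagonal]
  have hX : ∀ c : ℂ, φ (Polynomial.X - Polynomial.C c) = ψ (Polynomial.X - Polynomial.C c) := by
    intro c
    have h2 : φ (Polynomial.X - Polynomial.C c) = (-1) ^ Fintype.card n * A.charpoly.eval c := by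
      rw [Matrix.eval_charpoly, ← Matrix.det_neg, neg_sub]
      simp [φ, Matrix.algebraMap_eq_diagonal, Matrix.scalar_apply]
      rfl
    rw [h2, hchar, ← hcard, ← Multiset.card_map (fun z => c - z) A.charpoly.roots, ← Multiset.prod_map_neg]
    simp [ψ]
  change φ p = ψ p
  rw [(IsAlgClosed.splits p).eq_prod_roots, map_mul, map_mul, hC, map_multiset_prod,
    map_multiset_prod, Multiset.map_map, Multiset.map_map]
  congr 2
  exact Multiset.map_congr rfl fun c _ => hX c

theorem trace_pow_eq_sum_roots {n : Type*} [Fintype n] [DecidableEq n] (A : Matrix n n ℂ)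
    (k : ℕ) : (A ^ k).trace = (A.charpoly.roots.map fun z => z ^ k).sum := by
  have h : (A ^ k).charpoly =
      ((A.charpoly.roots.map fun z => z ^ k).map fun a => Polynomial.X - Polynomial.C a).prod := by
    refine Polynomial.funext fun c => ?_
    have := det_aeval_eq_prod_roots A (Polynomial.C c - Polynomial.X ^ k)
    rw [Matrix.eval_charpoly, Polynomial.eval_multiset_prod, Multiset.map_map, Multiset.map_map]
    simpa [Matrix.algebraMap_eq_diagonal, Matrix.scalar_apply, Pi.algebraMap_def] using this
  rw [Matrix.trace_eq_sum_roots_charpoly, h, Polynomial.roots_multiset_prod_X_sub_C]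

theorem exists_add_map_inv (S : Multiset ℂ) (hinv : S.map (fun z => z⁻¹) = S)
    (h0 : (0 : ℂ) ∉ S) (hprod : S.prod = 1) (n : ℕ) (hn : S.card = 2 * n) :
    ∃ t : Multiset ℂ, t.card = n ∧ S = t + t.map (fun z => z⁻¹) := by
  induction n generalizing S with
  | zero => exact ⟨0, by simp, by simpa using hn⟩
  | succ n ih =>
    have key : ∃ z S', S = z ::ₘ z⁻¹ ::ₘ S' := by
      by_cases h : ∃ z ∈ S, z⁻¹ ≠ z
      · obtain ⟨z, hz, hne⟩ := h
        obtain ⟨S1, rfl⟩ := Multiset.exists_cons_of_mem hz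
        have : z⁻¹ ∈ z ::ₘ S1 := by
          rw [← hinv]
          exact Multiset.mem_map_of_mem _ hz
        obtain ⟨S2, rfl⟩ := Multiset.exists_cons_of_mem ((Multiset.mem_cons.1 this).resolve_left hne)
        exact ⟨z, S2, rfl⟩
      · push Not at h
        have hpm : ∀ z ∈ S, z = 1 ∨ z = -1 := by
          intro z hz
          have hz0 : z ≠ 0 := fun h => h0 (h ▸ hz)
          have := h z hz
          refine mul_self_eq_one_iff.1 ?_
          nth_rw 1 [← this]
          exact inv_mul_cancel₀ hz0
        by_contra hcon
        push Not at hcon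
        have hnd : S.Nodup := by
          rw [Multiset.nodup_iff_le]
          intro a ha
          obtain ⟨S', rfl⟩ := Multiset.le_iff_exists_add.1 ha
          have h3 : a⁻¹ = a := h a (by simp)
          refine hcon a S' ?_
          rw [h3]
          simp
        have hle : S ≤ {1, -1} := by
          rw [Multiset.le_iff_subset hnd]
          intro z hz
          simpa using hpm z hz
        have hS : S = {1, -1} := Multiset.eq_of_le_of_card_le hle (by rw [hn]; simp)
        rw [hS] at hprod
        norm_num at hprod
    obtain ⟨z, S', rfl⟩ := key
    have hz0 : z ≠ 0 := fun h => h0 (by simp [h])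
    have hinv' : S'.map (fun z => z⁻¹) = S' := by
      simp only [Multiset.map_cons, inv_inv] at hinv
      rw [Multiset.cons_swap] at hinv
      simpa using hinv
    obtain ⟨t, ht, rfl⟩ := ih S' hinv' (fun h => h0 (by simp [h]))
      (by simpa [← mul_assoc, hz0] using hprod) (by simp at hn; omega)
    refine ⟨z ::ₘ t, by simp [ht], ?_⟩
    rw [Multiset.map_cons, Multiset.cons_add, Multiset.add_cons]

theorem det_eq_one_of_symplectic {A : Matrix (Fin (2 * N)) (Fin (2 * N)) ℂ}
    (hA : Aᵀ * J N * A = J N) : A.det = 1 := by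
  let e : Fin N ⊕ Fin N ≃ Fin (2 * N) := finSumFinEquiv.trans (finCongr (by omega))
  have hJ : (J N).submatrix e e = -Matrix.J (Fin N) ℂ := by
    ext i j
    rcases i with i | i <;> rcases j with j | j
    all_goals simp [J_apply, e, Matrix.J, Matrix.one_apply, Fin.ext_iff]
    all_goals grind
  have h := congrArg (fun M => M.submatrix e e) hA
  simp only [← Matrix.submatrix_mul_equiv _ _ e e e] at h
  rw [hJ] at h
  have h1 : A.submatrix e e ∈ Matrix.symplecticGroup (Fin N) ℂ := by
    rw [SymplecticGroup.mem_iff']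
    simpa [Matrix.transpose_submatrix] using h
  simpa using SymplecticGroup.det_eq_one h1

theorem roots_charpoly_map_inv {A : Matrix (Fin (2 * N)) (Fin (2 * N)) ℂ}
    (hA : Aᵀ * J N * A = J N) :
    A.charpoly.roots.map (fun z => z⁻¹) = A.charpoly.roots := by
  have hdet := det_eq_one_of_symplectic hA
  have hprod := Matrix.det_eq_prod_roots_charpoly A
  have h0 : (0 : ℂ) ∉ A.charpoly.roots := by
    intro h
    rw [Multiset.prod_eq_zero h, hdet] at hprod
    exact one_ne_zero hprod
  have h : A.charpoly = ((A.charpoly.roots.map fun z => z⁻¹).map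
      fun a => Polynomial.X - Polynomial.C a).prod := by
    refine Polynomial.funext fun c => ?_
    have h1 := det_aeval_eq_prod_roots A (Polynomial.C c * Polynomial.X - 1)
    have h2 : (Matrix.scalar (Fin (2 * N)) c - A).det = (c • A - 1).det := by
      have h3 : (Matrix.scalar (Fin (2 * N)) c - A)ᵀ * (J N * A) = J N * (c • A - 1) := by
        rw [Matrix.transpose_sub, sub_mul, ← mul_assoc Aᵀ, hA, mul_sub, mul_one]
        simp [Matrix.scalar_apply, ← Matrix.smul_eq_diagonal_mul]
      have h4 := congrArg Matrix.det h3
      rw [Matrix.det_mul, Matrix.det_mul, Matrix.det_mul, Matrix.det_transpose, hdet, mul_one,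
        mul_comm] at h4
      exact mul_left_cancel₀ ((Matrix.isUnit_iff_isUnit_det _).1 (isUnit_J N)).ne_zero h4
    rw [Matrix.eval_charpoly, h2, Polynomial.eval_multiset_prod, Multiset.map_map,
      Multiset.map_map]
    have h5 : (Polynomial.aeval A (Polynomial.C c * Polynomial.X - 1)) = c • A - 1 := by
      simp [Algebra.smul_def]
    rw [h5] at h1
    have h6 : (A.charpoly.roots.map fun z => (Polynomial.C c * Polynomial.X - 1).eval z).prod =
        (A.charpoly.roots.map fun z => z * (c - z⁻¹)).prod := by
      congr 1
      refine Multiset.map_congr rfl fun z hz => ?_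
      have hz0 : z ≠ 0 := fun h => h0 (h ▸ hz)
      rw [mul_sub, mul_inv_cancel₀ hz0, Polynomial.eval_sub, Polynomial.eval_mul,
        Polynomial.eval_C, Polynomial.eval_X, Polynomial.eval_one, mul_comm]
    rw [h1, h6, Multiset.prod_map_mul, Multiset.map_id', ← hprod, hdet, one_mul]
    simp
  conv_rhs => rw [h]
  rw [Polynomial.roots_multiset_prod_X_sub_C]

/-- Eigenvalues of a symplectic matrix come in inverse pairs. -/
theorem exists_trace_pow_eq {A : Matrix (Fin (2 * N)) (Fin (2 * N)) ℂ}
    (hA : Aᵀ * J N * A = J N) :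
    ∃ z : Fin N → ℂ, (∀ i, z i ≠ 0) ∧
      ∀ k, (A ^ k).trace = ∑ i, (z i ^ k + (z i)⁻¹ ^ k) := by
  have hprod := Matrix.det_eq_prod_roots_charpoly A
  rw [det_eq_one_of_symplectic hA] at hprod
  have h0 : (0 : ℂ) ∉ A.charpoly.roots := by
    intro h
    rw [Multiset.prod_eq_zero h] at hprod
    exact one_ne_zero hprod
  have hcard : A.charpoly.roots.card = 2 * N := by
    rw [← (IsAlgClosed.splits A.charpoly).natDegree_eq_card_roots, A.charpoly_natDegree_eq_dim,
      Fintype.card_fin]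
  obtain ⟨t, ht, hS⟩ := exists_add_map_inv _ (roots_charpoly_map_inv hA) h0 hprod.symm N hcard
  obtain ⟨l, rfl⟩ : ∃ l : List ℂ, t = l := ⟨t.toList, by simp⟩
  simp only [Multiset.coe_card] at ht
  subst ht
  refine ⟨l.get, fun i hi => h0 ?_, fun k => ?_⟩
  · rw [hS, ← hi]
    simp
  · rw [trace_pow_eq_sum_roots, hS, Multiset.map_add, Multiset.sum_add, Finset.sum_add_distrib]
    simp only [Multiset.map_coe, Multiset.sum_coe]
    congr 1
    · rw [← List.sum_ofFn]
      congr 1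
      exact (List.ext_get (by simp) fun i h1 h2 => by simp)
    · rw [← List.sum_ofFn]
      congr 1
      exact (List.ext_get (by simp) fun i h1 h2 => by simp)

end SymplecticHaar

namespace SymplecticHaar

variable {N : ℕ} {K : Type*} [Field K]

/-- `u ^ n + u ^ (-n)`. -/
def zcosh (u : K) (n : ℤ) : K := u ^ n + u ^ (-n)

/-- `u ^ n - u ^ (-n)`. -/
def zsinh (u : K) (n : ℤ) : K := u ^ n - u ^ (-n)

theorem zcosh_neg (u : K) (n : ℤ) : zcosh u (-n) = zcosh u n := by
  simp [zcosh, add_comm]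

theorem zsinh_neg (u : K) (n : ℤ) : zsinh u (-n) = -zsinh u n := by
  simp [zsinh]

theorem zcosh_natCast_dist (u : K) (a b : ℕ) :
    zcosh u (Nat.dist a b : ℕ) = zcosh u ((a : ℤ) - b) := by
  rcases le_total a b with h | h
  · rw [Nat.dist_eq_sub_of_le h, Nat.cast_sub h, ← zcosh_neg, neg_sub]
  · rw [Nat.dist_eq_sub_of_le_right h, Nat.cast_sub h]

theorem zcosh_mul_zcosh {u : K} (hu : u ≠ 0) (a b : ℤ) :
    zcosh u a * zcosh u b = zcosh u (a + b) + zcosh u (a - b) := by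
  simp only [zcosh, neg_add, sub_eq_add_neg, zpow_add₀ hu, neg_neg]
  ring

theorem zsinh_mul_zsinh {u : K} (hu : u ≠ 0) (a b : ℤ) :
    zsinh u a * zsinh u b = zcosh u (a + b) - zcosh u (a - b) := by
  simp only [zcosh, zsinh, neg_add, sub_eq_add_neg, zpow_add₀ hu, neg_neg]
  ring

theorem zsinh_mul_zcosh {u : K} (hu : u ≠ 0) (a b : ℤ) :
    zsinh u a * zcosh u b = zsinh u (a + b) + zsinh u (a - b) := by
  simp only [zcosh, zsinh, neg_add, sub_eq_add_neg, zpow_add₀ hu, neg_neg]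
  ring

theorem zsinh_one_mul_sum_zcosh {u : K} (hu : u ≠ 0) (k : ℕ) :
    zsinh u 1 * ∑ l ∈ Finset.range k, zcosh u (k - 2 * l) = zsinh u k * zcosh u 1 := by
  have h : ∀ n : ℕ, zsinh u 1 * ∑ l ∈ Finset.range n, zcosh u (k - 2 * l) =
      zsinh u (k + 1) - zsinh u (k + 1 - 2 * n) := by
    intro n
    induction n with
    | zero => simp
    | succ n ih =>
      rw [Finset.sum_range_succ, mul_add, ih, zsinh_mul_zcosh hu, ← neg_sub _ (1 : ℤ), zsinh_neg]
      push_cast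
      ring_nf
  rw [h, zsinh_mul_zcosh hu, ← neg_neg (zsinh u (k - 1)), ← zsinh_neg]
  ring_nf

theorem zcosh_one_body {u : K} (hu : u ≠ 0) (k : ℕ) :
    zsinh u 1 * (k * zcosh u k) + 2 * zsinh u k * zcosh u 1 =
      zsinh u 1 * ∑ l ∈ Finset.range k, (zcosh u l * zcosh u (k - l) + zcosh u (l - (k - l))) := by
  have h1 : ∀ l : ℕ, zcosh u l * zcosh u (k - l) + zcosh u (l - (k - l)) =
      zcosh u k + 2 * zcosh u (k - 2 * l) := by
    intro l
    rw [zcosh_mul_zcosh hu, ← zcosh_neg u (k - 2 * l)]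
    ring_nf
  simp only [h1, Finset.sum_add_distrib, ← Finset.mul_sum, Finset.sum_const, Finset.card_range,
    nsmul_eq_mul]
  rw [mul_add, mul_left_comm _ 2, zsinh_one_mul_sum_zcosh hu]
  ring

theorem zcosh_two_body {u v : K} (hu : u ≠ 0) (hv : v ≠ 0) (k : ℕ) :
    (zcosh u 1 - zcosh v 1) * ∑ l ∈ Finset.range k,
      (zcosh u l * zcosh v (k - l) + zcosh v l * zcosh u (k - l)) =
    2 * (zsinh u k * zsinh u 1 - zsinh v k * zsinh v 1) := by
  have h : ∀ {u v : K}, u ≠ 0 → v ≠ 0 → ∀ n : ℕ, (zcosh u 1 - zcosh v 1) *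
      ∑ l ∈ Finset.range n, zcosh v l * zcosh u (k - l) =
      zcosh v 0 * zcosh u (k + 1) - zcosh v n * zcosh u (k + 1 - n)
       + zcosh v (n - 1) * zcosh u (k - n) - zcosh v (-1) * zcosh u k := by
    intro u v hu hv n
    induction n with
    | zero => simp
    | succ n ih =>
      rw [Finset.sum_range_succ, mul_add, ih]
      have h1 := zcosh_mul_zcosh hu (k - n) 1
      have h2 := zcosh_mul_zcosh hv n 1
      push_cast
      have e1 : (k : ℤ) + 1 - n = k - n + 1 := by ring
      have e2 : (k : ℤ) + 1 - (n + 1) = k - n := by ring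
      have e3 : (k : ℤ) - (n + 1) = k - n - 1 := by ring
      have e4 : (n : ℤ) + 1 - 1 = n := by ring
      rw [e1, e2, e3, e4]
      linear_combination zcosh v n * h1 - zcosh u (k - n) * h2
  have h1 := h hu hv k
  have h2 := h hv hu k
  have e1 : (k : ℤ) + 1 - k = 1 := by ring
  rw [e1, sub_self, zcosh_neg] at h1 h2
  have h3 := zsinh_mul_zsinh hu k 1
  have h4 := zsinh_mul_zsinh hv k 1
  rw [Finset.sum_add_distrib, mul_add, h1, h3, h4, ← neg_sub, neg_mul, h2]
  simp only [zcosh, neg_zero, zpow_zero]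
  ring

theorem zcosh_many_body {u : Fin N → K} (hu : ∀ i, u i ≠ 0) (hs : ∀ i, zsinh (u i) 1 ≠ 0)
    (hy : ∀ i j, i ≠ j → zcosh (u i) 1 - zcosh (u j) 1 ≠ 0) (h2 : (2 : K) ≠ 0) (k : ℕ) :
    k * ∑ i, zcosh (u i) k + 2 * ∑ i, zsinh (u i) k * (zcosh (u i) 1 / zsinh (u i) 1 +
      ∑ j ∈ Finset.univ.erase i, zsinh (u i) 1 / (zcosh (u i) 1 - zcosh (u j) 1)) =
    ∑ l ∈ Finset.range k, ((∑ i, zcosh (u i) l) * (∑ i, zcosh (u i) (k - l)) +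
      ∑ i, zcosh (u i) (l - (k - l))) := by
  have h1 : ∀ i, k * zcosh (u i) k + 2 * (zsinh (u i) k * (zcosh (u i) 1 / zsinh (u i) 1)) =
      ∑ l ∈ Finset.range k, (zcosh (u i) l * zcosh (u i) (k - l) +
        zcosh (u i) (l - (k - l))) := by
    intro i
    refine mul_left_cancel₀ (hs i) ?_
    rw [← zcosh_one_body (hu i)]
    field_simp [hs i]
  have h3 : 2 * ∑ i, ∑ j ∈ Finset.univ.erase i,
      zsinh (u i) k * (zsinh (u i) 1 / (zcosh (u i) 1 - zcosh (u j) 1)) =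
      ∑ i, ∑ j ∈ Finset.univ.erase i, ∑ l ∈ Finset.range k,
        zcosh (u i) l * zcosh (u j) (k - l) := by
    have swap : ∀ f : Fin N → Fin N → K, ∑ i, ∑ j ∈ Finset.univ.erase i, f i j =
        ∑ i, ∑ j ∈ Finset.univ.erase i, f j i := by
      intro f
      refine Finset.sum_comm' ?_
      intro i j
      simp [eq_comm, ne_eq]
    refine mul_left_cancel₀ h2 ?_
    rw [two_mul (∑ i, ∑ j ∈ Finset.univ.erase i, zsinh (u i) k * _), two_mul (∑ i, ∑ j ∈ Finset.univ.erase i, ∑ l ∈ Finset.range k, _)]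
    nth_rw 2 [swap]
    nth_rw 4 [swap]
    simp only [← Finset.sum_add_distrib, Finset.mul_sum]
    refine Finset.sum_congr rfl fun i _ => Finset.sum_congr rfl fun j hj => ?_
    have hij : i ≠ j := (Finset.ne_of_mem_erase hj).symm
    have := zcosh_two_body (hu i) (hu j) k
    refine mul_left_cancel₀ (hy i j hij) ?_
    rw [this]
    have h5 := hy i j hij
    have h6 : zcosh (u j) 1 - zcosh (u i) 1 ≠ 0 := hy j i hij.symm
    have h7 : zcosh (u j) 1 - zcosh (u i) 1 = -(zcosh (u i) 1 - zcosh (u j) 1) := by ring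
    rw [h7, div_neg]
    field_simp
    ring
  have h4 : ∀ l : ℕ, (∑ i, zcosh (u i) l) * (∑ i, zcosh (u i) (k - l)) =
      ∑ i, zcosh (u i) l * zcosh (u i) (k - l) +
      ∑ i, ∑ j ∈ Finset.univ.erase i, zcosh (u i) l * zcosh (u j) (k - l) := by
    intro l
    rw [Finset.sum_mul_sum, ← Finset.sum_add_distrib]
    refine Finset.sum_congr rfl fun i _ => ?_
    rw [Finset.add_sum_erase _ (fun j => zcosh (u i) l * zcosh (u j) (k - l)) (Finset.mem_univ i)]
  calc _ = ∑ i, (k * zcosh (u i) k + 2 * (zsinh (u i) k * (zcosh (u i) 1 / zsinh (u i) 1))) +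
        2 * ∑ i, ∑ j ∈ Finset.univ.erase i,
      zsinh (u i) k * (zsinh (u i) 1 / (zcosh (u i) 1 - zcosh (u j) 1)) := by
        simp only [mul_add, Finset.sum_add_distrib, Finset.mul_sum]
        ring
    _ = _ := by
      rw [h3]
      simp only [h1, h4, Finset.sum_add_distrib]
      have e1 : ∀ f : Fin N → ℕ → K, ∑ i, ∑ l ∈ Finset.range k, f i l =
        ∑ l ∈ Finset.range k, ∑ i, f i l := fun f => Finset.sum_comm
      have e2 : ∑ i, ∑ j ∈ Finset.univ.erase i, ∑ l ∈ Finset.range k,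
        zcosh (u i) l * zcosh (u j) (k - l) = ∑ l ∈ Finset.range k, ∑ i, ∑ j ∈ Finset.univ.erase i,
        zcosh (u i) l * zcosh (u j) (k - l) := by
        rw [Finset.sum_comm]
        exact Finset.sum_congr rfl fun i _ => Finset.sum_comm
      rw [e1, e1, e2]
      ring

end SymplecticHaar

namespace SymplecticHaar

variable {N : ℕ}

/-- Laurent polynomials in `N` variables. -/
abbrev Tor (N : ℕ) : Type := AddMonoidAlgebra ℂ (Fin N → ℤ)

/-- The Fourier multiplier with symbol `w`. -/
def torDiag (w : (Fin N → ℤ) → ℂ) : Tor N →ₗ[ℂ] Tor N where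
  toFun f := .ofCoeff (Finsupp.onFinset f.coeff.support (fun m => w m * f.coeff m)
    fun m hm => by simpa using right_ne_zero_of_mul hm)
  map_add' f g := by
    ext m
    simp [mul_add]
  map_smul' c f := by
    ext m
    simp [mul_left_comm]

@[simp]
theorem coeff_torDiag (w : (Fin N → ℤ) → ℂ) (f : Tor N) (m : Fin N → ℤ) :
    (torDiag w f).coeff m = w m * f.coeff m := by
  simp [torDiag]

theorem torDiag_single (w : (Fin N → ℤ) → ℂ) (m : Fin N → ℤ) (r : ℂ) :
    torDiag w (AddMonoidAlgebra.single m r) = w m • AddMonoidAlgebra.single m r := by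
  ext n
  by_cases h : m = n
  · subst h; simp
  · simp [h]

/-- The invariant derivation of the torus along coordinate `i`. -/
def torDer (i : Fin N) : Derivation ℂ (Tor N) (Tor N) :=
  Derivation.mk' (torDiag fun m => (m i : ℂ)) fun a b => by
    induction a using AddMonoidAlgebra.induction_linear with
    | zero => simp
    | add a a' ha ha' => rw [add_mul, map_add, ha, ha', map_add]; simp only [smul_eq_mul]; ring
    | single m r =>
      induction b using AddMonoidAlgebra.induction_linear with
      | zero => simp
      | add b b' hb hb' => rw [mul_add, map_add, hb, hb', map_add]; simp only [smul_eq_mul]; ring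
      | single n s =>
        simp only [AddMonoidAlgebra.single_mul_single, torDiag_single, smul_eq_mul,
          mul_smul_comm, Pi.add_apply, Int.cast_add, add_smul]
        rw [add_comm n m, mul_comm s r, add_comm]

@[simp]
theorem coeff_torDer (i : Fin N) (f : Tor N) (m : Fin N → ℤ) :
    (torDer i f).coeff m = m i * f.coeff m :=
  coeff_torDiag _ f m

theorem torDer_single (i : Fin N) (m : Fin N → ℤ) (r : ℂ) :
    torDer i (AddMonoidAlgebra.single m r) = (m i : ℂ) • AddMonoidAlgebra.single m r :=
  torDiag_single _ m r

/-- `xᵢᵏ + xᵢ⁻ᵏ`. -/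
def torCosh (i : Fin N) (k : ℤ) : Tor N :=
  AddMonoidAlgebra.single (Pi.single i k) 1 + AddMonoidAlgebra.single (Pi.single i (-k)) 1

/-- `xᵢᵏ - xᵢ⁻ᵏ`. -/
def torSinh (i : Fin N) (k : ℤ) : Tor N :=
  AddMonoidAlgebra.single (Pi.single i k) 1 - AddMonoidAlgebra.single (Pi.single i (-k)) 1

theorem torDer_torCosh_self (i : Fin N) (k : ℤ) : torDer i (torCosh i k) = (k : Tor N) * torSinh i k := by
  simp only [torCosh, torSinh, map_add, torDer_single, Pi.single_eq_same, mul_sub]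
  rw [Int.cast_smul_eq_zsmul, Int.cast_smul_eq_zsmul, zsmul_eq_mul, zsmul_eq_mul, Int.cast_neg]
  ring

theorem torDer_torSinh_self (i : Fin N) (k : ℤ) : torDer i (torSinh i k) = (k : Tor N) * torCosh i k := by
  simp only [torCosh, torSinh, map_sub, torDer_single, Pi.single_eq_same, mul_add]
  rw [Int.cast_smul_eq_zsmul, Int.cast_smul_eq_zsmul, zsmul_eq_mul, zsmul_eq_mul, Int.cast_neg]
  ring

theorem torDer_torCosh_of_ne {i j : Fin N} (h : i ≠ j) (k : ℤ) : torDer i (torCosh j k) = 0 := by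
  simp [torCosh, torDer_single, Pi.single_eq_of_ne h]

theorem torDer_torSinh_of_ne {i j : Fin N} (h : i ≠ j) (k : ℤ) : torDer i (torSinh j k) = 0 := by
  simp [torSinh, torDer_single, Pi.single_eq_of_ne h]

/-- The coordinate `xᵢ` in the field of rational functions. -/
def torVar (i : Fin N) : FractionRing (Tor N) :=
  algebraMap (Tor N) _ (AddMonoidAlgebra.single (Pi.single i 1) 1)

theorem torVar_ne_zero (i : Fin N) : torVar i ≠ 0 := by
  rw [torVar, Ne, FaithfulSMul.algebraMap_eq_zero_iff]
  simp

theorem algebraMap_single_zpow (i : Fin N) (k : ℤ) :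
    algebraMap (Tor N) (FractionRing (Tor N)) (AddMonoidAlgebra.single (Pi.single i k) 1) =
      torVar i ^ k := by
  have hnat : ∀ k : ℕ, algebraMap (Tor N) (FractionRing (Tor N))
      (AddMonoidAlgebra.single (Pi.single i (k : ℤ)) 1) = torVar i ^ k := by
    intro k
    rw [torVar, ← map_pow, AddMonoidAlgebra.single_pow, one_pow, ← Pi.single_smul]
    simp
  obtain ⟨n, rfl | rfl⟩ := k.eq_nat_or_neg
  · rw [hnat, zpow_natCast]
  · rw [_root_.zpow_neg, zpow_natCast, ← hnat]
    refine eq_inv_of_mul_eq_one_left ?_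
    rw [← map_mul, AddMonoidAlgebra.single_mul_single, ← Pi.single_add]
    simp [← AddMonoidAlgebra.one_def]

theorem algebraMap_torCosh (i : Fin N) (k : ℤ) :
    algebraMap (Tor N) (FractionRing (Tor N)) (torCosh i k) = zcosh (torVar i) k := by
  simp only [torCosh, zcosh, map_add, algebraMap_single_zpow]

theorem algebraMap_torSinh (i : Fin N) (k : ℤ) :
    algebraMap (Tor N) (FractionRing (Tor N)) (torSinh i k) = zsinh (torVar i) k := by
  simp only [torSinh, zsinh, map_sub, algebraMap_single_zpow]

theorem torSinh_mul_torCosh (i : Fin N) (a b : ℤ) :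
    torSinh i a * torCosh i b = torSinh i (a + b) + torSinh i (a - b) := by
  apply FaithfulSMul.algebraMap_injective (Tor N) (FractionRing (Tor N))
  simp only [map_mul, map_add, algebraMap_torCosh, algebraMap_torSinh]
  exact zsinh_mul_zcosh (torVar_ne_zero i) a b

theorem torSinh_mul_torSinh (i : Fin N) (a b : ℤ) :
    torSinh i a * torSinh i b = torCosh i (a + b) - torCosh i (a - b) := by
  apply FaithfulSMul.algebraMap_injective (Tor N) (FractionRing (Tor N))
  simp only [map_mul, map_sub, algebraMap_torCosh, algebraMap_torSinh]
  exact zsinh_mul_zsinh (torVar_ne_zero i) a b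

theorem torCosh_natCast_dist (i : Fin N) (a b : ℕ) :
    torCosh i (Nat.dist a b : ℕ) = torCosh i ((a : ℤ) - b) := by
  apply FaithfulSMul.algebraMap_injective (Tor N) (FractionRing (Tor N))
  simp only [algebraMap_torCosh]
  exact zcosh_natCast_dist _ a b

theorem torSinh_one_ne_zero (i : Fin N) : torSinh i 1 ≠ 0 := by
  intro h
  have h2 := congrArg (fun f => f.coeff (Pi.single i 1)) h
  have h3 : (Pi.single i (-1) : Fin N → ℤ) ≠ Pi.single i 1 := fun h => by
    have := congrFun h i
    simp at this
  simp [torSinh] at h2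

theorem torCosh_sub_ne_zero {i j : Fin N} (hij : i ≠ j) : torCosh i 1 - torCosh j 1 ≠ 0 := by
  intro h
  have h2 := congrArg (fun f => f.coeff (Pi.single i 1)) h
  have h3 : (Pi.single i (-1) : Fin N → ℤ) ≠ Pi.single i 1 := fun h => by
    have := congrFun h i
    simp at this
  have h4 : ∀ c : ℤ, (Pi.single j c : Fin N → ℤ) ≠ Pi.single i 1 := fun c h => by
    have := congrFun h i
    simp [Pi.single_eq_of_ne hij] at this
  simp [torCosh, h4] at h2

/-- The Weyl denominator. -/
def weylDenom (N : ℕ) : Tor N :=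
  (Matrix.of fun i j : Fin N => torSinh i ((j : ℤ) + 1)).det

theorem monic_chebyshev_S (R : Type*) [CommRing R] [Nontrivial R] (n : ℕ) :
    (Polynomial.Chebyshev.S R n).natDegree = n ∧ (Polynomial.Chebyshev.S R n).Monic := by
  induction n using Nat.strong_induction_on with
  | _ n ih =>
    match n with
    | 0 => simp
    | 1 => simp [Polynomial.monic_X]
    | n + 2 =>
      obtain ⟨d1, m1⟩ := ih (n + 1) (by omega)
      obtain ⟨d0, m0⟩ := ih n (by omega)
      have h : Polynomial.Chebyshev.S R ((n + 2 : ℕ) : ℤ) =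
          Polynomial.X * Polynomial.Chebyshev.S R ((n + 1 : ℕ) : ℤ) -
            Polynomial.Chebyshev.S R (n : ℤ) := by
        push_cast
        exact Polynomial.Chebyshev.S_add_two R n
      have m2 := Polynomial.monic_X.mul m1
      have d2 : (Polynomial.X * Polynomial.Chebyshev.S R ((n + 1 : ℕ) : ℤ)).natDegree = n + 2 := by
        rw [Polynomial.monic_X.natDegree_mul m1, d1, Polynomial.natDegree_X]
        ring
      have lt : (Polynomial.Chebyshev.S R (n : ℤ)).degree <
          (Polynomial.X * Polynomial.Chebyshev.S R ((n + 1 : ℕ) : ℤ)).degree :=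
        Polynomial.degree_lt_degree (by rw [d2, d0]; omega)
      rw [h]
      refine ⟨?_, m2.sub_of_left lt⟩
      rw [Polynomial.natDegree_sub_eq_left_of_natDegree_lt (by rw [d2, d0]; omega), d2]

theorem torSinh_add_one (i : Fin N) (n : ℕ) : torSinh i ((n : ℤ) + 1) =
    torSinh i 1 * (Polynomial.Chebyshev.S (Tor N) n).eval (torCosh i 1) := by
  induction n using Nat.strong_induction_on with
  | _ n ih =>
    match n with
    | 0 => simp
    | 1 =>
      have := torSinh_mul_torCosh i 1 1
      have h0 : torSinh i 0 = 0 := by simp [torSinh]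
      rw [sub_self, h0, add_zero] at this
      rw [Nat.cast_one, Polynomial.Chebyshev.S_one, Polynomial.eval_X, this]
    | n + 2 =>
      have h1 := ih (n + 1) (by omega)
      have h0 := ih n (by omega)
      have := torSinh_mul_torCosh i ((n : ℤ) + 2) 1
      push_cast at h1 h0 ⊢
      rw [Polynomial.Chebyshev.S_add_two, Polynomial.eval_sub, Polynomial.eval_mul,
        Polynomial.eval_X]
      have e1 : (n : ℤ) + 2 - 1 = n + 1 := by ring
      have e2 : (n : ℤ) + 1 + 1 = n + 2 := by ring
      rw [e1] at this
      rw [e2] at h1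
      linear_combination -this + torCosh i 1 * h1 - h0

theorem weylDenom_eq_prod : weylDenom N =
    (∏ i, torSinh i 1) * ∏ i : Fin N, ∏ j ∈ Finset.Ioi i, (torCosh j 1 - torCosh i 1) := by
  rw [← Matrix.det_vandermonde, Matrix.det_eval_matrixOfPolynomials_eq_det_vandermonde _
    (fun j : Fin N => Polynomial.Chebyshev.S (Tor N) j)
    (fun j => (monic_chebyshev_S _ _).1) (fun j => (monic_chebyshev_S _ _).2),
    ← Matrix.det_mul_column, weylDenom]
  congr 1
  ext1 i j
  exact torSinh_add_one i j

theorem weylDenom_ne_zero : weylDenom N ≠ 0 := by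
  rw [weylDenom_eq_prod]
  refine mul_ne_zero (Finset.prod_ne_zero_iff.2 fun i _ => torSinh_one_ne_zero i)
    (Finset.prod_ne_zero_iff.2 fun i _ => Finset.prod_ne_zero_iff.2 fun j hj =>
      torCosh_sub_ne_zero (Finset.mem_Ioi.1 hj).ne')

end SymplecticHaar

namespace SymplecticHaar

variable {N : ℕ}

/-- Logarithmic derivative along coordinate `i`. -/
def torLog (i : Fin N) (f : Tor N) : FractionRing (Tor N) :=
  algebraMap (Tor N) _ (torDer i f) / algebraMap (Tor N) _ f

theorem algebraMap_tor_ne_zero {f : Tor N} (hf : f ≠ 0) :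
    algebraMap (Tor N) (FractionRing (Tor N)) f ≠ 0 := by
  rwa [Ne, FaithfulSMul.algebraMap_eq_zero_iff]

theorem torLog_mul (i : Fin N) {f g : Tor N} (hf : f ≠ 0) (hg : g ≠ 0) :
    torLog i (f * g) = torLog i f + torLog i g := by
  have h1 := algebraMap_tor_ne_zero hf
  have h2 := algebraMap_tor_ne_zero hg
  simp only [torLog, Derivation.leibniz, map_add, map_mul, smul_eq_mul]
  field_simp
  ring

theorem torLog_prod {ι : Type*} (i : Fin N) (s : Finset ι) (f : ι → Tor N) (hf : ∀ a ∈ s, f a ≠ 0) :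
    torLog i (∏ a ∈ s, f a) = ∑ a ∈ s, torLog i (f a) := by
  classical
  induction s using Finset.induction_on with
  | empty => simp [torLog]
  | insert a s ha ih =>
    rw [Finset.prod_insert ha, Finset.sum_insert ha, torLog_mul, ih]
    · exact fun b hb => hf b (Finset.mem_insert_of_mem hb)
    · exact hf a (Finset.mem_insert_self a s)
    · exact Finset.prod_ne_zero_iff.2 fun b hb => hf b (Finset.mem_insert_of_mem hb)

theorem zero_sub_div_sub {K : Type*} [Field K] (a b c : K) : (0 - a) / (b - c) = a / (c - b) := by
  rw [zero_sub, ← neg_sub c b, neg_div_neg_eq]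

theorem torLog_weylDenom (i : Fin N) : torLog i (weylDenom N) =
    zcosh (torVar i) 1 / zsinh (torVar i) 1 + ∑ j ∈ Finset.univ.erase i,
      zsinh (torVar i) 1 / (zcosh (torVar i) 1 - zcosh (torVar j) 1) := by
  rw [weylDenom_eq_prod, torLog_mul, torLog_prod, torLog_prod]
  rotate_left
  · exact fun a _ => Finset.prod_ne_zero_iff.2 fun j hj =>
      torCosh_sub_ne_zero (Finset.mem_Ioi.1 hj).ne'
  · exact fun a _ => torSinh_one_ne_zero a
  · exact Finset.prod_ne_zero_iff.2 fun i _ => torSinh_one_ne_zero i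
  · exact Finset.prod_ne_zero_iff.2 fun i _ => Finset.prod_ne_zero_iff.2 fun j hj =>
      torCosh_sub_ne_zero (Finset.mem_Ioi.1 hj).ne'
  congr 1
  · rw [Finset.sum_eq_single i]
    · rw [torLog, torDer_torSinh_self]
      simp [algebraMap_torCosh, algebraMap_torSinh]
    · intro b _ hb
      rw [torLog, torDer_torSinh_of_ne hb.symm]
      simp
    · simp
  · have h1 : ∀ a b : Fin N, a < b → torLog i (torCosh b 1 - torCosh a 1) =
        (if i = a then zsinh (torVar i) 1 / (zcosh (torVar i) 1 - zcosh (torVar b) 1) else 0) +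
        (if i = b then zsinh (torVar i) 1 / (zcosh (torVar i) 1 - zcosh (torVar a) 1) else 0) := by
      intro a b hab
      rw [torLog, map_sub, map_sub, map_sub]
      by_cases ha : i = a
      · subst ha
        rw [torDer_torCosh_of_ne hab.ne, torDer_torCosh_self, if_pos rfl, if_neg hab.ne]
        simp only [map_zero, map_mul, algebraMap_torCosh, algebraMap_torSinh, map_intCast]
        rw [Int.cast_one, one_mul, add_zero]
        exact zero_sub_div_sub _ _ _
      · by_cases hb : i = b
        · subst hb
          rw [torDer_torCosh_of_ne hab.ne', torDer_torCosh_self, if_pos rfl, if_neg ha]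
          simp [algebraMap_torCosh, algebraMap_torSinh]
        · rw [torDer_torCosh_of_ne ha, torDer_torCosh_of_ne hb, if_neg ha, if_neg hb]
          simp
    rw [Finset.sum_congr rfl fun a _ => (torLog_prod i
      (Finset.Ioi a) (fun b => torCosh b 1 - torCosh a 1) fun b hb =>
      torCosh_sub_ne_zero (Finset.mem_Ioi.1 hb).ne')]
    rw [Finset.sum_congr rfl fun a _ => Finset.sum_congr rfl fun b hb => h1 a b (Finset.mem_Ioi.1 hb)]
    simp only [Finset.sum_add_distrib]
    have h2 : (Finset.univ.erase i : Finset (Fin N)) = Finset.Ioi i ∪ Finset.Iio i := by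
      ext b
      simp only [Finset.mem_erase, Finset.mem_univ, and_true, Finset.mem_union, Finset.mem_Ioi,
        Finset.mem_Iio]
      rw [or_comm]
      exact ne_iff_lt_or_gt
    have h3 : Disjoint (Finset.Ioi i : Finset (Fin N)) (Finset.Iio i) := by
      rw [Finset.disjoint_left]
      intro b hb hb'
      exact absurd (Finset.mem_Ioi.1 hb) (Finset.mem_Iio.1 hb').not_gt
    rw [h2, Finset.sum_union h3]
    congr 1
    · rw [Finset.sum_eq_single i]
      · simp
      · intro b _ hb
        simp [hb.symm]
      · simp
    · rw [Finset.sum_comm' (t' := Finset.univ) (s' := fun b => Finset.Iio b)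
        (by intro a b; simp)]
      rw [Finset.sum_eq_single i]
      · simp
      · intro b _ hb
        simp [hb.symm]
      · simp

/-- Symmetric functions of the eigenvalues as Laurent polynomials. -/
def toTor (N : ℕ) : MvPolynomial ℕ ℂ →ₐ[ℂ] Tor N :=
  MvPolynomial.aeval fun k => ∑ i, torCosh i k

theorem toTor_X (k : ℕ) : toTor N (MvPolynomial.X k) = ∑ i, torCosh i k := by
  simp [toTor]

theorem toTor_X_dist (k m : ℕ) :
    toTor N (MvPolynomial.X (Nat.dist k m)) = ∑ i, torCosh i ((k : ℤ) - m) := by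
  simp [toTor_X, torCosh_natCast_dist]

theorem two_mul_sum_torSinh_mul_torDer_weylDenom (k : ℕ) :
    ((k : Tor N) * ∑ i : Fin N, torCosh i k) * weylDenom N + 2 * ∑ i : Fin N, torSinh i k * torDer i (weylDenom N) =
      toTor N (loopPoly k) * weylDenom N := by
  apply FaithfulSMul.algebraMap_injective (Tor N) (FractionRing (Tor N))
  have h0 := algebraMap_tor_ne_zero (weylDenom_ne_zero (N := N))
  have two_ne : (2 : Tor N) ≠ 0 := by
    rw [← map_ofNat (algebraMap ℂ (Tor N)) 2]
    exact (map_ne_zero_iff _ (FaithfulSMul.algebraMap_injective ℂ (Tor N))).2 two_ne_zero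
  have two_ne' : (2 : FractionRing (Tor N)) ≠ 0 := by
    have := algebraMap_tor_ne_zero two_ne
    rwa [map_ofNat] at this
  have h1 := zcosh_many_body (u := torVar (N := N)) torVar_ne_zero
    (fun i => by rw [← algebraMap_torSinh]; exact algebraMap_tor_ne_zero (torSinh_one_ne_zero i))
    (fun i j hij => by
      rw [← algebraMap_torCosh, ← algebraMap_torCosh, ← map_sub]
      exact algebraMap_tor_ne_zero (torCosh_sub_ne_zero hij)) two_ne' k
  simp only [← torLog_weylDenom] at h1
  have h2 : algebraMap (Tor N) (FractionRing (Tor N)) (toTor N (loopPoly k)) =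
      ∑ l ∈ Finset.range k, ((∑ i, zcosh (torVar (N := N) i) l) * (∑ i, zcosh (torVar (N := N) i) (k - l)) +
      ∑ i, zcosh (torVar (N := N) i) (l - (k - l))) := by
    rw [loopPoly, map_sum, map_sum]
    refine Finset.sum_congr rfl fun l hl => ?_
    have hl' : l ≤ k := (Finset.mem_range.1 hl).le
    rw [map_add, map_mul, toTor_X_dist, toTor_X, toTor_X]
    simp only [map_add, map_mul, map_sum, algebraMap_torCosh, Nat.cast_sub hl']
  have h3 : ∀ i, algebraMap (Tor N) (FractionRing (Tor N)) (torDer i (weylDenom N)) =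
      torLog i (weylDenom N) * algebraMap (Tor N) (FractionRing (Tor N)) (weylDenom N) :=
    fun i => (div_mul_cancel₀ _ h0).symm
  rw [map_mul, h2, ← h1, map_add, map_mul, map_mul, map_mul, map_sum, map_sum, map_natCast,
    map_ofNat]
  simp only [map_mul, h3, algebraMap_torCosh, algebraMap_torSinh, ← mul_assoc]
  rw [← Finset.sum_mul, add_mul, ← mul_assoc]

theorem torDer_toTor (i : Fin N) (h : MvPolynomial ℕ ℂ) : torDer i (toTor N h) =
    ∑ m ∈ h.vars, toTor N (MvPolynomial.pderiv m h) * ((m : Tor N) * torSinh i m) := by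
  let : Module (MvPolynomial ℕ ℂ) (Tor N) := Module.compHom _ (toTor N).toRingHom
  have : IsScalarTower ℂ (MvPolynomial ℕ ℂ) (Tor N) :=
    ⟨fun c p x => by
      change toTor N (c • p) * x = c • (toTor N p * x)
      rw [map_smul, smul_mul_assoc]⟩
  let d : Derivation ℂ (MvPolynomial ℕ ℂ) (Tor N) :=
    Derivation.mk' ((torDer i).toLinearMap ∘ₗ (toTor N).toLinearMap) fun a b => by
      change torDer i (toTor N (a * b)) = toTor N a * torDer i (toTor N b) +
        toTor N b * torDer i (toTor N a)
      rw [map_mul, Derivation.leibniz]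
      rfl
  have := derivation_eq_sum_pderiv d h
  refine this.trans (Finset.sum_congr rfl fun m _ => ?_)
  change toTor N (MvPolynomial.pderiv m h) * torDer i (toTor N (MvPolynomial.X m)) = _
  rw [toTor_X, map_sum, Finset.sum_eq_single i, torDer_torCosh_self]
  · simp
  · intro b _ hb
    exact torDer_torCosh_of_ne hb.symm _
  · simp

theorem sum_torDer_loop (k : ℕ) (h : MvPolynomial ℕ ℂ) :
    ∑ i, (torDer i (torSinh i k * toTor N h) * weylDenom N +
      2 * (torSinh i k * toTor N h) * torDer i (weylDenom N)) =
      toTor N (loopEq k h) * weylDenom N := by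
  have hkey := two_mul_sum_torSinh_mul_torDer_weylDenom (N := N) k
  have h3 : ∑ i, torSinh i k * torDer i (toTor N h) =
      toTor N (∑ m ∈ h.vars, MvPolynomial.pderiv m h *
        ((m : MvPolynomial ℕ ℂ) * (MvPolynomial.X (k + m) - MvPolynomial.X (Nat.dist k m)))) := by
    simp only [torDer_toTor, Finset.mul_sum, map_sum]
    rw [Finset.sum_comm]
    refine Finset.sum_congr rfl fun m _ => ?_
    rw [map_mul, map_mul, map_sub, map_natCast, toTor_X, toTor_X_dist]
    rw [← Finset.sum_sub_distrib, Finset.mul_sum, Finset.mul_sum]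
    refine Finset.sum_congr rfl fun i _ => ?_
    have := torSinh_mul_torSinh i k m
    push_cast
    rw [← this]
    ring
  simp only [loopEq, map_add, map_mul] at h3 ⊢
  rw [add_mul, ← h3, mul_right_comm, ← hkey]
  rw [add_mul, Finset.sum_mul, Finset.mul_sum, Finset.mul_sum, Finset.sum_mul, Finset.sum_mul,
    Finset.sum_mul, ← Finset.sum_add_distrib, ← Finset.sum_add_distrib]
  refine Finset.sum_congr rfl fun i _ => ?_
  rw [Derivation.leibniz, torDer_torSinh_self, smul_eq_mul, smul_eq_mul, Int.cast_natCast]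
  ring

end SymplecticHaar

namespace SymplecticHaar

variable {N : ℕ}

theorem coeff_torCosh_mul (i : Fin N) (k : ℤ) (h : Tor N) (m : Fin N → ℤ) :
    (torCosh i k * h).coeff m = h.coeff (m - Pi.single i k) + h.coeff (m + Pi.single i k) := by
  rw [torCosh, add_mul, AddMonoidAlgebra.coeff_add, Finsupp.add_apply]
  congr 1
  · rw [AddMonoidAlgebra.coeff_single_mul_apply]
    simp [sub_eq_neg_add]
  · rw [AddMonoidAlgebra.coeff_single_mul_apply]
    simp [add_comm, Pi.single_neg]

theorem coeff_torSinh_mul (i : Fin N) (k : ℤ) (h : Tor N) (m : Fin N → ℤ) :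
    (torSinh i k * h).coeff m = h.coeff (m - Pi.single i k) - h.coeff (m + Pi.single i k) := by
  rw [torSinh, sub_mul, AddMonoidAlgebra.coeff_sub, Finsupp.sub_apply]
  congr 1
  · rw [AddMonoidAlgebra.coeff_single_mul_apply]
    simp [sub_eq_neg_add]
  · rw [AddMonoidAlgebra.coeff_single_mul_apply]
    simp [add_comm, Pi.single_neg]

theorem coeff_prod_torSinh (s : Finset (Fin N)) (a : Fin N → ℤ) (m : Fin N → ℤ) :
    (∏ i ∈ s, torSinh i (a i)).coeff m =
      ∏ i, if i ∈ s then (if m i = a i then (1 : ℂ) else 0) - (if m i = -a i then 1 else 0) else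
        if m i = 0 then 1 else 0 := by
  induction s using Finset.induction_on generalizing m with
  | empty =>
    rw [Finset.prod_empty, AddMonoidAlgebra.one_def, AddMonoidAlgebra.coeff_single,
      Finsupp.single_apply]
    simp only [Finset.notMem_empty, if_false, Finset.prod_ite_zero, Finset.prod_const_one]
    simp [funext_iff, eq_comm]
  | insert j s hj ih =>
    rw [Finset.prod_insert hj, coeff_torSinh_mul, ih, ih]
    rw [← Finset.mul_prod_erase _ _ (Finset.mem_univ j), ← Finset.mul_prod_erase _ _ (Finset.mem_univ j),
      ← Finset.mul_prod_erase _ _ (Finset.mem_univ j)]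
    have h1 : ∀ c : ℤ, ∏ i ∈ Finset.univ.erase j, (if i ∈ s then
          (if (m + Pi.single j c : Fin N → ℤ) i = a i then (1 : ℂ) else 0) -
            (if (m + Pi.single j c : Fin N → ℤ) i = -a i then 1 else 0)
          else if (m + Pi.single j c : Fin N → ℤ) i = 0 then 1 else 0) =
        ∏ i ∈ Finset.univ.erase j, if i ∈ insert j s then (if m i = a i then (1 : ℂ) else 0) -
            (if m i = -a i then 1 else 0) else if m i = 0 then 1 else 0 := by
      intro c
      refine Finset.prod_congr rfl fun i hi => ?_
      have hij := Finset.ne_of_mem_erase hi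
      simp [hij]
    have h2 := h1 (-a j)
    rw [Pi.single_neg, ← sub_eq_add_neg] at h2
    rw [h1, h2, if_neg hj, if_neg hj, if_pos (Finset.mem_insert_self j s), ← sub_mul]
    simp [sub_eq_zero, add_eq_zero_iff_eq_neg]

/-- Coefficients of the Weyl denominator. -/
def weylMatrix (m : Fin N → ℤ) : Matrix (Fin N) (Fin N) ℂ :=
  Matrix.of fun i j => (if m i = (j : ℤ) + 1 then 1 else 0) - (if m i = -((j : ℤ) + 1) then 1 else 0)

theorem coeff_weylDenom (m : Fin N → ℤ) : (weylDenom N).coeff m = (weylMatrix m).det := by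
  rw [weylDenom, Matrix.det_apply', Matrix.det_apply', AddMonoidAlgebra.coeff_sum,
    Finsupp.finsetSum_apply]
  refine Finset.sum_congr rfl fun σ _ => ?_
  rw [← zsmul_eq_mul, AddMonoidAlgebra.coeff_smul, Finsupp.smul_apply, zsmul_eq_mul]
  congr 1
  have h1 : ∏ i : Fin N, (Matrix.of fun i j : Fin N => torSinh i ((j : ℤ) + 1)) (σ i) i =
      ∏ i, torSinh i (((σ⁻¹ i : Fin N) : ℤ) + 1) := by
    rw [← Equiv.prod_comp σ (fun i => torSinh i (((σ⁻¹ i : Fin N) : ℤ) + 1))]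
    simp
  rw [h1, coeff_prod_torSinh Finset.univ (fun i => ((σ⁻¹ i : Fin N) : ℤ) + 1),
    ← Equiv.prod_comp σ]
  simp [weylMatrix]

/-- Alternating under permutations and odd under sign changes. -/
structure IsAltOdd (h : (Fin N → ℤ) → ℂ) : Prop where
  perm : ∀ (σ : Equiv.Perm (Fin N)) m, h (m ∘ σ) = (Equiv.Perm.sign σ : ℤ) * h m
  flip : ∀ (i : Fin N) m, h (Function.update m i (-m i)) = -h m

theorem isAltOdd_weylDenom : IsAltOdd (weylDenom N).coeff where
  perm σ m := by
    rw [coeff_weylDenom, coeff_weylDenom, ← Matrix.det_permute]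
    rfl
  flip i m := by
    rw [coeff_weylDenom, coeff_weylDenom]
    have h : weylMatrix (Function.update m i (-m i)) =
        (weylMatrix m).updateRow i ((-1 : ℂ) • weylMatrix m i) := by
      ext a b
      by_cases ha : a = i
      · subst ha
        simp [weylMatrix, neg_eq_iff_eq_neg]
      · simp [weylMatrix, ha]
    rw [h, Matrix.det_updateRow_smul, Matrix.updateRow_eq_self]
    simp

theorem IsAltOdd.toTor_mul {h : Tor N} (hh : IsAltOdd h.coeff) (f : MvPolynomial ℕ ℂ) :
    IsAltOdd (toTor N f * h).coeff := by
  induction f using MvPolynomial.induction_on generalizing h with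
  | C a =>
    have : toTor N (MvPolynomial.C a) * h = a • h := by
      rw [toTor, MvPolynomial.aeval_C, Algebra.smul_def]
    rw [this]
    constructor
    · intro σ m
      rw [AddMonoidAlgebra.coeff_smul, Finsupp.smul_apply, Finsupp.smul_apply, hh.perm]
      simp only [smul_eq_mul]
      ring
    · intro i m
      rw [AddMonoidAlgebra.coeff_smul, Finsupp.smul_apply, Finsupp.smul_apply, hh.flip]
      simp
  | add p q hp hq =>
    rw [map_add, add_mul]
    constructor
    · intro σ m
      rw [AddMonoidAlgebra.coeff_add, Finsupp.add_apply, Finsupp.add_apply, (hp hh).perm, (hq hh).perm]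
      ring
    · intro i m
      rw [AddMonoidAlgebra.coeff_add, Finsupp.add_apply, Finsupp.add_apply, (hp hh).flip, (hq hh).flip]
      ring
  | mul_X p k hp =>
    rw [map_mul, mul_assoc]
    refine hp ?_
    have hc : ∀ m, (toTor N (MvPolynomial.X k) * h).coeff m =
        ∑ i, (h.coeff (m - Pi.single i (k : ℤ)) + h.coeff (m + Pi.single i (k : ℤ))) := by
      intro m
      rw [toTor_X, Finset.sum_mul, AddMonoidAlgebra.coeff_sum, Finsupp.finsetSum_apply]
      exact Finset.sum_congr rfl fun i _ => coeff_torCosh_mul _ _ _ _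
    constructor
    · intro σ m
      rw [hc, hc, Finset.mul_sum]
      refine Eq.trans ?_ (Equiv.sum_comp σ _)
      refine Finset.sum_congr rfl fun i _ => ?_
      have h1 : ∀ c : ℤ, m ∘ σ + Pi.single i c = (m + Pi.single (σ i) c) ∘ σ := by
        intro c
        ext a
        by_cases ha : a = i
        · subst ha; simp
        · simp [ha]
      have h2 := h1 (-k)
      rw [Pi.single_neg, Pi.single_neg, ← sub_eq_add_neg, ← sub_eq_add_neg] at h2
      rw [h1, h2, hh.perm, hh.perm, mul_add]
    · intro j m
      rw [hc, hc, ← Finset.sum_neg_distrib]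
      refine Finset.sum_congr rfl fun i _ => ?_
      by_cases hij : i = j
      · subst hij
        have h1 : ∀ c : ℤ, Function.update m i (-m i) + Pi.single i c =
            Function.update (m - Pi.single i c) i (-(m - Pi.single i c : Fin N → ℤ) i) := by
          intro c
          ext a
          by_cases ha : a = i
          · subst ha; simp; ring
          · simp [ha]
        have h2 := h1 (-k)
        rw [Pi.single_neg, ← sub_eq_add_neg, sub_neg_eq_add] at h2
        rw [h1, h2, hh.flip, hh.flip]
        ring
      · have h1 : ∀ c : ℤ, Function.update m j (-m j) + Pi.single i c =
            Function.update (m + Pi.single i c) j (-(m + Pi.single i c : Fin N → ℤ) j) := by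
          intro c
          ext a
          by_cases ha : a = j
          · subst ha; simp [Ne.symm hij]
          · simp [ha]
        have h2 := h1 (-k)
        rw [Pi.single_neg, ← sub_eq_add_neg, ← sub_eq_add_neg] at h2
        rw [h1, h2, hh.flip, hh.flip]
        ring

end SymplecticHaar

namespace SymplecticHaar

variable {N : ℕ}

/-- The lowest energy configuration `(1, …, N)`. -/
def weylVec (N : ℕ) : Fin N → ℤ := fun i => (i : ℤ) + 1

/-- The energy of a configuration above the ground state. -/
def excess (m : Fin N → ℤ) : ℤ := ∑ i, m i ^ 2 - ∑ i, weylVec N i ^ 2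

theorem excess_weylVec : excess (weylVec N) = 0 := sub_self _

theorem coeff_weylDenom_weylVec : (weylDenom N).coeff (weylVec N) = 1 := by
  rw [coeff_weylDenom]
  have : weylMatrix (weylVec N) = 1 := by
    ext i j
    have h : ¬ (i : ℤ) + 1 = -((j : ℤ) + 1) := by omega
    simp only [weylMatrix, weylVec, Matrix.of_apply, h, if_false, sub_zero, Matrix.one_apply]
    simp [Fin.ext_iff]
  rw [this, Matrix.det_one]

theorem excess_eq_zero_of_coeff_weylDenom_ne_zero {m : Fin N → ℤ}
    (h : (weylDenom N).coeff m ≠ 0) : excess m = 0 := by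
  rw [coeff_weylDenom, Matrix.det_apply'] at h
  obtain ⟨σ, -, hσ⟩ := Finset.exists_ne_zero_of_sum_ne_zero h
  have h1 := Finset.prod_ne_zero_iff.1 (right_ne_zero_of_mul hσ)
  rw [excess, sub_eq_zero, ← Equiv.sum_comp σ]
  refine Finset.sum_congr rfl fun i hi => ?_
  have h2 := h1 i hi
  rw [weylVec, sq_eq_sq_iff_eq_or_eq_neg]
  by_contra hc
  rw [not_or] at hc
  simp only [weylMatrix, Matrix.of_apply, if_neg hc.1, if_neg hc.2, sub_self, ne_eq, not_true] at h2

theorem strictMono_eq_of_sum_sq {g : Fin N → ℤ} (hg : StrictMono g) (h0 : ∀ i, 0 < g i)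
    (hs : ∑ i, g i ^ 2 = ∑ i, weylVec N i ^ 2) : g = weylVec N := by
  have h1 : ∀ n (hn : n < N), (n : ℤ) + 1 ≤ g ⟨n, hn⟩ := by
    intro n
    induction n with
    | zero => intro hn; have := h0 ⟨0, hn⟩; push_cast; omega
    | succ n ih =>
      intro hn
      have h2 := ih (by omega)
      have h3 : g ⟨n, by omega⟩ < g ⟨n + 1, hn⟩ := hg (by simp [Fin.lt_def])
      push_cast
      omega
  have h2 : ∀ i ∈ Finset.univ, weylVec N i ^ 2 ≤ g i ^ 2 := by
    intro i _
    have := h1 i i.2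
    have h3 : (0 : ℤ) ≤ weylVec N i := by unfold weylVec; positivity
    exact pow_le_pow_left₀ h3 this 2
  have h3 := (Finset.sum_eq_sum_iff_of_le h2).1 hs.symm
  ext i
  have h4 := h3 i (Finset.mem_univ i)
  have h5 : (0 : ℤ) ≤ weylVec N i := by unfold weylVec; positivity
  exact ((sq_eq_sq₀ h5 (h0 i).le).1 h4).symm

theorem IsAltOdd.eq_zero_of_abs {h : (Fin N → ℤ) → ℂ} (hh : IsAltOdd h) (m : Fin N → ℤ)
    (h0 : h (fun i => |m i|) = 0) : h m = 0 := by
  have key : ∀ s : Finset (Fin N), ∀ m : Fin N → ℤ,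
      (∀ i, i ∉ s → 0 ≤ m i) → h (fun i => |m i|) = 0 → h m = 0 := by
    intro s
    induction s using Finset.induction_on with
    | empty =>
      intro m hm h0
      have : (fun i => |m i|) = m := funext fun i => abs_of_nonneg (hm i (Finset.notMem_empty i))
      rwa [this] at h0
    | insert j s hj ih =>
      intro m hm h0
      rcases le_or_gt 0 (m j) with h1 | h1
      · refine ih m (fun i hi => ?_) h0
        by_cases hij : i = j
        · rwa [hij]
        · exact hm i (by simp [hij, hi])
      · rw [← neg_eq_zero, ← hh.flip j]
        refine ih _ (fun i hi => ?_) ?_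
        · by_cases hij : i = j
          · rw [hij, Function.update_self]; omega
          · rw [Function.update_of_ne hij]; exact hm i (by simp [hij, hi])
        · rw [← h0]
          congr 1
          ext i
          by_cases hij : i = j
          · rw [hij, Function.update_self, abs_neg]
          · rw [Function.update_of_ne hij]
  exact key Finset.univ m (fun i hi => absurd (Finset.mem_univ i) hi) h0

theorem IsAltOdd.eq_zero_of_not_injective {h : (Fin N → ℤ) → ℂ} (hh : IsAltOdd h) {m : Fin N → ℤ}
    (hm : ¬ Function.Injective m) : h m = 0 := by
  rw [Function.not_injective_iff] at hm
  obtain ⟨i, j, hij, hne⟩ := hm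
  have h1 := hh.perm (Equiv.swap i j) m
  have h2 : m ∘ Equiv.swap i j = m := by
    rw [Equiv.comp_swap_eq_update, hij, Function.update_eq_self, ← hij, Function.update_eq_self]
  rw [h2, Equiv.Perm.sign_swap hne] at h1
  push_cast at h1
  linear_combination h1 / 2

theorem IsAltOdd.eq_zero_of_apply_eq_zero {h : (Fin N → ℤ) → ℂ} (hh : IsAltOdd h) {m : Fin N → ℤ}
    {i : Fin N} (hm : m i = 0) : h m = 0 := by
  have h1 := hh.flip i m
  have h2 : Function.update m i (-m i) = m := by rw [hm, neg_zero, ← hm, Function.update_eq_self]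
  rw [h2] at h1
  linear_combination h1 / 2

theorem IsAltOdd.eq_zero_of_weylVec {h : (Fin N → ℤ) → ℂ} (hh : IsAltOdd h)
    (h0 : h (weylVec N) = 0) (hs : ∀ m, h m ≠ 0 → excess m = 0) (m : Fin N → ℤ) : h m = 0 := by
  by_contra hm
  have h1 : excess m = 0 := hs m hm
  have h2 : h (fun i => |m i|) ≠ 0 := fun h => hm (hh.eq_zero_of_abs m h)
  set a : Fin N → ℤ := fun i => |m i| with ha
  have inj : Function.Injective a := by
    by_contra hc
    exact h2 (hh.eq_zero_of_not_injective hc)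
  have pos : ∀ i, 0 < a i := by
    intro i
    refine lt_of_le_of_ne (abs_nonneg _) fun h => h2 (hh.eq_zero_of_apply_eq_zero h.symm)
  have sm : StrictMono (a ∘ Tuple.sort a) :=
    (Tuple.monotone_sort a).strictMono_of_injective (inj.comp (Equiv.injective _))
  have := strictMono_eq_of_sum_sq sm (fun i => pos _) (by
    rw [excess, sub_eq_zero] at h1
    rw [← h1]
    simp only [Function.comp_apply]
    rw [Equiv.sum_comp (Tuple.sort a) (fun i => a i ^ 2)]
    simp [ha])
  have h3 := hh.perm (Tuple.sort a) a
  rw [this, h0] at h3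
  refine h2 ?_
  rcases Int.units_eq_one_or (Equiv.Perm.sign (Tuple.sort a)) with h | h <;> rw [h] at h3 <;> simpa using h3.symm

end SymplecticHaar

namespace SymplecticHaar

variable {N : ℕ}

/-- The energy operator. -/
def torLap (N : ℕ) : Tor N →ₗ[ℂ] Tor N := torDiag fun m => (excess m : ℂ)

theorem torLap_eq (f : Tor N) : torLap N f =
    ∑ i, torDer i (torDer i f) - ((∑ i, weylVec N i ^ 2 : ℤ) : ℂ) • f := by
  ext m
  rw [torLap, coeff_torDiag, AddMonoidAlgebra.coeff_sub, Finsupp.sub_apply,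
    AddMonoidAlgebra.coeff_sum, Finsupp.finsetSum_apply, AddMonoidAlgebra.coeff_smul,
    Finsupp.smul_apply, excess]
  simp only [coeff_torDer, smul_eq_mul]
  push_cast
  rw [sub_mul, Finset.sum_mul]
  congr 1
  exact Finset.sum_congr rfl fun i _ => by ring

theorem torLap_weylDenom : torLap N (weylDenom N) = 0 := by
  ext m
  rw [torLap, coeff_torDiag]
  by_cases h : (weylDenom N).coeff m = 0
  · simp [h]
  · simp [excess_eq_zero_of_coeff_weylDenom_ne_zero h]

theorem torLap_mul_weylDenom (f : Tor N) : torLap N (f * weylDenom N) =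
    ∑ i, (torDer i (torDer i f) * weylDenom N + 2 * torDer i f * torDer i (weylDenom N)) := by
  have h := torLap_weylDenom (N := N)
  rw [torLap_eq, sub_eq_zero] at h
  rw [torLap_eq, ← mul_smul_comm, ← h, Finset.mul_sum, ← Finset.sum_sub_distrib]
  refine Finset.sum_congr rfl fun i _ => ?_
  simp only [Derivation.leibniz, map_add, smul_eq_mul]
  ring

/-- The operator on symmetric functions conjugate to the energy operator. -/
def loopOp (f : MvPolynomial ℕ ℂ) : MvPolynomial ℕ ℂ :=
  ∑ k ∈ f.vars, (k : MvPolynomial ℕ ℂ) * loopEq k (MvPolynomial.pderiv k f)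

theorem toTor_loopOp_mul (f : MvPolynomial ℕ ℂ) :
    toTor N (loopOp f) * weylDenom N = torLap N (toTor N f * weylDenom N) := by
  rw [torLap_mul_weylDenom, loopOp, map_sum, Finset.sum_mul]
  simp only [torDer_toTor]
  simp only [map_sum, Finset.sum_mul, Finset.mul_sum, ← Finset.sum_add_distrib]
  rw [Finset.sum_comm]
  refine Finset.sum_congr rfl fun k _ => ?_
  rw [map_mul, map_natCast, mul_assoc, ← sum_torDer_loop, Finset.mul_sum]
  refine Finset.sum_congr rfl fun i _ => ?_
  have h1 : toTor N (MvPolynomial.pderiv k f) * ((k : Tor N) * torSinh i k) =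
      (k : ℂ) • (torSinh i k * toTor N (MvPolynomial.pderiv k f)) := by
    rw [Algebra.smul_def, map_natCast]; ring
  rw [h1, Derivation.map_smul, Algebra.smul_def, Algebra.smul_def, map_natCast]
  ring

/-- Evaluation of a Laurent polynomial at a point of the complex torus. -/
def torEval (z : Fin N → ℂ) : Tor N →ₐ[ℂ] ℂ :=
  AddMonoidAlgebra.lift ℂ ℂ (Fin N → ℤ)
    { toFun := fun m => ∏ i, (if z i = 0 then 1 else z i) ^ (m.toAdd i)
      map_one' := by simp
      map_mul' := fun a b => by
        rw [← Finset.prod_mul_distrib]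
        refine Finset.prod_congr rfl fun i _ => ?_
        rw [toAdd_mul, Pi.add_apply, zpow_add₀]
        split_ifs with h
        · exact one_ne_zero
        · exact h }

theorem torEval_torCosh {z : Fin N → ℂ} (hz : ∀ i, z i ≠ 0) (i : Fin N) (k : ℕ) :
    torEval z (torCosh i k) = z i ^ k + (z i)⁻¹ ^ k := by
  have h : ∀ c : ℤ, torEval z (AddMonoidAlgebra.single (Pi.single i c) 1) = z i ^ c := by
    intro c
    rw [torEval, AddMonoidAlgebra.lift_single, one_smul]
    change ∏ j, (if z j = 0 then 1 else z j) ^ ((Pi.single i c : Fin N → ℤ) j) = _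
    rw [Finset.prod_eq_single i]
    · simp [hz]
    · intro j _ hj
      simp [hj]
    · simp
  rw [torCosh, map_add, h, h]
  simp

theorem exists_torEval_eq_traceEval {A : Matrix (Fin (2 * N)) (Fin (2 * N)) ℂ}
    (hA : Aᵀ * J N * A = J N) : ∃ z : Fin N → ℂ, ∀ f, traceEval A f = torEval z (toTor N f) := by
  obtain ⟨z, hz, hk⟩ := exists_trace_pow_eq hA
  refine ⟨z, fun f => ?_⟩
  have : traceEval A = (torEval z).comp (toTor N) := by
    refine MvPolynomial.algHom_ext fun k => ?_
    rw [traceEval_X, AlgHom.comp_apply, toTor_X, map_sum, hk]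
    exact Finset.sum_congr rfl fun i _ => (torEval_torCosh hz i k).symm
  rw [this]
  rfl

variable {μ : Measure (Matrix (Fin (2 * N)) (Fin (2 * N)) ℂ)} [IsProbabilityMeasure μ]

theorem integrable_traceEval (hμ : μ (USp N) = 1) (f : MvPolynomial ℕ ℂ) :
    Integrable (fun A => traceEval A f) μ :=
  integrable_of_continuous hμ (continuous_traceEval f)

theorem integral_loopOp (hμ : μ (USp N) = 1)
    (hinv : ∀ g ∈ USp N, μ.map (fun A => g * A) = μ) (f : MvPolynomial ℕ ℂ) :
    ∫ A, traceEval A (loopOp f) ∂μ = 0 := by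
  simp only [loopOp, map_sum, map_mul, map_natCast]
  rw [integral_finsetSum _ fun k _ => (integrable_traceEval hμ _).const_mul _]
  refine Finset.sum_eq_zero fun k _ => ?_
  rw [integral_const_mul, integral_loopEq hμ hinv, mul_zero]

theorem exists_filtered (hμ : μ (USp N) = 1)
    (hinv : ∀ g ∈ USp N, μ.map (fun A => g * A) = μ) (f : MvPolynomial ℕ ℂ) (S : Finset ℂ)
    (hS : (0 : ℂ) ∉ S) : ∃ g, ∫ A, traceEval A g ∂μ = ∫ A, traceEval A f ∂μ ∧
      ∀ m, (toTor N g * weylDenom N).coeff m =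
        (∏ s ∈ S, (1 - s⁻¹ * excess m)) * (toTor N f * weylDenom N).coeff m := by
  induction S using Finset.induction_on with
  | empty => exact ⟨f, rfl, by simp⟩
  | insert s S hs ih =>
    obtain ⟨g, hg, hc⟩ := ih fun h => hS (Finset.mem_insert_of_mem h)
    refine ⟨g - s⁻¹ • loopOp g, ?_, fun m => ?_⟩
    · simp only [map_sub, map_smul, smul_eq_mul]
      rw [integral_sub (integrable_traceEval hμ _) ((integrable_traceEval hμ _).const_mul _),
        integral_const_mul, integral_loopOp hμ hinv, hg]
      simp
    · rw [map_sub, map_smul, sub_mul, smul_mul_assoc, toTor_loopOp_mul, AddMonoidAlgebra.coeff_sub,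
        Finsupp.sub_apply, AddMonoidAlgebra.coeff_smul, Finsupp.smul_apply, torLap, coeff_torDiag,
        hc, Finset.prod_insert hs, smul_eq_mul]
      ring

/-- Integration of a symmetric function of the eigenvalues is extraction of a coefficient. -/
theorem integral_traceEval (hμ : μ (USp N) = 1)
    (hinv : ∀ g ∈ USp N, μ.map (fun A => g * A) = μ) (f : MvPolynomial ℕ ℂ) :
    ∫ A, traceEval A f ∂μ = (toTor N f * weylDenom N).coeff (weylVec N) := by
  classical
  obtain ⟨g, hg, hc⟩ := exists_filtered hμ hinv f
    (((toTor N f * weylDenom N).coeff.support.image fun m => (excess m : ℂ)).erase 0)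
    (Finset.notMem_erase _ _)
  set c := (toTor N f * weylDenom N).coeff (weylVec N) with hcdef
  have h1 : (toTor N g * weylDenom N).coeff (weylVec N) = c := by
    rw [hc, excess_weylVec]
    simp [c]
  have h2 : toTor N (g - MvPolynomial.C c) * weylDenom N = 0 := by
    ext m
    refine (isAltOdd_weylDenom.toTor_mul _).eq_zero_of_weylVec ?_ ?_ m
    · rw [map_sub, sub_mul, AddMonoidAlgebra.coeff_sub, Finsupp.sub_apply, h1, toTor,
        MvPolynomial.aeval_C, ← Algebra.smul_def, AddMonoidAlgebra.coeff_smul, Finsupp.smul_apply,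
        coeff_weylDenom_weylVec]
      simp
    · intro m hm
      by_contra hne
      refine hm ?_
      have h3 : (weylDenom N).coeff m = 0 := by
        by_contra h
        exact hne (excess_eq_zero_of_coeff_weylDenom_ne_zero h)
      have h4 : (toTor N g * weylDenom N).coeff m = 0 := by
        rw [hc]
        by_cases h5 : (toTor N f * weylDenom N).coeff m = 0
        · rw [h5, mul_zero]
        · have h6 : (excess m : ℂ) ≠ 0 := by exact_mod_cast hne
          refine mul_eq_zero_of_left (Finset.prod_eq_zero (i := (excess m : ℂ)) ?_ ?_) _
          · exact Finset.mem_erase.2 ⟨h6, Finset.mem_image_of_mem _ (Finsupp.mem_support_iff.2 h5)⟩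
          · rw [inv_mul_cancel₀ h6, sub_self]
      rw [map_sub, sub_mul, AddMonoidAlgebra.coeff_sub, Finsupp.sub_apply, h4, toTor,
        MvPolynomial.aeval_C, ← Algebra.smul_def, AddMonoidAlgebra.coeff_smul, Finsupp.smul_apply,
        h3]
      simp
  have h3 : toTor N g = algebraMap ℂ (Tor N) c := by
    have := (mul_eq_zero.1 h2).resolve_right weylDenom_ne_zero
    rw [map_sub, sub_eq_zero] at this
    rw [this, toTor, MvPolynomial.aeval_C]
  rw [← hg]
  have h4 : (fun A => traceEval A g) =ᵐ[μ] fun _ => c := by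
    filter_upwards [ae_mem_USp hμ] with A hA
    obtain ⟨z, hz⟩ := exists_torEval_eq_traceEval hA.2
    rw [hz, h3, AlgHom.commutes]
    rfl
  rw [integral_congr_ae h4]
  simp

end SymplecticHaar

set_option linter.unusedSectionVars false
namespace SymplecticHaar

variable {N : ℕ} {ι : Type*} [Fintype ι] [DecidableEq ι]

/-- Second quantization of a one-particle operator on `N`-particle wave functions. -/
def dGam (X : Matrix ι ι ℂ) (ψ : (Fin N → ι) → ℂ) : (Fin N → ι) → ℂ :=
  fun m => ∑ i, ∑ k, X (m i) k * ψ (Function.update m i k)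

theorem dGam_add (X Y : Matrix ι ι ℂ) (ψ : (Fin N → ι) → ℂ) :
    dGam (X + Y) ψ = dGam X ψ + dGam Y ψ := by
  ext m
  simp [dGam, add_mul, Finset.sum_add_distrib]

theorem dGam_neg (X : Matrix ι ι ℂ) (ψ : (Fin N → ι) → ℂ) : dGam (-X) ψ = -dGam X ψ := by
  ext m
  simp [dGam]

theorem dGam_add_right (X : Matrix ι ι ℂ) (ψ φ : (Fin N → ι) → ℂ) :
    dGam X (ψ + φ) = dGam X ψ + dGam X φ := by
  ext m
  simp [dGam, mul_add, Finset.sum_add_distrib]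

/-- The two-particle part of a product of second quantized operators. -/
def twoBody (X Y : Matrix ι ι ℂ) (ψ : (Fin N → ι) → ℂ) : (Fin N → ι) → ℂ :=
  fun m => ∑ i, ∑ j ∈ Finset.univ.erase i, ∑ k, ∑ l,
    X (m i) k * (Y (m j) l * ψ (Function.update (Function.update m i k) j l))

theorem twoBody_comm (X Y : Matrix ι ι ℂ) (ψ : (Fin N → ι) → ℂ) :
    twoBody X Y ψ = twoBody Y X ψ := by
  ext m
  simp only [twoBody]
  rw [Finset.sum_comm' (t' := Finset.univ) (s' := fun j => Finset.univ.erase j)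
    (by intro x y; simp [eq_comm])]
  refine Finset.sum_congr rfl fun i _ => Finset.sum_congr rfl fun j hj => ?_
  rw [Finset.sum_comm]
  refine Finset.sum_congr rfl fun k _ => Finset.sum_congr rfl fun l _ => ?_
  rw [Function.update_comm (Finset.ne_of_mem_erase hj)]
  ring

theorem dGam_dGam (X Y : Matrix ι ι ℂ) (ψ : (Fin N → ι) → ℂ) :
    dGam X (dGam Y ψ) = dGam (X * Y) ψ + twoBody X Y ψ := by
  ext m
  simp only [dGam, twoBody, Pi.add_apply]
  rw [← Finset.sum_add_distrib]
  refine Finset.sum_congr rfl fun i _ => ?_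
  have h : ∀ k, (∑ j, ∑ l, Y (Function.update m i k j) l *
      ψ (Function.update (Function.update m i k) j l)) =
      ∑ l, Y k l * ψ (Function.update m i l) + ∑ j ∈ Finset.univ.erase i, ∑ l,
        Y (m j) l * ψ (Function.update (Function.update m i k) j l) := by
    intro k
    rw [← Finset.add_sum_erase _ _ (Finset.mem_univ i)]
    congr 1
    · simp
    · refine Finset.sum_congr rfl fun j hj => ?_
      rw [Function.update_of_ne (Finset.ne_of_mem_erase hj)]
  simp only [h, mul_add, Finset.sum_add_distrib, Finset.mul_sum]
  congr 1
  · rw [Finset.sum_comm]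
    refine Finset.sum_congr rfl fun l _ => ?_
    rw [Matrix.mul_apply, Finset.sum_mul]
    exact Finset.sum_congr rfl fun k _ => (mul_assoc _ _ _).symm
  · rw [Finset.sum_comm]

theorem dGam_comm (X Y : Matrix ι ι ℂ) (ψ : (Fin N → ι) → ℂ) :
    dGam X (dGam Y ψ) = dGam Y (dGam X ψ) + dGam (X * Y - Y * X) ψ := by
  rw [dGam_dGam, dGam_dGam, twoBody_comm Y X, sub_eq_add_neg, dGam_add, dGam_neg]
  abel

variable {κ : Type*} [Fintype κ] [DecidableEq κ]

/-- The Slater determinant in which the first `N` sites are filled. -/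
def vac (κ : Type*) [DecidableEq κ] (m : Fin N → Fin N ⊕ κ) : ℂ :=
  (Matrix.of fun i j => if m i = Sum.inl j then (1 : ℂ) else 0).det

/-- Antisymmetry of a wave function. -/
def IsSkew (ψ : (Fin N → ι) → ℂ) : Prop :=
  ∀ (σ : Equiv.Perm (Fin N)) m, ψ (m ∘ σ) = ((Equiv.Perm.sign σ : ℤ) : ℂ) * ψ m

theorem isSkew_vac : IsSkew (vac (N := N) κ) := by
  intro σ m
  rw [vac, vac, ← Matrix.det_permute]
  rfl

theorem IsSkew.dGam {ψ : (Fin N → ι) → ℂ} (h : IsSkew ψ) (X : Matrix ι ι ℂ) :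
    IsSkew (dGam X ψ) := by
  intro σ m
  simp only [SymplecticHaar.dGam, Finset.mul_sum]
  refine Eq.trans ?_ (Equiv.sum_comp σ _)
  refine Finset.sum_congr rfl fun i _ => Finset.sum_congr rfl fun k _ => ?_
  have : Function.update (m ∘ σ) i k = Function.update m (σ i) k ∘ σ := by
    rw [Function.update_comp_eq_of_injective _ σ.injective]
  rw [this, h]
  simp only [Function.comp_apply]
  ring

theorem IsSkew.eq_zero {ψ : (Fin N → ι) → ℂ} (h : IsSkew ψ) {m : Fin N → ι} {i j : Fin N}
    (hij : m i = m j) (hne : i ≠ j) : ψ m = 0 := by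
  have h1 := h (Equiv.swap i j) m
  rw [Equiv.comp_swap_eq_update, hij, Function.update_eq_self, ← hij, Function.update_eq_self,
    Equiv.Perm.sign_swap hne] at h1
  push_cast at h1
  linear_combination h1 / 2

theorem dGam_vac_eq_zero {X : Matrix (Fin N ⊕ κ) (Fin N ⊕ κ) ℂ} (h : ∀ i j, X i (Sum.inl j) = 0) :
    dGam X (vac κ) = 0 := by
  ext m
  refine Finset.sum_eq_zero fun i _ => Finset.sum_eq_zero fun k _ => ?_
  rcases k with k | k
  · rw [h, zero_mul]
  · rw [vac, Matrix.det_eq_zero_of_row_eq_zero i, mul_zero]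
    intro j
    simp

theorem vac_inl : vac (N := N) κ Sum.inl = 1 := by
  rw [vac, ← Matrix.det_one (n := Fin N)]
  congr 1
  ext i j
  simp [Matrix.one_apply]

/-- The part of a block matrix which moves filled sites to empty ones. -/
def upper (X : Matrix (Fin N ⊕ κ) (Fin N ⊕ κ) ℂ) : Matrix (Fin N ⊕ κ) (Fin N ⊕ κ) ℂ :=
  Matrix.fromBlocks 0 X.toBlocks₁₂ 0 0

theorem dGam_apply_inl {ψ : (Fin N → Fin N ⊕ κ) → ℂ} (h : IsSkew ψ)
    (X : Matrix (Fin N ⊕ κ) (Fin N ⊕ κ) ℂ) :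
    dGam X ψ Sum.inl = X.toBlocks₁₁.trace * ψ Sum.inl + dGam (upper X) ψ Sum.inl := by
  have e : ∀ Y : Matrix (Fin N ⊕ κ) (Fin N ⊕ κ) ℂ, dGam Y ψ Sum.inl =
      (∑ i, ∑ j, Y (Sum.inl i) (Sum.inl j) * ψ (Function.update Sum.inl i (Sum.inl j))) +
      ∑ i, ∑ j, Y (Sum.inl i) (Sum.inr j) * ψ (Function.update Sum.inl i (Sum.inr j)) := by
    intro Y
    simp only [dGam, Fintype.sum_sum_type, Finset.sum_add_distrib]
  rw [e X, e (upper X)]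
  have h0 : ∑ i : Fin N, ∑ j : Fin N, upper X (Sum.inl i) (Sum.inl j) *
      ψ (Function.update Sum.inl i (Sum.inl j)) = 0 := by
    refine Finset.sum_eq_zero fun i _ => Finset.sum_eq_zero fun j _ => ?_
    simp [upper]
  rw [h0, zero_add]
  congr 1
  rw [Matrix.trace, Finset.sum_mul]
  refine Finset.sum_congr rfl fun i _ => ?_
  rw [Finset.sum_eq_single i]
  · rw [Function.update_eq_self]
    rfl
  · intro j _ hj
    rw [h.eq_zero (i := i) (j := j) ?_ hj.symm, mul_zero]
    rw [Function.update_self, Function.update_of_ne hj]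
  · simp

end SymplecticHaar

set_option linter.unusedSectionVars false
namespace SymplecticHaar

variable {N : ℕ} {κ : Type*} [Fintype κ] [DecidableEq κ]

theorem upper_fromBlocks (a : Matrix (Fin N) (Fin N) ℂ) (b : Matrix (Fin N) κ ℂ)
    (c : Matrix κ (Fin N) ℂ) (d : Matrix κ κ ℂ) :
    upper (Matrix.fromBlocks a b c d) = Matrix.fromBlocks 0 b 0 0 := by
  rw [upper, Matrix.toBlocks_fromBlocks₁₂]

theorem dGam_upper_vac (b : Matrix (Fin N) κ ℂ) :
    dGam (Matrix.fromBlocks 0 b 0 0) (vac κ) = 0 :=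
  dGam_vac_eq_zero fun i j => by rcases i with i | i <;> simp

theorem dGam_upper_dGam (x : Matrix (Fin N) κ ℂ) (a : Matrix (Fin N) (Fin N) ℂ)
    (b : Matrix (Fin N) κ ℂ) (c : Matrix κ (Fin N) ℂ) (d : Matrix κ κ ℂ)
    (ψ : (Fin N → Fin N ⊕ κ) → ℂ) :
    dGam (Matrix.fromBlocks 0 x 0 0) (dGam (Matrix.fromBlocks a b c d) ψ) =
      dGam (Matrix.fromBlocks a b c d) (dGam (Matrix.fromBlocks 0 x 0 0) ψ) +
      dGam (Matrix.fromBlocks (x * c) (x * d - a * x) 0 (-(c * x))) ψ := by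
  rw [dGam_comm]
  congr 2
  rw [Matrix.fromBlocks_multiply, Matrix.fromBlocks_multiply]
  ext (i | i) (j | j) <;> simp

variable (a₁ a₂ a₃ a₄ : Matrix (Fin N) (Fin N) ℂ) (b₁ b₂ b₃ b₄ : Matrix (Fin N) κ ℂ)
  (c₁ c₂ c₃ c₄ : Matrix κ (Fin N) ℂ) (d₁ d₂ d₃ d₄ : Matrix κ κ ℂ)

theorem wick_one : dGam (Matrix.fromBlocks a₁ b₁ c₁ d₁) (vac κ) Sum.inl = a₁.trace := by
  rw [dGam_apply_inl isSkew_vac, upper_fromBlocks, dGam_upper_vac, vac_inl]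
  simp

theorem wick_two : dGam (Matrix.fromBlocks a₁ b₁ c₁ d₁) (dGam (Matrix.fromBlocks a₂ b₂ c₂ d₂)
    (vac κ)) Sum.inl = a₁.trace * a₂.trace + (b₁ * c₂).trace := by
  have z : ∀ X : Matrix (Fin N ⊕ κ) (Fin N ⊕ κ) ℂ, dGam X (0 : (Fin N → Fin N ⊕ κ) → ℂ) = 0 := by
    intro X; ext m; simp [dGam]
  rw [dGam_apply_inl (isSkew_vac.dGam _), upper_fromBlocks, dGam_upper_dGam, dGam_upper_vac,
    z, zero_add, wick_one, wick_one, Matrix.toBlocks_fromBlocks₁₁]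

theorem wick_three : dGam (Matrix.fromBlocks a₁ b₁ c₁ d₁) (dGam (Matrix.fromBlocks a₂ b₂ c₂ d₂)
    (dGam (Matrix.fromBlocks a₃ b₃ c₃ d₃) (vac κ))) Sum.inl =
      a₁.trace * (a₂.trace * a₃.trace + (b₂ * c₃).trace) +
      ((b₁ * c₂).trace * a₃.trace + ((b₁ * d₂ - a₂ * b₁) * c₃).trace) +
      a₂.trace * (b₁ * c₃).trace := by
  have z : ∀ X : Matrix (Fin N ⊕ κ) (Fin N ⊕ κ) ℂ, dGam X (0 : (Fin N → Fin N ⊕ κ) → ℂ) = 0 := by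
    intro X; ext m; simp [dGam]
  rw [dGam_apply_inl ((isSkew_vac.dGam _).dGam _), upper_fromBlocks, dGam_upper_dGam,
    dGam_upper_dGam, dGam_upper_vac, z, zero_add, Pi.add_apply, wick_two, wick_two, wick_two,
    Matrix.toBlocks_fromBlocks₁₁]
  simp only [Matrix.mul_zero, Matrix.trace_zero]
  ring

theorem wick_four : dGam (Matrix.fromBlocks a₁ b₁ c₁ d₁) (dGam (Matrix.fromBlocks a₂ b₂ c₂ d₂)
    (dGam (Matrix.fromBlocks a₂ b₂ c₂ d₂) (dGam (Matrix.fromBlocks a₁ b₁ c₁ d₁) (vac κ))))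
      Sum.inl =
      (a₁.trace ^ 2 + (b₁ * c₁).trace) * (a₂.trace ^ 2 + (b₂ * c₂).trace) +
      a₁.trace * a₂.trace * (2 * (b₂ * c₁).trace + 2 * (b₁ * c₂).trace) +
      2 * (b₁ * c₂).trace * (b₂ * c₁).trace +
      a₁.trace * ((b₂ * d₂ * c₁).trace - (a₂ * b₂ * c₁).trace + (b₁ * d₂ * c₂).trace
        - (a₂ * b₁ * c₂).trace) +
      2 * a₂.trace * ((b₁ * d₂ * c₁).trace - (a₂ * b₁ * c₁).trace) +
      ((b₁ * d₂ * d₂ * c₁).trace - 2 * (a₂ * b₁ * d₂ * c₁).trace + (a₂ * a₂ * b₁ * c₁).trace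
        - (b₂ * c₂ * b₁ * c₁).trace - (b₁ * c₂ * b₂ * c₁).trace) := by
  have z : ∀ X : Matrix (Fin N ⊕ κ) (Fin N ⊕ κ) ℂ, dGam X (0 : (Fin N → Fin N ⊕ κ) → ℂ) = 0 := by
    intro X; ext m; simp [dGam]
  rw [dGam_apply_inl (((isSkew_vac.dGam _).dGam _).dGam _), upper_fromBlocks, dGam_upper_dGam,
    dGam_upper_dGam, dGam_upper_dGam, dGam_upper_vac, z, zero_add, Pi.add_apply, dGam_add_right, Pi.add_apply]
  simp only [wick_three, Matrix.toBlocks_fromBlocks₁₁, Matrix.mul_zero,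
    Matrix.trace_zero, Matrix.mul_neg, Matrix.neg_mul, Matrix.trace_neg, Matrix.sub_mul,
    Matrix.mul_sub, Matrix.trace_sub, ← Matrix.mul_assoc]
  ring

end SymplecticHaar

set_option linter.unusedSectionVars false
namespace SymplecticHaar

variable {N : ℕ}

/-- The amplitude of a jump of length `k` on the half line with an odd reflecting boundary. -/
def hop (k u v : ℕ) : ℤ :=
  (if u = v + k then 1 else 0) + (if v = u + k then 1 else 0) - (if u + v + 2 = k then 1 else 0)

/-- The position of a site, the first `N` of them being filled. -/
def site (N L : ℕ) : Fin N ⊕ Fin L → ℕ :=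
  Sum.elim (fun i => i) (fun j => N + j)

/-- The jump operator on `N + L` sites. -/
def hopMatrix (N L k : ℕ) : Matrix (Fin N ⊕ Fin L) (Fin N ⊕ Fin L) ℂ :=
  Matrix.of fun u v => (hop k (site N L u) (site N L v) : ℂ)

/-- The wave function with prescribed coefficients at positive positions. -/
def restr (L : ℕ) (h : (Fin N → ℤ) → ℂ) (m : Fin N → Fin N ⊕ Fin L) : ℂ :=
  h fun i => (site N L (m i) : ℤ) + 1

theorem site_injective (N L : ℕ) : Function.Injective (site N L) := by
  rintro (i | i) (j | j) h <;> simp only [site, Sum.elim_inl, Sum.elim_inr] at h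
  · rw [Fin.ext h]
  · omega
  · omega
  · rw [Fin.ext (by omega : (i : ℕ) = j)]

theorem exists_site_eq {L u : ℕ} (h : u < N + L) : ∃ x, site N L x = u := by
  by_cases hu : u < N
  · exact ⟨Sum.inl ⟨u, hu⟩, rfl⟩
  · exact ⟨Sum.inr ⟨u - N, by omega⟩, by simp only [site, Sum.elim_inr]; omega⟩

theorem sum_site_eq {L : ℕ} (φ : ℤ → ℂ) (hφ : ∀ q : ℤ, (N + L : ℤ) < q → φ q = 0) (q : ℤ) :
    ∑ v, (if (site N L v : ℤ) + 1 = q then (1 : ℂ) else 0) * φ ((site N L v : ℤ) + 1) =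
      if 1 ≤ q then φ q else 0 := by
  by_cases h1 : 1 ≤ q
  · rw [if_pos h1]
    by_cases h2 : q ≤ N + L
    · obtain ⟨x, hx⟩ := exists_site_eq (N := N) (L := L) (u := (q - 1).toNat) (by omega)
      have hq : (site N L x : ℤ) + 1 = q := by omega
      rw [Finset.sum_eq_single x]
      · rw [if_pos hq, hq, one_mul]
      · intro y _ hy
        rw [if_neg, zero_mul]
        intro h
        exact hy (site_injective N L (by omega))
      · simp
    · rw [hφ q (by omega)]
      refine Finset.sum_eq_zero fun v _ => ?_
      split_ifs with h
      · rw [h, hφ q (by omega), mul_zero]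
      · rw [zero_mul]
  · rw [if_neg h1]
    refine Finset.sum_eq_zero fun v _ => ?_
    rw [if_neg (by omega), zero_mul]

theorem hop_cast (k u v : ℕ) : (hop k u v : ℂ) =
    (if (v : ℤ) + 1 = (u : ℤ) + 1 - k then 1 else 0) + (if (v : ℤ) + 1 = (u : ℤ) + 1 + k then 1 else 0)
      - (if (v : ℤ) + 1 = k - ((u : ℤ) + 1) then 1 else 0) := by
  have h1 : (u = v + k) ↔ ((v : ℤ) + 1 = (u : ℤ) + 1 - k) := by omega
  have h2 : (v = u + k) ↔ ((v : ℤ) + 1 = (u : ℤ) + 1 + k) := by omega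
  have h3 : (u + v + 2 = k) ↔ ((v : ℤ) + 1 = k - ((u : ℤ) + 1)) := by omega
  simp only [hop, h1, h2, h3]
  push_cast
  rfl

theorem restr_toTor_X_mul {L : ℕ} {h : Tor N} (hh : IsAltOdd h.coeff) (k : ℕ)
    (hs : ∀ (m : Fin N → ℤ) i, (N + L : ℤ) < m i → h.coeff m = 0) :
    restr L (toTor N (MvPolynomial.X k) * h).coeff = dGam (hopMatrix N L k) (restr L h.coeff) := by
  ext m
  rw [restr, toTor_X, Finset.sum_mul, AddMonoidAlgebra.coeff_sum, Finsupp.finsetSum_apply, dGam]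
  refine Finset.sum_congr rfl fun i _ => ?_
  rw [coeff_torCosh_mul]
  set p : Fin N → ℤ := fun i => (site N L (m i) : ℤ) + 1 with hp
  set φ : ℤ → ℂ := fun q => h.coeff (Function.update p i q) with hφ
  have hφ0 : φ 0 = 0 := hh.eq_zero_of_apply_eq_zero (i := i) (by simp)
  have hφn : ∀ q, φ (-q) = -φ q := by
    intro q
    have := hh.flip i (Function.update p i q)
    simpa [hφ] using this
  have hφs : ∀ q : ℤ, (N + L : ℤ) < q → φ q = 0 := fun q hq => hs _ i (by simpa using hq)
  have e1 : ∀ c : ℤ, p + Pi.single i c = Function.update p i (p i + c) := by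
    intro c; ext j
    by_cases hj : j = i
    · subst hj; simp
    · simp [hj]
  have e2 : ∀ c : ℤ, p - Pi.single i c = Function.update p i (p i - c) := by
    intro c; ext j
    by_cases hj : j = i
    · subst hj; simp
    · simp [hj]
  have e3 : ∀ v, restr L h.coeff (Function.update m i v) = φ ((site N L v : ℤ) + 1) := by
    intro v
    rw [restr, hφ]
    congr 1
    ext j
    by_cases hj : j = i
    · subst hj; simp
    · simp [hj, hp]
  rw [e1, e2]
  simp only [e3, hopMatrix, Matrix.of_apply, hop_cast, sub_mul, add_mul, Finset.sum_sub_distrib,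
    Finset.sum_add_distrib, sum_site_eq φ hφs]
  change φ (p i - k) + φ (p i + k) = _
  have hpi : (site N L (m i) : ℤ) + 1 = p i := rfl
  have hp1 : 1 ≤ p i := by rw [← hpi]; omega
  rw [hpi, if_pos (by omega : 1 ≤ p i + k)]
  rcases lt_trichotomy (p i) k with h1 | h1 | h1
  · rw [if_neg (by omega), if_pos (by omega), ← neg_sub (k : ℤ) (p i), hφn]
    ring
  · rw [if_neg (by omega), if_neg (by omega), h1, sub_self, hφ0]
    ring
  · rw [if_pos (by omega), if_neg (by omega)]
    ring

theorem coeff_toTor_X_mul_eq_zero {h : Tor N} {B : ℤ} (k : ℕ)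
    (hs : ∀ (m : Fin N → ℤ) i, B < m i → h.coeff m = 0) (m : Fin N → ℤ) (i : Fin N)
    (hm : B + k < m i) : (toTor N (MvPolynomial.X k) * h).coeff m = 0 := by
  rw [toTor_X, Finset.sum_mul, AddMonoidAlgebra.coeff_sum, Finsupp.finsetSum_apply]
  refine Finset.sum_eq_zero fun j _ => ?_
  rw [coeff_torCosh_mul]
  by_cases hj : i = j
  · subst hj
    rw [hs _ i ?_, hs _ i ?_, add_zero]
    · simp only [Pi.add_apply, Pi.single_eq_same]; omega
    · simp only [Pi.sub_apply, Pi.single_eq_same]; omega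
  · rw [hs _ i ?_, hs _ i ?_, add_zero]
    · simp only [Pi.add_apply, Pi.single_eq_of_ne hj]; omega
    · simp only [Pi.sub_apply, Pi.single_eq_of_ne hj]; omega

theorem coeff_weylDenom_eq_zero (m : Fin N → ℤ) (i : Fin N) (hm : (N : ℤ) < m i) :
    (weylDenom N).coeff m = 0 := by
  rw [coeff_weylDenom]
  refine Matrix.det_eq_zero_of_row_eq_zero i fun j => ?_
  rw [weylMatrix, Matrix.of_apply, if_neg, if_neg, sub_zero]
  all_goals omega

theorem restr_weylDenom (L : ℕ) : restr L (weylDenom N).coeff = vac (Fin L) := by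
  ext m
  rw [restr, coeff_weylDenom, vac]
  congr 1
  ext i j
  rw [weylMatrix, Matrix.of_apply, Matrix.of_apply,
    if_neg (by omega : ¬ (site N L (m i) : ℤ) + 1 = -((j : ℤ) + 1)), sub_zero]
  refine if_congr ?_ rfl rfl
  rw [← (site_injective N L).eq_iff]
  simp only [site, Sum.elim_inl]
  omega

theorem restr_inl (L : ℕ) (h : (Fin N → ℤ) → ℂ) : restr L h Sum.inl = h (weylVec N) := rfl

theorem coeff_two (a L : ℕ) (hL : a ≤ L) :
    (toTor N (MvPolynomial.X a * MvPolynomial.X a) * weylDenom N).coeff (weylVec N) =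
      dGam (hopMatrix N L a) (dGam (hopMatrix N L a) (vac (Fin L))) Sum.inl := by
  have h0 := isAltOdd_weylDenom (N := N)
  have s1 := coeff_toTor_X_mul_eq_zero a (coeff_weylDenom_eq_zero (N := N))
  rw [map_mul, mul_assoc, ← restr_weylDenom, ← restr_toTor_X_mul h0, ← restr_toTor_X_mul
    (h0.toTor_mul _), restr_inl]
  · intro m i hm; exact s1 m i (by omega)
  · intro m i hm; exact coeff_weylDenom_eq_zero m i (by omega)

theorem coeff_four (a b L : ℕ) (hL : a + 2 * b ≤ L) :
    (toTor N (MvPolynomial.X a * (MvPolynomial.X b * (MvPolynomial.X b * MvPolynomial.X a)))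
      * weylDenom N).coeff (weylVec N) =
      dGam (hopMatrix N L a) (dGam (hopMatrix N L b) (dGam (hopMatrix N L b)
        (dGam (hopMatrix N L a) (vac (Fin L))))) Sum.inl := by
  have h0 := isAltOdd_weylDenom (N := N)
  have s1 := coeff_toTor_X_mul_eq_zero a (coeff_weylDenom_eq_zero (N := N))
  have s2 := coeff_toTor_X_mul_eq_zero b s1
  have s3 := coeff_toTor_X_mul_eq_zero b s2
  have h1 := h0.toTor_mul (MvPolynomial.X a)
  have h2 := h1.toTor_mul (MvPolynomial.X b)
  have h3 := h2.toTor_mul (MvPolynomial.X b)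
  rw [map_mul, map_mul, map_mul, mul_assoc, mul_assoc, mul_assoc, ← restr_weylDenom,
    ← restr_toTor_X_mul h0, ← restr_toTor_X_mul h1, ← restr_toTor_X_mul h2,
    ← restr_toTor_X_mul h3, restr_inl]
  · intro m i hm; exact s3 m i (by omega)
  · intro m i hm; exact s2 m i (by omega)
  · intro m i hm; exact s1 m i (by omega)
  · intro m i hm; exact coeff_weylDenom_eq_zero m i (by omega)

end SymplecticHaar

set_option linter.unusedSectionVars false
namespace SymplecticHaar

variable {N : ℕ}

/-- Composition of kernels through a set of intermediate sites. -/
def kmul (S : Finset ℕ) (f g : ℕ → ℕ → ℤ) (u w : ℕ) : ℤ := ∑ v ∈ S, f u v * g v w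

/-- The trace of a kernel over a set of sites. -/
def ktr (S : Finset ℕ) (f : ℕ → ℕ → ℤ) : ℤ := ∑ u ∈ S, f u u

/-- The matrix obtained from a kernel by labelling rows and columns by sites. -/
def kmat {α β : Type*} (p : α → ℕ) (q : β → ℕ) (f : ℕ → ℕ → ℤ) : Matrix α β ℂ :=
  Matrix.of fun i j => (f (p i) (q j) : ℂ)

theorem kmat_mul {α β δ : Type*} [Fintype β] {p : α → ℕ} {q : β → ℕ} {r : δ → ℕ} {S : Finset ℕ}
    (hS : ∀ f : ℕ → ℤ, ∑ j, f (q j) = ∑ v ∈ S, f v) (f g : ℕ → ℕ → ℤ) :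
    kmat p q f * kmat q r g = kmat p r (kmul S f g) := by
  ext i j
  rw [Matrix.mul_apply, kmat, kmat, kmat, Matrix.of_apply, kmul, ← hS]
  push_cast
  rfl

theorem trace_kmat {α : Type*} [Fintype α] {p : α → ℕ} {S : Finset ℕ}
    (hS : ∀ f : ℕ → ℤ, ∑ j, f (p j) = ∑ v ∈ S, f v) (f : ℕ → ℕ → ℤ) :
    (kmat p p f).trace = (ktr S f : ℂ) := by
  rw [Matrix.trace, ktr, ← hS]
  push_cast
  rfl

theorem sum_filled (N : ℕ) (f : ℕ → ℤ) : ∑ j : Fin N, f j = ∑ v ∈ Finset.range N, f v :=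
  (Finset.sum_range f).symm

theorem sum_empty (N L : ℕ) (f : ℕ → ℤ) :
    ∑ j : Fin L, f (N + j) = ∑ v ∈ Finset.Ico N (N + L), f v := by
  rw [Finset.sum_Ico_eq_sum_range, add_tsub_cancel_left, Finset.sum_range]

theorem hopMatrix_eq (N L k : ℕ) : hopMatrix N L k =
    Matrix.fromBlocks (kmat (fun i : Fin N => (i : ℕ)) (fun i : Fin N => (i : ℕ)) (hop k))
      (kmat (fun i : Fin N => (i : ℕ)) (fun j : Fin L => N + j) (hop k))
      (kmat (fun j : Fin L => N + j) (fun i : Fin N => (i : ℕ)) (hop k))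
      (kmat (fun j : Fin L => N + j) (fun j : Fin L => N + j) (hop k)) := by
  ext (i | i) (j | j) <;> rfl

theorem hop_comm (k u v : ℕ) : hop k u v = hop k v u := by
  rw [hop, hop, add_comm u v]
  ring

theorem ktr_kmul_comm (S T : Finset ℕ) (f g : ℕ → ℕ → ℤ) :
    ktr S (kmul T f g) = ktr T (kmul S g f) := by
  simp only [ktr, kmul]
  rw [Finset.sum_comm]
  simp only [mul_comm]

theorem kmul_assoc (S T : Finset ℕ) (f g h : ℕ → ℕ → ℤ) :
    kmul T (kmul S f g) h = kmul S f (kmul T g h) := by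
  ext u w
  simp only [kmul, Finset.sum_mul, Finset.mul_sum, mul_assoc]
  rw [Finset.sum_comm]

theorem ktr_swap (S : Finset ℕ) (f : ℕ → ℕ → ℤ) : ktr S (Function.swap f) = ktr S f := rfl

theorem swap_kmul (S : Finset ℕ) (f g : ℕ → ℕ → ℤ) :
    Function.swap (kmul S f g) = kmul S (Function.swap g) (Function.swap f) := by
  ext u w
  simp only [kmul, Function.swap, mul_comm]

theorem swap_hop (k : ℕ) : Function.swap (hop k) = hop k := by
  ext u v
  exact hop_comm k v u

/-- The second moment of the trace of the `a`-th power. -/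
def secondMoment (N L a : ℕ) : ℤ :=
  ktr (Finset.range N) (hop a) ^ 2 +
    ktr (Finset.range N) (kmul (Finset.Ico N (N + L)) (hop a) (hop a))

/-- The genuinely quartic part of a fourth moment of traces of powers. -/
def quartic (I O : Finset ℕ) (a b : ℕ) : ℤ :=
  ktr I (kmul O (kmul O (kmul O (hop a) (hop b)) (hop b)) (hop a))
    - 2 * ktr I (kmul O (kmul O (kmul I (hop b) (hop a)) (hop b)) (hop a))
    + ktr I (kmul O (kmul I (kmul I (hop b) (hop b)) (hop a)) (hop a))
    - ktr I (kmul O (kmul I (kmul O (hop b) (hop b)) (hop a)) (hop a))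
    - ktr I (kmul O (kmul I (kmul O (hop a) (hop b)) (hop b)) (hop a))

/-- The covariance of the squares of the traces of the `a`-th and `b`-th powers. -/
def squareCov (I O : Finset ℕ) (a b : ℕ) : ℤ :=
  4 * ktr I (hop a) * ktr I (hop b) * ktr I (kmul O (hop b) (hop a)) +
    2 * ktr I (kmul O (hop b) (hop a)) ^ 2 +
    2 * ktr I (hop a) * (ktr I (kmul O (kmul O (hop b) (hop b)) (hop a))
      - ktr I (kmul O (kmul I (hop b) (hop b)) (hop a))) +
    2 * ktr I (hop b) * (ktr I (kmul O (kmul O (hop a) (hop b)) (hop a))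
      - ktr I (kmul O (kmul I (hop b) (hop a)) (hop a))) +
    quartic I O a b

theorem dGam_two (N L a : ℕ) :
    dGam (hopMatrix N L a) (dGam (hopMatrix N L a) (vac (Fin L))) Sum.inl =
      (secondMoment N L a : ℂ) := by
  rw [hopMatrix_eq, wick_two, kmat_mul (sum_empty N L), trace_kmat (sum_filled N),
    trace_kmat (sum_filled N), secondMoment]
  push_cast
  ring

theorem dGam_four (N L a b : ℕ) :
    dGam (hopMatrix N L a) (dGam (hopMatrix N L b) (dGam (hopMatrix N L b)
        (dGam (hopMatrix N L a) (vac (Fin L))))) Sum.inl =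
      ((secondMoment N L a * secondMoment N L b +
        squareCov (Finset.range N) (Finset.Ico N (N + L)) a b : ℤ) : ℂ) := by
  have e1 : ktr (Finset.range N) (kmul (Finset.Ico N (N + L)) (hop a) (hop b)) =
      ktr (Finset.range N) (kmul (Finset.Ico N (N + L)) (hop b) (hop a)) := by
    rw [← ktr_swap, swap_kmul, swap_hop, swap_hop]
  have e2 : ktr (Finset.range N) (kmul (Finset.Ico N (N + L)) (kmul (Finset.Ico N (N + L)) (hop a) (hop b)) (hop b)) =
      ktr (Finset.range N) (kmul (Finset.Ico N (N + L)) (kmul (Finset.Ico N (N + L)) (hop b) (hop b)) (hop a)) := by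
    rw [← ktr_swap, swap_kmul, swap_kmul, swap_hop, swap_hop, kmul_assoc]
  have e3 : ktr (Finset.range N) (kmul (Finset.Ico N (N + L)) (kmul (Finset.range N) (hop b) (hop a)) (hop b)) =
      ktr (Finset.range N) (kmul (Finset.Ico N (N + L)) (kmul (Finset.range N) (hop b) (hop b)) (hop a)) := by
    rw [← ktr_swap, swap_kmul, swap_kmul, swap_hop, swap_hop, ← kmul_assoc, ktr_kmul_comm,
      ← kmul_assoc]
  rw [hopMatrix_eq, hopMatrix_eq, wick_four]
  simp only [kmat_mul (sum_empty N L), kmat_mul (sum_filled N), trace_kmat (sum_filled N)]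
  rw [secondMoment, secondMoment, squareCov, quartic, e1, e2, e3]
  push_cast
  ring

end SymplecticHaar

set_option linter.unusedSectionVars false
namespace SymplecticHaar

variable {N : ℕ} {A : Matrix (Fin (2 * N)) (Fin (2 * N)) ℂ}
  {μ : Measure (Matrix (Fin (2 * N)) (Fin (2 * N)) ℂ)}

theorem one_mem_USp : (1 : Matrix (Fin (2 * N)) (Fin (2 * N)) ℂ) ∈ USp N :=
  ⟨one_mem _, by simp⟩

theorem pow_mem_USp (hA : A ∈ USp N) (k : ℕ) : A ^ k ∈ USp N := by
  induction k with
  | zero => rw [pow_zero]; exact one_mem_USp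
  | succ k ih => rw [pow_succ]; exact USp_mul_mem ih hA

theorem star_trace_of_mem_USp (hA : A ∈ USp N) : star A.trace = A.trace := by
  have h1 : A * Aᴴ = 1 := Matrix.mem_unitaryGroup_iff.1 hA.1
  have h2 : Aᵀ * J N = J N * Aᴴ := by
    calc Aᵀ * J N = Aᵀ * J N * (A * Aᴴ) := by rw [h1, mul_one]
      _ = (Aᵀ * J N * A) * Aᴴ := by rw [mul_assoc _ A]
      _ = J N * Aᴴ := by rw [hA.2]
  rw [← Matrix.trace_conjTranspose, ← Matrix.trace_transpose A]
  calc Aᴴ.trace = (-(Aᴴ * (J N * J N))).trace := by rw [J_mul_J]; simp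
    _ = (-(J N * Aᴴ * J N)).trace := by
      rw [Matrix.trace_neg, Matrix.trace_neg, ← mul_assoc, Matrix.trace_mul_comm, mul_assoc]
    _ = (-(Aᵀ * (J N * J N))).trace := by rw [← h2, mul_assoc]
    _ = Aᵀ.trace := by rw [J_mul_J]; simp

theorem ofReal_re_trace_pow (hA : A ∈ USp N) (k : ℕ) : (((A ^ k).trace.re : ℝ) : ℂ) = (A ^ k).trace :=
  Complex.conj_eq_iff_re.1 (star_trace_of_mem_USp (pow_mem_USp hA k))

theorem abs_re_trace_pow_le (hA : A ∈ USp N) (k : ℕ) : |(A ^ k).trace.re| ≤ 2 * N := by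
  refine (Complex.abs_re_le_norm _).trans ?_
  refine (norm_sum_le _ _).trans ?_
  refine (Finset.sum_le_sum fun i _ => entry_norm_bound_of_unitary (pow_mem_USp hA k).1 i i).trans ?_
  simp

theorem integral_eq_of_traceEval [IsProbabilityMeasure μ] (hμ : μ (USp N) = 1)
    (hinv : ∀ g ∈ USp N, μ.map (fun A => g * A) = μ) (f : MvPolynomial ℕ ℂ)
    {F : Matrix (Fin (2 * N)) (Fin (2 * N)) ℂ → ℝ} (hF : ∀ A ∈ USp N, (F A : ℂ) = traceEval A f)
    {c : ℤ} (hc : (toTor N f * weylDenom N).coeff (weylVec N) = (c : ℂ)) :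
    ∫ A, F A ∂μ = c := by
  have h1 : ((∫ A, F A ∂μ : ℝ) : ℂ) = ((c : ℝ) : ℂ) := by
    rw [← integral_complex_ofReal, integral_congr_ae (g := fun A => traceEval A f),
      integral_traceEval hμ hinv, hc]
    · simp
    · filter_upwards [ae_mem_USp hμ] with A hA using hF A hA
  exact_mod_cast h1

theorem integral_sq [IsProbabilityMeasure μ] (hμ : μ (USp N) = 1)
    (hinv : ∀ g ∈ USp N, μ.map (fun A => g * A) = μ) {a L : ℕ} (hL : a ≤ L) :
    ∫ A, (A ^ a).trace.re ^ 2 ∂μ = secondMoment N L a := by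
  refine integral_eq_of_traceEval hμ hinv (MvPolynomial.X a * MvPolynomial.X a) ?_
    ((coeff_two a L hL).trans (dGam_two N L a))
  intro A hA
  push_cast
  rw [ofReal_re_trace_pow hA, map_mul, traceEval_X]
  ring

theorem integral_sq_mul_sq [IsProbabilityMeasure μ] (hμ : μ (USp N) = 1)
    (hinv : ∀ g ∈ USp N, μ.map (fun A => g * A) = μ) {a b L : ℕ} (hL : a + 2 * b ≤ L) :
    ∫ A, (A ^ a).trace.re ^ 2 * (A ^ b).trace.re ^ 2 ∂μ =
      ((secondMoment N L a * secondMoment N L b +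
        squareCov (Finset.range N) (Finset.Ico N (N + L)) a b : ℤ) : ℝ) := by
  refine integral_eq_of_traceEval hμ hinv _ ?_ ((coeff_four a b L hL).trans (dGam_four N L a b))
  intro A hA
  push_cast
  rw [ofReal_re_trace_pow hA, ofReal_re_trace_pow hA]
  simp only [map_mul, traceEval_X]
  ring

end SymplecticHaar

set_option linter.unusedSectionVars false
namespace SymplecticHaar

variable {N L a b : ℕ}

theorem sum_indicator_eq {S : Finset ℕ} {P : ℕ → Prop} [DecidablePred P] {Q : Prop} [Decidable Q]
    (x : ℕ) (h : ∀ v, (v ∈ S ∧ P v) ↔ (Q ∧ v = x)) :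
    ∑ v ∈ S, (if P v then (1 : ℤ) else 0) = if Q then 1 else 0 := by
  rw [Finset.sum_boole]
  split_ifs with hQ
  · have : S.filter P = {x} := by ext v; simp [h, hQ]
    simp [this]
  · have : S.filter P = ∅ := by ext v; simp [h, hQ]
    simp [this]

theorem ktr_hop (ha : 1 ≤ a) : ktr (Finset.range N) (hop a) =
    -(if Even a ∧ a ≤ 2 * N then 1 else 0) := by
  simp only [ktr, hop]
  rw [← sum_indicator_eq (S := Finset.range N) (P := fun u => u + u + 2 = a) (a / 2 - 1),
    ← Finset.sum_neg_distrib]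
  · refine Finset.sum_congr rfl fun u _ => ?_
    rw [if_neg (by omega)]
    ring
  · intro v
    rw [Finset.mem_range, Nat.even_iff]
    omega

theorem hop_mul_hop (ha : 1 ≤ a) (u v : ℕ) : hop a u v * hop a u v =
    (if u = v + a then 1 else 0) + (if v = u + a then 1 else 0) + (if u + v + 2 = a then 1 else 0) := by
  unfold hop
  split_ifs <;> omega

theorem sum_empty_hop_mul_hop (ha : 1 ≤ a) {u : ℕ} (h : u + a < N + L) :
    ∑ v ∈ Finset.Ico N (N + L), hop a u v * hop a u v =
      (if N + a ≤ u then 1 else 0) + (if N ≤ u + a then 1 else 0) +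
        (if N + u + 2 ≤ a then 1 else 0) := by
  simp only [hop_mul_hop ha, Finset.sum_add_distrib]
  congr 1
  · congr 1
    · refine sum_indicator_eq (u - a) fun v => ?_
      rw [Finset.mem_Ico]; omega
    · refine sum_indicator_eq (u + a) fun v => ?_
      rw [Finset.mem_Ico]; omega
  · refine sum_indicator_eq (a - u - 2) fun v => ?_
    rw [Finset.mem_Ico]; omega

theorem sum_filled_hop_mul_hop (ha : 1 ≤ a) (u : ℕ) :
    ∑ v ∈ Finset.range N, hop a u v * hop a u v =
      (if a ≤ u ∧ u < N + a then 1 else 0) + (if u + a < N then 1 else 0) +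
        (if u + 2 ≤ a ∧ a < N + u + 2 then 1 else 0) := by
  simp only [hop_mul_hop ha, Finset.sum_add_distrib]
  congr 1
  · congr 1
    · refine sum_indicator_eq (u - a) fun v => ?_
      rw [Finset.mem_range]; omega
    · refine sum_indicator_eq (u + a) fun v => ?_
      rw [Finset.mem_range]; omega
  · refine sum_indicator_eq (a - u - 2) fun v => ?_
    rw [Finset.mem_range]; omega

theorem ktr_kmul_self (ha : 1 ≤ a) (hL : a ≤ L) :
    ktr (Finset.range N) (kmul (Finset.Ico N (N + L)) (hop a) (hop a)) =
      ((min a N + min N (a - 1 - N) : ℕ) : ℤ) := by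
  simp only [ktr, kmul]
  have h1 : ∀ u ∈ Finset.range N, ∑ v ∈ Finset.Ico N (N + L), hop a u v * hop a v u =
      (if N ≤ u + a then 1 else 0) + (if N + u + 2 ≤ a then 1 else 0) := by
    intro u hu
    rw [Finset.mem_range] at hu
    simp only [hop_comm a _ u]
    rw [sum_empty_hop_mul_hop ha (by omega), if_neg (by omega), zero_add]
  rw [Finset.sum_congr rfl h1, Finset.sum_add_distrib, Finset.sum_boole, Finset.sum_boole]
  have h2 : (Finset.range N).filter (fun u => N ≤ u + a) = Finset.Ico (N - a) N := by
    ext u; simp only [Finset.mem_filter, Finset.mem_range, Finset.mem_Ico]; omega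
  have h3 : (Finset.range N).filter (fun u => N + u + 2 ≤ a) =
      Finset.range (min N (a - 1 - N)) := by
    ext u; simp only [Finset.mem_filter, Finset.mem_range]; omega
  rw [h2, h3, Nat.card_Ico, Finset.card_range]
  push_cast
  omega

theorem secondMoment_eq (ha : 1 ≤ a) (hL : a ≤ L) : secondMoment N L a =
    (if Even a ∧ a ≤ 2 * N then 1 else 0) + ((min a N + min N (a - 1 - N) : ℕ) : ℤ) := by
  rw [secondMoment, ktr_kmul_self ha hL, ktr_hop ha]
  split_ifs <;> ring

/-! ### Generic bounds -/

theorem abs_hop_le_one (ha : 1 ≤ a) (u v : ℕ) : |hop a u v| ≤ 1 := by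
  unfold hop
  split_ifs <;> first | omega | norm_num

theorem sum_abs_hop_le (a : ℕ) (S : Finset ℕ) (u : ℕ) : ∑ v ∈ S, |hop a u v| ≤ 3 := by
  have h1 : ∀ v, |hop a u v| ≤ (if u = v + a then 1 else 0) + (if v = u + a then 1 else 0) +
      (if u + v + 2 = a then 1 else 0) := by
    intro v
    unfold hop
    split_ifs <;> norm_num
  refine (Finset.sum_le_sum fun v _ => h1 v).trans ?_
  simp only [Finset.sum_add_distrib]
  have h2 : ∀ (P : ℕ → Prop) [DecidablePred P] (x : ℕ), (∀ v, P v → v = x) →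
      ∑ v ∈ S, (if P v then (1 : ℤ) else 0) ≤ 1 := by
    intro P _ x h
    rw [Finset.sum_boole]
    have : (S.filter P).card ≤ 1 := Finset.card_le_one.2 fun y hy z hz =>
      (h y (Finset.mem_filter.1 hy).2).trans (h z (Finset.mem_filter.1 hz).2).symm
    exact_mod_cast this
  have e1 := h2 (fun v => u = v + a) (u - a) fun v hv => by omega
  have e2 := h2 (fun v => v = u + a) (u + a) fun v hv => by omega
  have e3 := h2 (fun v => u + v + 2 = a) (a - 2 - u) fun v hv => by omega
  linarith

theorem sum_abs_kmul_le {f g : ℕ → ℕ → ℤ} {c d : ℤ} (hd : 0 ≤ d) (S T : Finset ℕ)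
    (hf : ∀ u, ∑ v ∈ S, |f u v| ≤ c) (hg : ∀ u, ∑ v ∈ T, |g u v| ≤ d) (u : ℕ) :
    ∑ v ∈ T, |kmul S f g u v| ≤ c * d := by
  calc ∑ v ∈ T, |kmul S f g u v| ≤ ∑ v ∈ T, ∑ w ∈ S, |f u w| * |g w v| := by
        refine Finset.sum_le_sum fun v _ => (Finset.abs_sum_le_sum_abs _ _).trans ?_
        simp only [abs_mul, le_refl]
    _ = ∑ w ∈ S, |f u w| * ∑ v ∈ T, |g w v| := by
        rw [Finset.sum_comm]
        simp only [Finset.mul_sum]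
    _ ≤ ∑ w ∈ S, |f u w| * d :=
        Finset.sum_le_sum fun w _ => mul_le_mul_of_nonneg_left (hg w) (abs_nonneg _)
    _ = (∑ w ∈ S, |f u w|) * d := by rw [Finset.sum_mul]
    _ ≤ c * d := mul_le_mul_of_nonneg_right (hf u) hd

theorem abs_ktr_le {f : ℕ → ℕ → ℤ} {c : ℤ} (hf : ∀ u, ∑ v ∈ Finset.range N, |f u v| ≤ c) :
    |ktr (Finset.range N) f| ≤ N * c := by
  calc |ktr (Finset.range N) f| ≤ ∑ u ∈ Finset.range N, |f u u| := Finset.abs_sum_le_sum_abs _ _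
    _ ≤ ∑ u ∈ Finset.range N, c := Finset.sum_le_sum fun u hu =>
        (Finset.single_le_sum (f := fun v => |f u v|) (fun v _ => abs_nonneg _) hu).trans (hf u)
    _ = N * c := by simp

theorem abs_ktr_kmul_two_le (a b : ℕ) (S : Finset ℕ) :
    |ktr (Finset.range N) (kmul S (hop a) (hop b))| ≤ N * 9 :=
  abs_ktr_le (sum_abs_kmul_le (c := 3) (d := 3) (by norm_num) _ _
    (fun u => sum_abs_hop_le a _ u) fun u => sum_abs_hop_le b _ u)

theorem abs_ktr_kmul_three_le (a b c : ℕ) (S T : Finset ℕ) :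
    |ktr (Finset.range N) (kmul S (kmul T (hop a) (hop b)) (hop c))| ≤ N * 27 :=
  abs_ktr_le (sum_abs_kmul_le (c := 9) (d := 3) (by norm_num) _ _
    (sum_abs_kmul_le (c := 3) (d := 3) (by norm_num) _ _
      (fun u => sum_abs_hop_le a _ u) fun u => sum_abs_hop_le b _ u) fun u => sum_abs_hop_le c _ u)

theorem abs_ktr_kmul_four_le (a b c d : ℕ) (S T U : Finset ℕ) :
    |ktr (Finset.range N) (kmul S (kmul T (kmul U (hop a) (hop b)) (hop c)) (hop d))| ≤ N * 81 :=
  abs_ktr_le (sum_abs_kmul_le (c := 27) (d := 3) (by norm_num) _ _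
    (sum_abs_kmul_le (c := 9) (d := 3) (by norm_num) _ _
    (sum_abs_kmul_le (c := 3) (d := 3) (by norm_num) _ _
      (fun u => sum_abs_hop_le a _ u) fun u => sum_abs_hop_le b _ u) fun u => sum_abs_hop_le c _ u)
      fun u => sum_abs_hop_le d _ u)

theorem abs_quartic_le (a b : ℕ) (O : Finset ℕ) : |quartic (Finset.range N) O a b| ≤ N * 486 := by
  have h := fun a b c d S T U => abs_le.1 (abs_ktr_kmul_four_le (N := N) a b c d S T U)
  unfold quartic
  have h1 := h a b b a O O O
  have h2 := h b a b a O O (Finset.range N)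
  have h3 := h b b a a O (Finset.range N) (Finset.range N)
  have h4 := h b b a a O (Finset.range N) O
  have h5 := h a b b a O (Finset.range N) O
  rw [abs_le]
  constructor <;> linarith [h1.1, h1.2, h2.1, h2.2, h3.1, h3.2, h4.1, h4.2, h5.1, h5.2]

theorem ktr_hop_mem (ha : 1 ≤ a) :
    ktr (Finset.range N) (hop a) = 0 ∨ ktr (Finset.range N) (hop a) = -1 := by
  rw [ktr_hop ha]
  split_ifs <;> simp

end SymplecticHaar

set_option linter.unusedSectionVars false
namespace SymplecticHaar

variable {N L a b : ℕ}

theorem hop_ne_zero {k u v : ℕ} (h : hop k u v ≠ 0) : u = v + k ∨ v = u + k ∨ u + v + 2 = k := by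
  contrapose! h
  rw [hop, if_neg h.1, if_neg h.2.1, if_neg h.2.2]
  norm_num

theorem abs_sum_le_card {ι : Type*} [DecidableEq ι] (s F : Finset ι) (f : ι → ℤ)
    (h : ∀ p ∈ s, f p ≠ 0 → p ∈ F) (hb : ∀ p ∈ s, |f p| ≤ 1) : |∑ p ∈ s, f p| ≤ F.card := by
  calc |∑ p ∈ s, f p| ≤ ∑ p ∈ s, |f p| := Finset.abs_sum_le_sum_abs _ _
    _ ≤ ∑ p ∈ s, if p ∈ F then 1 else 0 := by
        refine Finset.sum_le_sum fun p hp => ?_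
        split_ifs with hF
        · exact hb p hp
        · by_contra hne
          exact hF (h p hp fun h0 => hne (by rw [h0]; norm_num))
    _ = ((s.filter (· ∈ F)).card : ℤ) := by rw [Finset.sum_boole]
    _ ≤ F.card := by
        exact_mod_cast Finset.card_le_card fun p hp => (Finset.mem_filter.1 hp).2

theorem abs_hop_mul_hop_le (ha : 1 ≤ a) (hb : 1 ≤ b) (u v w x : ℕ) :
    |hop a u v * hop b w x| ≤ 1 := by
  rw [abs_mul]
  exact mul_le_one₀ (abs_hop_le_one ha u v) (abs_nonneg _) (abs_hop_le_one hb w x)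

theorem abs_cross_le (ha : 1 ≤ a) (hb : 1 ≤ b) (hab : a ≠ b) :
    |ktr (Finset.range N) (kmul (Finset.Ico N (N + L)) (hop b) (hop a))| ≤ 2 := by
  simp only [ktr, kmul]
  rw [← Finset.sum_product']
  refine (abs_sum_le_card _ {((a - b - 2) / 2, (a - b - 2) / 2 + b),
    ((b - a - 2) / 2, (b - a - 2) / 2 + a)} _ ?_ fun p _ => abs_hop_mul_hop_le hb ha _ _ _ _).trans ?_
  · rintro ⟨u, v⟩ hp hne
    rw [Finset.mem_product, Finset.mem_range, Finset.mem_Ico] at hp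
    have h1 := hop_ne_zero (left_ne_zero_of_mul hne)
    have h2 := hop_ne_zero (right_ne_zero_of_mul hne)
    simp only [Finset.mem_insert, Finset.mem_singleton, Prod.mk.injEq]
    dsimp only at hp h1 h2
    omega
  · exact_mod_cast Finset.card_le_two

/-! ### Short jumps -/

theorem ktr_kmul_hop (haN : a ≤ N) (hL : a ≤ L) (f : ℕ → ℕ → ℤ) :
    ktr (Finset.range N) (kmul (Finset.Ico N (N + L)) f (hop a)) =
      ∑ u ∈ Finset.Ico (N - a) N, f u (u + a) := by
  have h : Finset.Ico (N - a) N = (Finset.range N).filter (fun u => N ≤ u + a) := by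
    ext u; simp only [Finset.mem_filter, Finset.mem_range, Finset.mem_Ico]; omega
  rw [h, Finset.sum_filter, ktr]
  refine Finset.sum_congr rfl fun u hu => ?_
  rw [Finset.mem_range] at hu
  rw [kmul]
  split_ifs with hN
  · rw [Finset.sum_eq_single (u + a)]
    · rw [hop, if_pos rfl]
      split_ifs <;> omega
    · intro v hv hne
      rw [Finset.mem_Ico] at hv
      by_contra h0
      have := hop_ne_zero (right_ne_zero_of_mul h0)
      omega
    · intro hv
      rw [Finset.mem_Ico] at hv
      omega
  · refine Finset.sum_eq_zero fun v hv => ?_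
    rw [Finset.mem_Ico] at hv
    by_contra h0
    have := hop_ne_zero (right_ne_zero_of_mul h0)
    omega

theorem kmul_hop_left (ha : 1 ≤ a) (haN : a ≤ N) (hL : a ≤ L) (f : ℕ → ℕ → ℤ) {u : ℕ}
    (hu : u ∈ Finset.Ico (N - a) N) (w : ℕ) :
    kmul (Finset.Ico N (N + L)) (hop a) f u w = f (u + a) w := by
  rw [Finset.mem_Ico] at hu
  rw [kmul, Finset.sum_eq_single (u + a)]
  · rw [hop]
    split_ifs <;> omega
  · intro v hv hne
    rw [Finset.mem_Ico] at hv
    by_contra h0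
    have := hop_ne_zero (left_ne_zero_of_mul h0)
    omega
  · intro hv
    rw [Finset.mem_Ico] at hv
    omega

theorem kmul_hop_right (ha : 1 ≤ a) (haN : a ≤ N) (f : ℕ → ℕ → ℤ) {u : ℕ}
    (hu : u ∈ Finset.Ico (N - a) N) (x : ℕ) :
    kmul (Finset.range N) f (hop a) x (u + a) = f x u := by
  rw [Finset.mem_Ico] at hu
  rw [kmul, Finset.sum_eq_single u]
  · rw [hop]
    split_ifs <;> omega
  · intro v hv hne
    rw [Finset.mem_range] at hv
    by_contra h0
    have := hop_ne_zero (right_ne_zero_of_mul h0)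
    omega
  · intro hv
    rw [Finset.mem_range] at hv
    omega

theorem abs_cubic_le_of (haN : a ≤ N) (hL : a ≤ L) {T : Finset ℕ} {c d : ℕ} (hc : 1 ≤ c)
    (hd : 1 ≤ d) (x y : ℕ)
    (key : ∀ u v, u ∈ Finset.Ico (N - a) N → v ∈ T → (u = v + c ∨ v = u + c ∨ u + v + 2 = c) →
      (v = u + a + d ∨ u + a = v + d ∨ v + (u + a) + 2 = d) → N < a + b ∧ u = x ∧ v = y) :
    |ktr (Finset.range N) (kmul (Finset.Ico N (N + L)) (kmul T (hop c) (hop d)) (hop a))| ≤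
      if a + b ≤ N then 0 else 1 := by
  rw [ktr_kmul_hop haN hL]
  simp only [kmul]
  rw [← Finset.sum_product']
  have key' : ∀ p ∈ Finset.Ico (N - a) N ×ˢ T, hop c p.1 p.2 * hop d p.2 (p.1 + a) ≠ 0 →
      N < a + b ∧ p ∈ ({(x, y)} : Finset (ℕ × ℕ)) := by
    rintro ⟨u, v⟩ hp hne
    rw [Finset.mem_product] at hp
    obtain ⟨h1, h2, h3⟩ := key u v hp.1 hp.2 (hop_ne_zero (left_ne_zero_of_mul hne))
      (hop_ne_zero (right_ne_zero_of_mul hne))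
    exact ⟨h1, by simp [h2, h3]⟩
  split_ifs with hN
  · rw [Finset.sum_eq_zero, abs_zero]
    intro p hp
    by_contra hne
    exact absurd hN (key' p hp hne).1.not_ge
  · exact (abs_sum_le_card _ {(x, y)} _ (fun p hp hne => (key' p hp hne).2)
      fun p _ => abs_hop_mul_hop_le hc hd _ _ _ _).trans (by simp)

theorem abs_cubic_empty_le (ha : 1 ≤ a) (hab : a ≤ b) (haN : a ≤ N) (hL : a ≤ L) :
    |ktr (Finset.range N) (kmul (Finset.Ico N (N + L)) (kmul (Finset.Ico N (N + L)) (hop b) (hop b))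
      (hop a))| ≤ if a + b ≤ N then 0 else 1 := by
  refine abs_cubic_le_of haN hL (by omega) (by omega) ((2 * b - a - 2) / 2)
    (b - 2 - (2 * b - a - 2) / 2) fun u v hu hv h1 h2 => ?_
  rw [Finset.mem_Ico] at hu hv
  omega

theorem abs_cubic_filled_le (ha : 1 ≤ a) (hab : a ≤ b) (haN : a ≤ N) (hL : a ≤ L) :
    |ktr (Finset.range N) (kmul (Finset.Ico N (N + L)) (kmul (Finset.range N) (hop b) (hop b))
      (hop a))| ≤ if a + b ≤ N then 0 else 1 := by
  refine abs_cubic_le_of haN hL (by omega) (by omega) ((2 * b - a - 2) / 2)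
    (b - 2 - (2 * b - a - 2) / 2) fun u v hu hv h1 h2 => ?_
  rw [Finset.mem_Ico] at hu
  rw [Finset.mem_range] at hv
  omega

theorem abs_cubic_empty_le' (ha : 1 ≤ a) (hab : a ≤ b) (haN : a ≤ N) (hL : a ≤ L) :
    |ktr (Finset.range N) (kmul (Finset.Ico N (N + L)) (kmul (Finset.Ico N (N + L)) (hop a) (hop b))
      (hop a))| ≤ if a + b ≤ N then 0 else 1 := by
  refine abs_cubic_le_of haN hL (by omega) (by omega) ((b - 2 * a - 2) / 2)
    ((b - 2 * a - 2) / 2 + a) fun u v hu hv h1 h2 => ?_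
  rw [Finset.mem_Ico] at hu hv
  omega

theorem abs_cubic_filled_le' (ha : 1 ≤ a) (hab : a ≤ b) (haN : a ≤ N) (hL : a ≤ L) :
    |ktr (Finset.range N) (kmul (Finset.Ico N (N + L)) (kmul (Finset.range N) (hop b) (hop a))
      (hop a))| ≤ if a + b ≤ N then 0 else 1 := by
  refine abs_cubic_le_of haN hL (by omega) (by omega) ((b - 2) / 2)
    ((b - 2) / 2) fun u v hu hv h1 h2 => ?_
  rw [Finset.mem_Ico] at hu
  rw [Finset.mem_range] at hv
  omega

/-- The excess of jumps to empty sites over jumps to filled ones. -/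
def imbalance (N b x : ℕ) : ℤ :=
  (if N + b ≤ x then 1 else 0) + (if N ≤ x + b then 1 else 0) + (if N + x + 2 ≤ b then 1 else 0) -
    ((if b ≤ x ∧ x < N + b then 1 else 0) + (if x + b < N then 1 else 0) +
        (if x + 2 ≤ b ∧ b < N + x + 2 then 1 else 0))

theorem quartic_eq (ha : 1 ≤ a) (hab : a ≤ b) (haN : a ≤ N) (hL : a + b ≤ L) :
    quartic (Finset.range N) (Finset.Ico N (N + L)) a b =
      ∑ u ∈ Finset.Ico (N - a) N, (imbalance N b (u + a) - imbalance N b u) := by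
  have haL : a ≤ L := by omega
  have hb : 1 ≤ b := by omega
  have hK2 : ∑ u ∈ Finset.Ico (N - a) N, kmul (Finset.Ico N (N + L))
      (kmul (Finset.range N) (hop b) (hop a)) (hop b) u (u + a) = 0 := by
    refine Finset.sum_eq_zero fun u hu => Finset.sum_eq_zero fun w hw => ?_
    rw [kmul, Finset.sum_mul]
    refine Finset.sum_eq_zero fun v hv => ?_
    by_contra hne
    have h1 := hop_ne_zero (left_ne_zero_of_mul (left_ne_zero_of_mul hne))
    have h2 := hop_ne_zero (right_ne_zero_of_mul (left_ne_zero_of_mul hne))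
    have h3 := hop_ne_zero (right_ne_zero_of_mul hne)
    rw [Finset.mem_Ico] at hu hw
    rw [Finset.mem_range] at hv
    omega
  have hD : ∀ x, x + b < N + L → imbalance N b x =
      kmul (Finset.Ico N (N + L)) (hop b) (hop b) x x - kmul (Finset.range N) (hop b) (hop b) x x := by
    intro x hx
    simp only [kmul, hop_comm b _ x]
    rw [sum_empty_hop_mul_hop hb hx, sum_filled_hop_mul_hop hb, imbalance]
  rw [quartic, kmul_assoc _ _ (hop a) (hop b) (hop b), kmul_assoc _ _ (hop a) (hop b) (hop b)]
  simp only [ktr_kmul_hop haN haL]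
  rw [hK2, mul_zero, sub_zero, ← Finset.sum_add_distrib, ← Finset.sum_sub_distrib, ← Finset.sum_sub_distrib]
  refine Finset.sum_congr rfl fun u hu => ?_
  rw [kmul_hop_left ha haN haL _ hu, kmul_hop_left ha haN haL _ hu, kmul_hop_right ha haN _ hu,
    kmul_hop_right ha haN _ hu]
  rw [Finset.mem_Ico] at hu
  rw [hD _ (by omega), hD _ (by omega)]
  ring

/-- The set of `b` for which jumps of lengths `a ≤ b` interact nontrivially at the edge. -/
def Window (N a b : ℕ) : Prop := (N < b + a ∧ b ≤ N + a) ∨ (2 * N < b + a ∧ b ≤ 2 * N + a)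

instance (N a b : ℕ) : Decidable (Window N a b) := by unfold Window; infer_instance

theorem abs_quartic_le_of_le (ha : 1 ≤ a) (hab : a ≤ b) (haN : a ≤ N) (hL : a + b ≤ L) :
    |quartic (Finset.range N) (Finset.Ico N (N + L)) a b| ≤
      4 * a * if Window N a b then 1 else 0 := by
  rw [quartic_eq ha hab haN hL]
  have e : ∀ x, N ≤ x + a → x < N + a → imbalance N b x = (if N ≤ x + b then 1 else 0)
      + (if N + x + 2 ≤ b then 1 else 0) - ((if b ≤ x then 1 else 0) +
        (if x + 2 ≤ b ∧ b < N + x + 2 then 1 else 0)) := by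
    intro x h1 h2
    rw [imbalance]
    split_ifs <;> omega
  split_ifs with hw
  · have hb : ∀ u ∈ Finset.Ico (N - a) N, |imbalance N b (u + a) - imbalance N b u| ≤ 4 := by
      intro u hu
      rw [Finset.mem_Ico] at hu
      have hx : ∀ x, |imbalance N b x| ≤ 2 := by
        intro x
        rw [imbalance]
        split_ifs <;> first | omega | norm_num
      exact (abs_sub _ _).trans (by linarith [hx (u + a), hx u])
    refine (Finset.abs_sum_le_sum_abs _ _).trans ((Finset.sum_le_sum hb).trans ?_)
    rw [Finset.sum_const, Nat.card_Ico, nsmul_eq_mul]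
    have : (N - (N - a) : ℕ) = a := by omega
    rw [this]
    linarith
  · rw [Finset.sum_eq_zero, abs_zero, mul_zero]
    intro u hu
    rw [Finset.mem_Ico] at hu
    rw [Window] at hw
    have hc : ∀ x y, N ≤ x + a → x < N + a → N ≤ y + a → y < N + a →
        imbalance N b x = imbalance N b y := by
      intro x y h1 h2 h3 h4
      rw [e x h1 h2, e y h3 h4, if_pos (by omega : N ≤ x + b), if_pos (by omega : N ≤ y + b)]
      have e1 : (N + x + 2 ≤ b) ↔ (N + y + 2 ≤ b) := by omega
      have e2 : (b ≤ x) ↔ (b ≤ y) := by omega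
      have e3 : (x + 2 ≤ b ∧ b < N + x + 2) ↔ (y + 2 ≤ b ∧ b < N + y + 2) := by omega
      simp only [e1, e2, e3]
    rw [hc (u + a) u (by omega) (by omega) (by omega) (by omega), sub_self]

end SymplecticHaar

set_option linter.unusedSectionVars false
namespace SymplecticHaar

variable {N L a b : ℕ}

theorem cross_eq_zero (ha : 1 ≤ a) (hab : a < b) (h : a + b ≤ N) (hL : a ≤ L) :
    ktr (Finset.range N) (kmul (Finset.Ico N (N + L)) (hop b) (hop a)) = 0 := by
  rw [ktr_kmul_hop (by omega) hL]
  refine Finset.sum_eq_zero fun u hu => ?_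
  rw [Finset.mem_Ico] at hu
  by_contra hne
  rcases hop_ne_zero hne with h | h | h <;> omega

theorem not_window (h : a + b ≤ N) : ¬ Window N a b := by
  unfold Window; omega

theorem abs_squareCov_le_of {X C K : ℤ} (ha : 1 ≤ a) (hb : 1 ≤ b) {O : Finset ℕ}
    (hx : |ktr (Finset.range N) (kmul O (hop b) (hop a))| ≤ X)
    (hc₁ : |ktr (Finset.range N) (kmul O (kmul O (hop b) (hop b)) (hop a))| ≤ C)
    (hc₂ : |ktr (Finset.range N) (kmul O (kmul (Finset.range N) (hop b) (hop b)) (hop a))| ≤ C)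
    (hc₃ : |ktr (Finset.range N) (kmul O (kmul O (hop a) (hop b)) (hop a))| ≤ C)
    (hc₄ : |ktr (Finset.range N) (kmul O (kmul (Finset.range N) (hop b) (hop a)) (hop a))| ≤ C)
    (hq : |quartic (Finset.range N) O a b| ≤ K) :
    |squareCov (Finset.range N) O a b| ≤ 4 * X + 2 * X ^ 2 + 8 * C + K := by
  rw [squareCov]
  have h₁ := ktr_hop_mem (N := N) ha
  have h₂ := ktr_hop_mem (N := N) hb
  revert h₁ h₂ hx hc₁ hc₂ hc₃ hc₄ hq
  generalize ktr (Finset.range N) (hop a) = t₁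
  generalize ktr (Finset.range N) (hop b) = t₂
  generalize ktr (Finset.range N) (kmul O (hop b) (hop a)) = x
  generalize ktr (Finset.range N) (kmul O (kmul O (hop b) (hop b)) (hop a)) = c₁
  generalize ktr (Finset.range N) (kmul O (kmul (Finset.range N) (hop b) (hop b)) (hop a)) = c₂
  generalize ktr (Finset.range N) (kmul O (kmul O (hop a) (hop b)) (hop a)) = c₃
  generalize ktr (Finset.range N) (kmul O (kmul (Finset.range N) (hop b) (hop a)) (hop a)) = c₄
  generalize quartic (Finset.range N) O a b = q
  intro hx hc₁ hc₂ hc₃ hc₄ hq h₁ h₂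
  have hX : x ^ 2 ≤ X ^ 2 := sq_le_sq' (abs_le.1 hx).1 (abs_le.1 hx).2
  rw [abs_le] at *
  rcases h₁ with rfl | rfl <;> rcases h₂ with rfl | rfl <;> constructor <;>
    nlinarith [sq_nonneg x]

/-- Squares of traces of small distinct powers are uncorrelated. -/
theorem squareCov_eq_zero (ha : 1 ≤ a) (hab : a < b) (h : a + b ≤ N) (hL : a + b ≤ L) :
    squareCov (Finset.range N) (Finset.Ico N (N + L)) a b = 0 := by
  have h0 := abs_squareCov_le_of ha (ha.trans hab.le)
    (abs_nonpos_iff.2 (cross_eq_zero (L := L) ha hab h (by omega)))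
    (abs_cubic_empty_le (L := L) ha hab.le (by omega) (by omega))
    (abs_cubic_filled_le (L := L) ha hab.le (by omega) (by omega))
    (abs_cubic_empty_le' (L := L) ha hab.le (by omega) (by omega))
    (abs_cubic_filled_le' (L := L) ha hab.le (by omega) (by omega))
    (abs_quartic_le_of_le ha hab.le (by omega) hL)
  rw [if_pos h, if_neg (not_window h)] at h0
  exact abs_nonpos_iff.1 (h0.trans (by norm_num))

/-- The variance of the square of the trace of a small power. -/
theorem squareCov_self (ha : 1 ≤ a) (h : 2 * a ≤ N) (hL : 2 * a ≤ L) :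
    squareCov (Finset.range N) (Finset.Ico N (N + L)) a a =
      2 * a ^ 2 + 4 * a * if Even a then 1 else 0 := by
  have hz : ∀ {z : ℤ}, |z| ≤ (if a + a ≤ N then 0 else 1) → z = 0 := fun {z} hz => by
    rw [if_pos (by omega)] at hz
    exact abs_nonpos_iff.1 hz
  have h1 := hz (abs_cubic_empty_le (L := L) ha le_rfl (by omega) (by omega))
  have h2 := hz (abs_cubic_filled_le (L := L) ha le_rfl (by omega) (by omega))
  have h4 := abs_quartic_le_of_le (L := L) ha le_rfl (by omega : a ≤ N) (by omega)
  rw [if_neg (not_window (by omega)), mul_zero] at h4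
  rw [squareCov, h1, h2, abs_nonpos_iff.1 h4, ktr_kmul_self ha (by omega), ktr_hop ha,
    min_eq_left (by omega : a ≤ N), show min N (a - 1 - N) = 0 by omega]
  have e : (Even a ∧ a ≤ 2 * N) ↔ Even a := and_iff_left (by omega)
  simp only [e]
  split_ifs <;> push_cast <;> ring

theorem abs_squareCov_le_of_le (ha : 1 ≤ a) (hab : a < b) (haN : a ≤ N) (hL : a + b ≤ L) :
    |squareCov (Finset.range N) (Finset.Ico N (N + L)) a b| ≤
      24 + 4 * a * if Window N a b then 1 else 0 := by
  have hc : (if a + b ≤ N then 0 else 1 : ℤ) ≤ 1 := by split_ifs <;> norm_num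
  have h0 := abs_squareCov_le_of ha (ha.trans hab.le)
    (abs_cross_le (N := N) (L := L) ha (by omega) hab.ne)
    (abs_cubic_empty_le (L := L) ha hab.le (by omega) (by omega))
    (abs_cubic_filled_le (L := L) ha hab.le (by omega) (by omega))
    (abs_cubic_empty_le' (L := L) ha hab.le (by omega) (by omega))
    (abs_cubic_filled_le' (L := L) ha hab.le (by omega) (by omega))
    (abs_quartic_le_of_le ha hab.le (by omega) hL)
  refine h0.trans ?_
  linarith

theorem abs_squareCov_le (hN : 1 ≤ N) (ha : 1 ≤ a) (hb : 1 ≤ b) (hab : a ≠ b) :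
    |squareCov (Finset.range N) (Finset.Ico N (N + L)) a b| ≤ 800 * N := by
  have h0 := abs_squareCov_le_of ha hb
    (abs_cross_le (N := N) (L := L) ha hb hab)
    (abs_ktr_kmul_three_le (N := N) b b a (Finset.Ico N (N + L)) (Finset.Ico N (N + L)))
    (abs_ktr_kmul_three_le (N := N) b b a (Finset.Ico N (N + L)) (Finset.range N))
    (abs_ktr_kmul_three_le (N := N) a b a (Finset.Ico N (N + L)) (Finset.Ico N (N + L)))
    (abs_ktr_kmul_three_le (N := N) b a a (Finset.Ico N (N + L)) (Finset.range N))
    (abs_quartic_le (N := N) a b (Finset.Ico N (N + L)))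
  refine h0.trans ?_
  have : (1 : ℤ) ≤ N := by exact_mod_cast hN
  linarith

theorem abs_squareCov_self_le (hN : 1 ≤ N) (ha : 1 ≤ a) :
    |squareCov (Finset.range N) (Finset.Ico N (N + L)) a a| ≤ 1000 * N ^ 2 := by
  have h0 := abs_squareCov_le_of ha ha
    (abs_ktr_kmul_two_le (N := N) a a (Finset.Ico N (N + L)))
    (abs_ktr_kmul_three_le (N := N) a a a (Finset.Ico N (N + L)) (Finset.Ico N (N + L)))
    (abs_ktr_kmul_three_le (N := N) a a a (Finset.Ico N (N + L)) (Finset.range N))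
    (abs_ktr_kmul_three_le (N := N) a a a (Finset.Ico N (N + L)) (Finset.Ico N (N + L)))
    (abs_ktr_kmul_three_le (N := N) a a a (Finset.Ico N (N + L)) (Finset.range N))
    (abs_quartic_le (N := N) a a (Finset.Ico N (N + L)))
  refine h0.trans ?_
  have : (1 : ℤ) ≤ N := by exact_mod_cast hN
  nlinarith

/-- The covariance of the squared traces of the `a`-th and `b`-th powers for large `N`. -/
def limitCov (a b : ℕ) : ℤ := if a = b then 2 * (a : ℤ) ^ 2 + 4 * a * (if Even a then 1 else 0) else 0

/-- A bound for the deviation of the covariance of squared traces from its limiting value. -/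
def covError (N a b : ℕ) : ℤ :=
  (if 2 * a ≤ N ∧ N < 2 * b then 24 + 4 * (a : ℤ) * (if Window N a b then 1 else 0) else 0) +
    (if N < 2 * a ∧ N < 2 * b then 800 * (N : ℤ) else 0) +
    (if a = b ∧ N < 2 * a then 5000 * (a : ℤ) ^ 2 else 0)

theorem covError_nonneg (N a b : ℕ) : 0 ≤ covError N a b := by
  unfold covError
  positivity

theorem abs_squareCov_sub_limitCov_le (hN : 1 ≤ N) (ha : 1 ≤ a) (hab : a ≤ b) (hL : a + b ≤ L) :
    |squareCov (Finset.range N) (Finset.Ico N (N + L)) a b - limitCov a b| ≤ covError N a b := by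
  unfold covError limitCov
  by_cases h1 : 2 * a ≤ N
  · rcases hab.eq_or_lt with rfl | hab
    · rw [squareCov_self ha h1 (by omega), if_pos rfl, sub_self, abs_zero]
      positivity
    · rw [if_neg hab.ne, sub_zero, if_neg (by omega : ¬ (N < 2 * a ∧ N < 2 * b)),
        if_neg (by omega : ¬ (a = b ∧ N < 2 * a)), add_zero, add_zero]
      by_cases h2 : N < 2 * b
      · rw [if_pos ⟨h1, h2⟩]
        exact abs_squareCov_le_of_le ha hab (by omega) hL
      · rw [squareCov_eq_zero ha hab (by omega) hL, if_neg (by omega), abs_zero]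
  · rw [if_neg (by omega : ¬ (2 * a ≤ N ∧ N < 2 * b)),
      if_pos (by omega : (N < 2 * a ∧ N < 2 * b))]
    rcases hab.eq_or_lt with rfl | hab
    · rw [if_pos rfl, if_pos (⟨rfl, by omega⟩ : a = a ∧ N < 2 * a)]
      have h3 := abs_squareCov_self_le (L := L) hN ha
      have h4 : (N : ℤ) ^ 2 ≤ (2 * a) ^ 2 := by
        have : (N : ℤ) ≤ 2 * a := by omega
        gcongr
      have h5 : (a : ℤ) ≤ a ^ 2 := by nlinarith [(by exact_mod_cast ha : (1 : ℤ) ≤ a)]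
      rw [abs_le] at *
      split_ifs <;> constructor <;> linarith
    · rw [if_neg hab.ne, sub_zero, if_neg (by omega), zero_add, add_zero]
      exact abs_squareCov_le hN ha (by omega) hab.ne

end SymplecticHaar

set_option linter.unusedSectionVars false
namespace SymplecticHaar

variable {N : ℕ}

theorem sum_inv_sq_tail_le (hN : 1 ≤ N) (M : ℕ) :
    ∑ a ∈ Finset.Icc 1 M, (if N < 2 * a then 1 / (a : ℝ) ^ 2 else 0) ≤ 2 / (N : ℝ) := by
  suffices h : ∑ a ∈ Finset.Icc 1 M, (if N < 2 * a then 1 / (a : ℝ) ^ 2 else 0) +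
      2 / ((max N (2 * M + 1) : ℕ) : ℝ) ≤ 2 / (N : ℝ) from
    le_trans (le_add_of_nonneg_right (by positivity)) h
  induction M with
  | zero => simp [hN]
  | succ M ih =>
    rw [Finset.sum_Icc_succ_top (by omega)]
    refine le_trans ?_ ih
    rw [add_assoc]
    gcongr
    split_ifs with h
    · rw [max_eq_right (by omega), max_eq_right (by omega)]
      push_cast
      rw [div_add_div _ _ (by positivity) (by positivity),
        div_le_div_iff₀ (by positivity) (by positivity)]
      nlinarith [(Nat.cast_nonneg M : (0 : ℝ) ≤ M)]
    · rw [zero_add]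
      gcongr
      omega

theorem sum_inv_sq_le (M : ℕ) : ∑ a ∈ Finset.Icc 1 M, 1 / (a : ℝ) ^ 2 ≤ 2 := by
  have h := sum_inv_sq_tail_le le_rfl M
  rw [Nat.cast_one, div_one] at h
  refine le_trans (le_of_eq (Finset.sum_congr rfl fun a ha => ?_)) h
  rw [if_pos (by have := (Finset.mem_Icc.1 ha).1; omega)]

theorem sum_window_le (hN : 1 ≤ N) (a M : ℕ) :
    ∑ b ∈ Finset.Icc 1 M, (if N < 2 * b then (if Window N a b then 1 else 0) / (b : ℝ) ^ 2 else 0) ≤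
      16 * a / (N : ℝ) ^ 2 := by
  set W := Finset.Ioc (N - a) (N + a) ∪ Finset.Ioc (2 * N - a) (2 * N + a) with hW
  have hcard : (W.card : ℝ) ≤ 4 * a := by
    have h1 : W.card ≤ 4 * a := by
      refine (Finset.card_union_le _ _).trans ?_
      simp only [Nat.card_Ioc]
      omega
    exact_mod_cast h1
  calc _ ≤ ∑ b ∈ Finset.Icc 1 M, if b ∈ W then 4 / (N : ℝ) ^ 2 else 0 := by
        refine Finset.sum_le_sum fun b hb => ?_
        by_cases h1 : N < 2 * b
        · rw [if_pos h1]
          by_cases h2 : Window N a b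
          · have hb1 : (1 : ℝ) ≤ b := by exact_mod_cast (Finset.mem_Icc.1 hb).1
            have hN0 : (0 : ℝ) < N := by exact_mod_cast hN
            rw [if_pos h2, if_pos, div_le_div_iff₀ (by positivity) (by positivity)]
            · have : (N : ℝ) ≤ 2 * b := by exact_mod_cast h1.le
              nlinarith
            · simp only [hW, Finset.mem_union, Finset.mem_Ioc]
              unfold Window at h2
              omega
          · rw [if_neg h2, zero_div]
            positivity
        · rw [if_neg h1]
          positivity
    _ ≤ ∑ b ∈ W, 4 / (N : ℝ) ^ 2 := by
        rw [← Finset.sum_filter]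
        refine Finset.sum_le_sum_of_subset_of_nonneg ?_ fun _ _ _ => by positivity
        intro b hb
        exact (Finset.mem_filter.1 hb).2
    _ = W.card * (4 / (N : ℝ) ^ 2) := by rw [Finset.sum_const, nsmul_eq_mul]
    _ ≤ 4 * a * (4 / (N : ℝ) ^ 2) := by gcongr
    _ = _ := by ring

/-- The accumulated deviation of the covariances is of order `1 / N`. -/
theorem sum_covError_le (hN : 1 ≤ N) (M : ℕ) :
    ∑ a ∈ Finset.Icc 1 M, ∑ b ∈ Finset.Icc 1 M,
      (covError N a b : ℝ) / ((a : ℝ) ^ 2 * (b : ℝ) ^ 2) ≤ 20000 / N := by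
  have hN0 : (0 : ℝ) < N := by exact_mod_cast hN
  set q : ℕ → ℝ := fun b => if N < 2 * b then 1 / (b : ℝ) ^ 2 else 0 with hq
  set r : ℕ → ℕ → ℝ := fun a b =>
    if N < 2 * b then (if Window N a b then 1 else 0) / (b : ℝ) ^ 2 else 0 with hr
  have hq0 : ∀ b, 0 ≤ q b := fun b => by simp only [hq]; positivity
  have hqs := sum_inv_sq_tail_le hN M
  have hrow : ∀ a ∈ Finset.Icc 1 M, ∑ b ∈ Finset.Icc 1 M,
      (covError N a b : ℝ) / ((a : ℝ) ^ 2 * (b : ℝ) ^ 2) ≤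
      48 / N * (1 / (a : ℝ) ^ 2) + (if 2 * a ≤ N then 64 / (N : ℝ) ^ 2 else 0) + 6600 * q a := by
    intro a ha
    have ha1 : (1 : ℝ) ≤ a := by exact_mod_cast (Finset.mem_Icc.1 ha).1
    have e : ∀ b ∈ Finset.Icc 1 M, (covError N a b : ℝ) / ((a : ℝ) ^ 2 * (b : ℝ) ^ 2) =
        (if 2 * a ≤ N then 24 / (a : ℝ) ^ 2 else 0) * q b +
        (if 2 * a ≤ N then 4 / (a : ℝ) else 0) * r a b +
        800 * N * q a * q b + (if b = a then 5000 * q a else 0) := by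
      intro b hb
      have hb1 : (1 : ℝ) ≤ b := by exact_mod_cast (Finset.mem_Icc.1 hb).1
      simp only [hq, hr, covError]
      by_cases h1 : 2 * a ≤ N
      · have h1' : ¬ N < 2 * a := by omega
        by_cases h2 : N < 2 * b
        · simp only [h1, h2, h1', true_and, false_and, and_false, if_true, if_false]
          split_ifs <;> push_cast <;> field_simp <;> ring
        · simp only [h1, h2, h1', and_false, if_true, if_false]
          split_ifs <;> simp
      · have h1' : N < 2 * a := by omega
        by_cases h3 : a = b
        · subst h3
          simp only [h1, h1', false_and, true_and, if_true, if_false]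
          push_cast
          field_simp
          ring
        · by_cases h2 : N < 2 * b
          · simp only [h1, h1', h2, h3, Ne.symm h3, false_and, true_and, if_true, if_false]
            push_cast
            field_simp
            ring
          · simp only [h1, h1', h2, h3, Ne.symm h3, false_and, and_false, if_true, if_false]
            simp
    rw [Finset.sum_congr rfl e, Finset.sum_add_distrib, Finset.sum_add_distrib,
      Finset.sum_add_distrib, ← Finset.mul_sum, ← Finset.mul_sum, ← Finset.mul_sum,
      Finset.sum_ite_eq', if_pos ha]
    have hws := sum_window_le hN a M
    have t1 : (if 2 * a ≤ N then 24 / (a : ℝ) ^ 2 else 0) * ∑ b ∈ Finset.Icc 1 M, q b ≤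
        48 / N * (1 / (a : ℝ) ^ 2) := by
      calc _ ≤ 24 / (a : ℝ) ^ 2 * (2 / N) := by
            gcongr
            · split_ifs
              · exact le_rfl
              · positivity
        _ = _ := by ring
    have t2 : (if 2 * a ≤ N then 4 / (a : ℝ) else 0) * ∑ b ∈ Finset.Icc 1 M, r a b ≤
        if 2 * a ≤ N then 64 / (N : ℝ) ^ 2 else 0 := by
      split_ifs
      · calc _ ≤ 4 / (a : ℝ) * (16 * a / (N : ℝ) ^ 2) := by gcongr
          _ = _ := by field_simp; norm_num
      · simp
    have t3 : 800 * N * q a * ∑ b ∈ Finset.Icc 1 M, q b ≤ 1600 * q a := by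
      calc _ ≤ 800 * N * q a * (2 / N) := by
            have := hq0 a
            gcongr
        _ = _ := by field_simp; ring
    linarith
  calc _ ≤ _ := Finset.sum_le_sum hrow
    _ = 48 / N * ∑ a ∈ Finset.Icc 1 M, (1 / (a : ℝ) ^ 2) +
        ∑ a ∈ Finset.Icc 1 M, (if 2 * a ≤ N then 64 / (N : ℝ) ^ 2 else 0) +
        6600 * ∑ a ∈ Finset.Icc 1 M, q a := by
        rw [Finset.sum_add_distrib, Finset.sum_add_distrib, Finset.mul_sum, Finset.mul_sum]
    _ ≤ 48 / N * 2 + 64 / N + 6600 * (2 / N) := by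
        gcongr
        · exact sum_inv_sq_le M
        · rw [← Finset.sum_filter, Finset.sum_const, nsmul_eq_mul]
          have hc : ((Finset.Icc 1 M).filter (fun a => 2 * a ≤ N)).card ≤ N := by
            have : (Finset.Icc 1 M).filter (fun a => 2 * a ≤ N) ⊆ Finset.Icc 1 N := by
              intro x hx
              simp only [Finset.mem_filter, Finset.mem_Icc] at hx ⊢
              omega
            simpa using Finset.card_le_card this
          calc _ ≤ (N : ℝ) * (64 / (N : ℝ) ^ 2) := by gcongr
            _ = _ := by field_simp
    _ = 13360 / N := by ring
    _ ≤ _ := by gcongr; norm_num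

end SymplecticHaar

set_option linter.unusedSectionVars false
namespace SymplecticHaar

open Filter Topology

variable {N : ℕ}

theorem tendsto_sum_Icc {f : ℕ → ℝ} {s : ℝ} (h : HasSum f s) (h0 : f 0 = 0) :
    Tendsto (fun M : ℕ => ∑ a ∈ Finset.Icc 1 M, f a) atTop (𝓝 s) := by
  have e : ∀ M : ℕ, ∑ a ∈ Finset.Icc 1 M, f a = ∑ a ∈ Finset.range (M + 1), f a := by
    intro M
    rw [Finset.sum_range_succ', h0, add_zero]
    induction M with
    | zero => simp
    | succ M ih => rw [Finset.sum_Icc_succ_top (by omega), ih, Finset.sum_range_succ]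
  simp only [e]
  exact h.tendsto_sum_nat.comp (tendsto_add_atTop_nat 1)

theorem hasSum_even {p : ℕ} {s : ℝ} (h : HasSum (fun n : ℕ => 1 / (n : ℝ) ^ p) s) :
    HasSum (fun n : ℕ => if Even n then 1 / (n : ℝ) ^ p else 0) (s / 2 ^ p) := by
  have hi : Function.Injective (fun n : ℕ => 2 * n) := fun a b hab => by simpa using hab
  rw [← hi.hasSum_iff]
  · refine (h.div_const (2 ^ p)).congr_fun ?_ |> fun h => h
    intro n
    simp [mul_pow, div_eq_mul_inv, mul_comm]
  · intro n hn
    rw [if_neg]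
    rintro ⟨k, rfl⟩
    exact hn ⟨k, by ring⟩

theorem hasSum_zeta_three : HasSum (fun n : ℕ => 1 / (n : ℝ) ^ 3) (riemannZeta 3).re := by
  have h1 := zeta_nat_eq_tsum_of_gt_one (k := 3) (by norm_num)
  have h2 : riemannZeta 3 = ((∑' n : ℕ, 1 / (n : ℝ) ^ 3 : ℝ) : ℂ) := by
    rw [Complex.ofReal_tsum]
    push_cast
    exact_mod_cast h1
  rw [h2, Complex.ofReal_re]
  exact (Real.summable_one_div_nat_pow.2 (by norm_num)).hasSum

theorem tendsto_limitCov_sum :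
    Tendsto (fun M : ℕ => ∑ a ∈ Finset.Icc 1 M, (8 * (1 / (a : ℝ) ^ 2) +
      16 * if Even a then 1 / (a : ℝ) ^ 3 else 0)) atTop
      (𝓝 (4 * Real.pi ^ 2 / 3 + 2 * (riemannZeta 3).re)) := by
  have h := (hasSum_zeta_two.mul_left 8).add ((hasSum_even hasSum_zeta_three).mul_left 16)
  refine (tendsto_sum_Icc h ?_).trans_eq ?_
  · simp
  · congr 1
    ring

theorem sum_limitCov (M : ℕ) : 4 * ∑ a ∈ Finset.Icc 1 M, ∑ b ∈ Finset.Icc 1 M,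
      (limitCov a b : ℝ) / ((a : ℝ) ^ 2 * (b : ℝ) ^ 2) =
    ∑ a ∈ Finset.Icc 1 M, (8 * (1 / (a : ℝ) ^ 2) + 16 * if Even a then 1 / (a : ℝ) ^ 3 else 0) := by
  rw [Finset.mul_sum]
  refine Finset.sum_congr rfl fun a ha => ?_
  have ha0 : (0 : ℝ) < a := by exact_mod_cast (Finset.mem_Icc.1 ha).1
  rw [Finset.sum_eq_single a]
  · rw [limitCov, if_pos rfl]
    split_ifs <;> push_cast <;> field_simp <;> ring
  · intro b _ hb
    rw [limitCov, if_neg (Ne.symm hb), Int.cast_zero, zero_div]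
  · exact fun h => absurd ha h

/-! ### The expectation -/

theorem abs_harmonic_sub_le (hN : 1 ≤ N) :
    |∑ a ∈ Finset.Icc 1 (2 * N), 1 / (a : ℝ) - (Real.log (2 * N) + Real.eulerMascheroniConstant)| ≤
      1 / (N : ℝ) := by
  have hN0 : (0 : ℝ) < N := by exact_mod_cast hN
  have e : ∑ a ∈ Finset.Icc 1 (2 * N), 1 / (a : ℝ) = (harmonic (2 * N) : ℝ) := by
    rw [harmonic_eq_sum_Icc]
    push_cast
    simp
  have h1 := Real.eulerMascheroniSeq_lt_eulerMascheroniConstant (2 * N)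
  have h2 := Real.eulerMascheroniConstant_lt_eulerMascheroniSeq' (2 * N)
  rw [Real.eulerMascheroniSeq] at h1
  rw [Real.eulerMascheroniSeq', if_neg (by omega)] at h2
  push_cast at h1 h2
  have h3 : Real.log (2 * N + 1) ≤ Real.log (2 * N) + 1 / N := by
    have : Real.log ((2 * N + 1) / (2 * N)) ≤ (2 * N + 1) / (2 * N) - 1 :=
      Real.log_le_sub_one_of_pos (by positivity)
    rw [Real.log_div (by positivity) (by positivity)] at this
    have h4 : (2 * N + 1) / (2 * N) - 1 ≤ 1 / (N : ℝ) := by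
      field_simp
      linarith
    linarith
  have h5 : (0 : ℝ) < 1 / N := by positivity
  rw [e, abs_le]
  constructor <;> linarith

theorem abs_even_sum_sub_le (hN : 1 ≤ N) :
    |∑ a ∈ Finset.Icc 1 (2 * N), (if Even a then 1 / (a : ℝ) ^ 2 else 0) - Real.pi ^ 2 / 24| ≤
      2 / (N : ℝ) := by
  have ht := tendsto_sum_Icc (hasSum_even hasSum_zeta_two) (by simp)
  rw [show Real.pi ^ 2 / 6 / 2 ^ 2 = Real.pi ^ 2 / 24 by ring] at ht
  have hsub : ∀ M, 2 * N ≤ M → Finset.Icc 1 (2 * N) ⊆ Finset.Icc 1 M :=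
    fun M hM => Finset.Icc_subset_Icc_right hM
  have h1 : ∑ a ∈ Finset.Icc 1 (2 * N), (if Even a then 1 / (a : ℝ) ^ 2 else 0) ≤
      Real.pi ^ 2 / 24 := by
    refine ge_of_tendsto ht (eventually_atTop.2 ⟨2 * N, fun M hM => ?_⟩)
    exact Finset.sum_le_sum_of_subset_of_nonneg (hsub M hM) fun _ _ _ => by positivity
  have h2 : Real.pi ^ 2 / 24 ≤
      ∑ a ∈ Finset.Icc 1 (2 * N), (if Even a then 1 / (a : ℝ) ^ 2 else 0) + 2 / (N : ℝ) := by
    refine le_of_tendsto ht (eventually_atTop.2 ⟨2 * N, fun M hM => ?_⟩)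
    rw [← Finset.sum_sdiff (hsub M hM), add_comm]
    gcongr
    refine le_trans ?_ (sum_inv_sq_tail_le hN M)
    refine le_trans ?_ (Finset.sum_le_sum_of_subset_of_nonneg (Finset.sdiff_subset
      (s := Finset.Icc 1 M) (t := Finset.Icc 1 (2 * N))) fun _ _ _ => by positivity)
    refine Finset.sum_le_sum fun a ha => ?_
    rw [Finset.mem_sdiff, Finset.mem_Icc, Finset.mem_Icc] at ha
    rw [if_pos (by omega : N < 2 * a)]
    split_ifs
    · exact le_rfl
    · positivity
  have h3 : (0 : ℝ) ≤ 2 / N := by positivity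
  rw [abs_le]
  constructor <;> linarith

theorem inv_sq_tail_telescope (hN : 1 ≤ N) {M : ℕ} (hM : N ≤ M) :
    1 / ((N : ℝ) + 1) - 1 / (M + 1) ≤ ∑ a ∈ Finset.Icc 1 M, (if N < a then 1 / (a : ℝ) ^ 2 else 0) ∧
      ∑ a ∈ Finset.Icc 1 M, (if N < a then 1 / (a : ℝ) ^ 2 else 0) ≤ 1 / (N : ℝ) - 1 / M := by
  induction M, hM using Nat.le_induction with
  | base =>
    rw [Finset.sum_eq_zero]
    · simp
    · intro a ha
      rw [if_neg (by have := (Finset.mem_Icc.1 ha).2; omega)]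
  | succ M hM ih =>
    have hM0 : (0 : ℝ) < M := by exact_mod_cast (hN.trans hM)
    rw [Finset.sum_Icc_succ_top (by omega), if_pos (by omega)]
    push_cast
    have h1 : 1 / ((M : ℝ) + 1) - 1 / (M + 1 + 1) ≤ 1 / ((M : ℝ) + 1) ^ 2 := by
      rw [div_sub_div _ _ (by positivity) (by positivity),
        div_le_div_iff₀ (by positivity) (by positivity)]
      nlinarith
    have h2 : 1 / ((M : ℝ) + 1) ^ 2 ≤ 1 / M - 1 / (M + 1) := by
      rw [div_sub_div _ _ (by positivity) (by positivity),
        div_le_div_iff₀ (by positivity) (by positivity)]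
      nlinarith
    constructor <;> linarith [ih.1, ih.2]

/-- The second moment of the trace of the `a`-th power, for a large number of empty sites. -/
theorem secondMoment_div_sq {L a : ℕ} (ha : 1 ≤ a) (hL : a ≤ L) :
    (secondMoment N L a : ℝ) / (a : ℝ) ^ 2 =
      (if a ≤ 2 * N then 1 / (a : ℝ) else 0) +
      (if a ≤ 2 * N then (if Even a then 1 / (a : ℝ) ^ 2 else 0) else 0) -
      (if N < a ∧ a ≤ 2 * N then 1 / (a : ℝ) ^ 2 else 0) +
      2 * N * (if 2 * N < a then 1 / (a : ℝ) ^ 2 else 0) := by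
  have ha0 : (0 : ℝ) < a := by exact_mod_cast ha
  rw [secondMoment_eq ha hL]
  by_cases h1 : a ≤ 2 * N
  · have h2 : ((min a N + min N (a - 1 - N) : ℕ) : ℝ) = a - if N < a then 1 else 0 := by
      split_ifs with h
      · rw [eq_sub_iff_add_eq]
        exact_mod_cast (by omega : (min a N + min N (a - 1 - N)) + 1 = a)
      · rw [sub_zero]
        exact_mod_cast (by omega : (min a N + min N (a - 1 - N)) = a)
    rw [Int.cast_add, Int.cast_natCast, h2]
    simp only [h1, not_lt.2 h1, and_true, if_true, if_false]
    split_ifs <;> push_cast <;> field_simp <;> ring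
  · have h2 : ((min a N + min N (a - 1 - N) : ℕ) : ℝ) = 2 * N := by
      exact_mod_cast (by omega : (min a N + min N (a - 1 - N)) = 2 * N)
    rw [Int.cast_add, Int.cast_natCast, h2]
    simp only [h1, not_le.1 h1, and_false, if_true, if_false]
    push_cast
    field_simp
    ring

theorem abs_expectation_sub_le (hN : 1 ≤ N) {M : ℕ} (hM : 2 * N ^ 2 ≤ M) :
    |∑ a ∈ Finset.Icc 1 M, (secondMoment N M a : ℝ) / (a : ℝ) ^ 2 -
      (Real.log (2 * N) + Real.eulerMascheroniConstant + 1 + Real.pi ^ 2 / 24)| ≤ 7 / (N : ℝ) := by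
  have hN0 : (0 : ℝ) < N := by exact_mod_cast hN
  have hNM : 2 * N ≤ M := by nlinarith
  rw [Finset.sum_congr rfl fun a ha => secondMoment_div_sq (N := N) (L := M)
    (Finset.mem_Icc.1 ha).1 (Finset.mem_Icc.1 ha).2]
  rw [Finset.sum_add_distrib, Finset.sum_sub_distrib, Finset.sum_add_distrib, ← Finset.mul_sum]
  have hres : ∀ f : ℕ → ℝ, ∑ a ∈ Finset.Icc 1 M, (if a ≤ 2 * N then f a else 0) =
      ∑ a ∈ Finset.Icc 1 (2 * N), f a := by
    intro f
    rw [← Finset.sum_filter]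
    congr 1
    ext a
    simp only [Finset.mem_filter, Finset.mem_Icc]
    omega
  rw [hres, hres]
  have h1 := abs_le.1 (abs_harmonic_sub_le hN)
  have h2 := abs_le.1 (abs_even_sum_sub_le hN)
  have h3 : ∑ a ∈ Finset.Icc 1 M, (if N < a ∧ a ≤ 2 * N then 1 / (a : ℝ) ^ 2 else 0) ≤ 2 / (N : ℝ) := by
    refine le_trans (Finset.sum_le_sum fun a _ => ?_) (sum_inv_sq_tail_le hN M)
    split_ifs with h h'
    · exact le_rfl
    · omega
    · positivity
    · exact le_rfl
  have h3' : 0 ≤ ∑ a ∈ Finset.Icc 1 M, (if N < a ∧ a ≤ 2 * N then 1 / (a : ℝ) ^ 2 else 0) :=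
    Finset.sum_nonneg fun _ _ => by positivity
  obtain ⟨h4, h5⟩ := inv_sq_tail_telescope (N := 2 * N) (by omega) hNM
  push_cast at h4 h5
  have hM0 : (2 : ℝ) * N ^ 2 ≤ M := by exact_mod_cast hM
  have h6 : 2 * (N : ℝ) * ∑ a ∈ Finset.Icc 1 M, (if 2 * N < a then 1 / (a : ℝ) ^ 2 else 0) ≤ 1 := by
    calc _ ≤ 2 * N * (1 / (2 * (N : ℝ)) - 1 / M) := by gcongr
      _ = 1 - 2 * N * (1 / M) := by field_simp
      _ ≤ 1 := sub_le_self _ (by positivity)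
  have h7 : 1 - 2 / (N : ℝ) ≤
      2 * N * ∑ a ∈ Finset.Icc 1 M, (if 2 * N < a then 1 / (a : ℝ) ^ 2 else 0) := by
    have h8 : 1 / ((M : ℝ) + 1) ≤ 1 / (2 * N ^ 2) := by gcongr; linarith
    have h9 : 1 / (2 * (N : ℝ)) - 1 / (2 * N ^ 2) ≤ 1 / (2 * N + 1) := by
      rw [div_sub_div _ _ (by positivity) (by positivity),
        div_le_div_iff₀ (by positivity) (by positivity)]
      have := pow_pos hN0 2
      nlinarith
    calc 1 - 2 / (N : ℝ) = 2 * N * (1 / (2 * (N : ℝ)) - 1 / (2 * N ^ 2) - 1 / (2 * N ^ 2)) := by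
          field_simp
          ring
      _ ≤ 2 * N * (1 / (2 * (N : ℝ) + 1) - 1 / (M + 1)) := by gcongr
      _ ≤ _ := by gcongr
  have e : (7 : ℝ) / N = 1 / N + 2 / N + 2 / N + 2 / N := by ring
  have h0 : (0 : ℝ) < 1 / N := by positivity
  have h0' : (2 : ℝ) / N = 1 / N + 1 / N := by ring
  rw [abs_le, e]
  constructor <;> linarith [h1.1, h1.2, h2.1, h2.2]

end SymplecticHaar

set_option linter.unusedSectionVars false
namespace SymplecticHaar

open Filter Topology

variable {N : ℕ} {μ : Measure (Matrix (Fin (2 * N)) (Fin (2 * N)) ℂ)}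
  {A : Matrix (Fin (2 * N)) (Fin (2 * N)) ℂ}

/-- The square of the trace of the `a`-th power. -/
def sqTrace (a : ℕ) (A : Matrix (Fin (2 * N)) (Fin (2 * N)) ℂ) : ℝ := (A ^ a).trace.re ^ 2

/-- The truncation of `Q N` to the first `M` powers. -/
def truncQ (M : ℕ) (A : Matrix (Fin (2 * N)) (Fin (2 * N)) ℂ) : ℝ :=
  2 * ∑ a ∈ Finset.Icc 1 M, sqTrace a A / (a : ℝ) ^ 2

theorem continuous_sqTrace (a : ℕ) : Continuous (sqTrace (N := N) a) :=
  (Complex.continuous_re.comp (continuous_id.pow a).matrix_trace).pow 2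

theorem continuous_truncQ (M : ℕ) : Continuous (truncQ (N := N) M) :=
  continuous_const.mul (continuous_finsetSum _ fun a _ => (continuous_sqTrace a).div_const _)

theorem integrable_of_continuous_real [IsProbabilityMeasure μ] (hμ : μ (USp N) = 1)
    {F : Matrix (Fin (2 * N)) (Fin (2 * N)) ℂ → ℝ} (hF : Continuous F) : Integrable F μ := by
  obtain ⟨K, hK⟩ := (isCompact_USp N).exists_bound_of_continuousOn hF.continuousOn
  exact Integrable.of_bound hF.aestronglyMeasurable K ((ae_mem_USp hμ).mono fun A hA => hK A hA)

theorem sqTrace_nonneg (a : ℕ) (A : Matrix (Fin (2 * N)) (Fin (2 * N)) ℂ) : 0 ≤ sqTrace a A :=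
  sq_nonneg _

theorem sqTrace_le (hA : A ∈ USp N) (a : ℕ) : sqTrace a A ≤ 4 * (N : ℝ) ^ 2 := by
  have h := abs_le.1 (abs_re_trace_pow_le hA a)
  exact (sq_le_sq' h.1 h.2).trans_eq (by ring)

theorem truncQ_nonneg (M : ℕ) (A : Matrix (Fin (2 * N)) (Fin (2 * N)) ℂ) : 0 ≤ truncQ M A :=
  mul_nonneg zero_le_two (Finset.sum_nonneg fun a _ => div_nonneg (sqTrace_nonneg a A) (sq_nonneg _))

theorem truncQ_le (hA : A ∈ USp N) (M : ℕ) : truncQ M A ≤ 16 * (N : ℝ) ^ 2 := by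
  calc truncQ M A ≤ 2 * ∑ a ∈ Finset.Icc 1 M, 4 * (N : ℝ) ^ 2 * (1 / (a : ℝ) ^ 2) := by
        unfold truncQ
        gcongr with a ha
        rw [mul_one_div]
        gcongr
        exact sqTrace_le hA a
    _ = 8 * (N : ℝ) ^ 2 * ∑ a ∈ Finset.Icc 1 M, 1 / (a : ℝ) ^ 2 := by
        rw [← Finset.mul_sum]
        ring
    _ ≤ 8 * (N : ℝ) ^ 2 * 2 := by
        gcongr
        exact sum_inv_sq_le M
    _ = _ := by ring

theorem tendsto_truncQ (hA : A ∈ USp N) : Tendsto (fun M => truncQ M A) atTop (𝓝 (Q N A)) := by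
  have hs : Summable fun a : ℕ => 4 * (N : ℝ) ^ 2 * (1 / (a : ℝ) ^ 2) :=
    (Real.summable_one_div_nat_pow.2 (by norm_num)).mul_left _
  have hs' : Summable fun k : ℕ => sqTrace (k + 1) A / ((k : ℝ) + 1) ^ 2 := by
    refine Summable.of_nonneg_of_le (fun k => div_nonneg (sqTrace_nonneg _ A) (sq_nonneg _))
      (fun k => ?_) ((summable_nat_add_iff 1).2 hs)
    rw [mul_one_div]
    push_cast
    gcongr
    exact sqTrace_le hA _
  have e : ∀ M, truncQ M A = 2 * ∑ k ∈ Finset.range M, sqTrace (k + 1) A / ((k : ℝ) + 1) ^ 2 := by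
    intro M
    rw [truncQ]
    congr 1
    induction M with
    | zero => simp
    | succ M ih =>
      rw [Finset.sum_Icc_succ_top (by omega), ih, Finset.sum_range_succ]
      push_cast
      rfl
  simp only [e]
  exact hs'.hasSum.tendsto_sum_nat.const_mul 2

theorem tendsto_integral_truncQ_pow [IsProbabilityMeasure μ] (hμ : μ (USp N) = 1) (p : ℕ) :
    Tendsto (fun M => ∫ A, truncQ M A ^ p ∂μ) atTop (𝓝 (∫ A, Q N A ^ p ∂μ)) := by
  refine tendsto_integral_of_dominated_convergence (fun _ => (16 * (N : ℝ) ^ 2) ^ p)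
    (fun M => ((continuous_truncQ M).pow p).aestronglyMeasurable) (integrable_const _) (fun M => ?_)
    ?_
  · filter_upwards [ae_mem_USp hμ] with A hA
    rw [Real.norm_eq_abs, abs_of_nonneg (pow_nonneg (truncQ_nonneg M A) p)]
    exact pow_le_pow_left₀ (truncQ_nonneg M A) (truncQ_le hA M) p
  · filter_upwards [ae_mem_USp hμ] with A hA
    exact (tendsto_truncQ hA).pow p

theorem memLp_Q [IsProbabilityMeasure μ] (hμ : μ (USp N) = 1) : MemLp (Q N) 2 μ := by
  refine MemLp.of_bound (aestronglyMeasurable_of_tendsto_ae atTop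
    (fun M => (continuous_truncQ M).aestronglyMeasurable)
    ((ae_mem_USp hμ).mono fun A hA => tendsto_truncQ hA)) (16 * (N : ℝ) ^ 2) ?_
  filter_upwards [ae_mem_USp hμ] with A hA
  have h0 := ge_of_tendsto' (tendsto_truncQ hA) fun M => truncQ_nonneg M A
  rw [Real.norm_eq_abs, abs_of_nonneg h0]
  exact le_of_tendsto' (tendsto_truncQ hA) fun M => truncQ_le hA M

theorem integral_truncQ [IsProbabilityMeasure μ] (hμ : μ (USp N) = 1) (M : ℕ) :
    ∫ A, truncQ M A ∂μ = 2 * ∑ a ∈ Finset.Icc 1 M, (∫ A, sqTrace a A ∂μ) / (a : ℝ) ^ 2 := by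
  unfold truncQ
  rw [integral_const_mul, integral_finsetSum _ fun a _ =>
    (integrable_of_continuous_real hμ (continuous_sqTrace a)).div_const _]
  simp only [integral_div]

theorem integral_truncQ_sq [IsProbabilityMeasure μ] (hμ : μ (USp N) = 1) (M : ℕ) :
    ∫ A, truncQ M A ^ 2 ∂μ = 4 * ∑ a ∈ Finset.Icc 1 M, ∑ b ∈ Finset.Icc 1 M,
      (∫ A, sqTrace a A * sqTrace b A ∂μ) / ((a : ℝ) ^ 2 * (b : ℝ) ^ 2) := by
  have e : ∀ A : Matrix (Fin (2 * N)) (Fin (2 * N)) ℂ, truncQ M A ^ 2 =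
      4 * ∑ a ∈ Finset.Icc 1 M, ∑ b ∈ Finset.Icc 1 M,
        sqTrace a A * sqTrace b A / ((a : ℝ) ^ 2 * (b : ℝ) ^ 2) := by
    intro A
    rw [truncQ, mul_pow, sq (∑ _ ∈ _, _), Finset.sum_mul_sum]
    norm_num only
    simp only [div_mul_div_comm]
  have hi : ∀ a b : ℕ, Integrable (fun A : Matrix (Fin (2 * N)) (Fin (2 * N)) ℂ =>
      sqTrace a A * sqTrace b A / ((a : ℝ) ^ 2 * (b : ℝ) ^ 2)) μ := fun a b =>
    integrable_of_continuous_real hμ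
      (((continuous_sqTrace a).mul (continuous_sqTrace b)).div_const _)
  simp only [e]
  rw [integral_const_mul, integral_finsetSum _ fun a _ => integrable_finsetSum _ fun b _ => hi a b]
  congr 1
  refine Finset.sum_congr rfl fun a _ => ?_
  rw [integral_finsetSum _ fun b _ => hi a b]
  simp only [integral_div]

theorem abs_covariance_sub_le [IsProbabilityMeasure μ] (hμ : μ (USp N) = 1)
    (hinv : ∀ g ∈ USp N, μ.map (fun A => g * A) = μ) (hN : 1 ≤ N) {a b : ℕ} (ha : 1 ≤ a)
    (hb : 1 ≤ b) :
    |∫ A, sqTrace a A * sqTrace b A ∂μ - (∫ A, sqTrace a A ∂μ) * (∫ A, sqTrace b A ∂μ) -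
      (limitCov a b : ℝ)| ≤ (covError N a b : ℝ) + (covError N b a : ℝ) := by
  wlog hab : a ≤ b generalizing a b
  · have h := this hb ha (by omega)
    rw [add_comm, mul_comm (∫ A, sqTrace a A ∂μ)]
    simp only [mul_comm (sqTrace a _)]
    rwa [show limitCov a b = limitCov b a by
      rw [limitCov, limitCov, if_neg (by omega), if_neg (by omega)]]
  have h1 : ∫ A, sqTrace a A ∂μ = secondMoment N (a + 2 * b) a :=
    integral_sq hμ hinv (by omega)
  have h2 : ∫ A, sqTrace b A ∂μ = secondMoment N (a + 2 * b) b :=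
    integral_sq hμ hinv (by omega)
  have h3 := integral_sq_mul_sq hμ hinv (le_refl (a + 2 * b))
  have h4 := abs_squareCov_sub_limitCov_le (L := a + 2 * b) hN ha hab (by omega)
  have h5 : (0 : ℝ) ≤ covError N b a := by exact_mod_cast covError_nonneg N b a
  have h6 : ∫ A, sqTrace a A * sqTrace b A ∂μ = _ := h3
  rw [h1, h2, h6]
  refine le_trans ?_ (le_add_of_nonneg_right h5)
  push_cast
  rw [add_sub_cancel_left]
  exact_mod_cast h4

theorem abs_variance_truncQ_sub_le [IsProbabilityMeasure μ] (hμ : μ (USp N) = 1)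
    (hinv : ∀ g ∈ USp N, μ.map (fun A => g * A) = μ) (hN : 1 ≤ N) (M : ℕ) :
    |∫ A, truncQ M A ^ 2 ∂μ - (∫ A, truncQ M A ^ 1 ∂μ) ^ 2 -
      ∑ a ∈ Finset.Icc 1 M, (8 * (1 / (a : ℝ) ^ 2) + 16 * if Even a then 1 / (a : ℝ) ^ 3 else 0)| ≤
      160000 / (N : ℝ) := by
  have e : ∫ A, truncQ M A ^ 2 ∂μ - (∫ A, truncQ M A ^ 1 ∂μ) ^ 2 -
      ∑ a ∈ Finset.Icc 1 M, (8 * (1 / (a : ℝ) ^ 2) + 16 * if Even a then 1 / (a : ℝ) ^ 3 else 0) =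
      4 * ∑ a ∈ Finset.Icc 1 M, ∑ b ∈ Finset.Icc 1 M,
        (∫ A, sqTrace a A * sqTrace b A ∂μ - (∫ A, sqTrace a A ∂μ) * (∫ A, sqTrace b A ∂μ) -
          limitCov a b) / ((a : ℝ) ^ 2 * (b : ℝ) ^ 2) := by
    simp only [pow_one]
    rw [← sum_limitCov, integral_truncQ_sq hμ, integral_truncQ hμ, mul_pow, sq (∑ _ ∈ _, _),
      Finset.sum_mul_sum]
    simp only [sub_div, Finset.sum_sub_distrib, div_mul_div_comm]
    ring
  have hs : ∑ a ∈ Finset.Icc 1 M, ∑ b ∈ Finset.Icc 1 M,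
      (covError N b a : ℝ) / ((a : ℝ) ^ 2 * (b : ℝ) ^ 2) ≤ 20000 / N := by
    rw [Finset.sum_comm]
    refine le_trans (le_of_eq ?_) (sum_covError_le hN M)
    simp only [mul_comm]
  rw [e, abs_mul, abs_of_pos (by norm_num : (0 : ℝ) < 4)]
  calc _ ≤ 4 * ∑ a ∈ Finset.Icc 1 M, ∑ b ∈ Finset.Icc 1 M,
        ((covError N a b : ℝ) / ((a : ℝ) ^ 2 * (b : ℝ) ^ 2) +
          (covError N b a : ℝ) / ((a : ℝ) ^ 2 * (b : ℝ) ^ 2)) := by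
        gcongr
        refine (Finset.abs_sum_le_sum_abs _ _).trans (Finset.sum_le_sum fun a ha => ?_)
        refine (Finset.abs_sum_le_sum_abs _ _).trans (Finset.sum_le_sum fun b hb => ?_)
        rw [abs_div, abs_of_nonneg (by positivity : (0 : ℝ) ≤ (a : ℝ) ^ 2 * (b : ℝ) ^ 2), ← add_div]
        gcongr
        exact abs_covariance_sub_le hμ hinv hN (Finset.mem_Icc.1 ha).1 (Finset.mem_Icc.1 hb).1
    _ ≤ 4 * (20000 / N + 20000 / N) := by
        simp only [Finset.sum_add_distrib]
        gcongr
        exact sum_covError_le hN M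
    _ = _ := by ring

theorem abs_variance_Q_sub_le [IsProbabilityMeasure μ] (hμ : μ (USp N) = 1)
    (hinv : ∀ g ∈ USp N, μ.map (fun A => g * A) = μ) (hN : 1 ≤ N) :
    |variance (Q N) μ - (4 * Real.pi ^ 2 / 3 + 2 * (riemannZeta 3).re)| ≤ 160000 / (N : ℝ) := by
  rw [variance_eq_sub (memLp_Q hμ)]
  have h := (((tendsto_integral_truncQ_pow hμ 2).sub
    ((tendsto_integral_truncQ_pow hμ 1).pow 2)).sub tendsto_limitCov_sum).abs
  simp only [pow_one] at h
  refine le_of_tendsto' h fun M => ?_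
  simpa only [pow_one] using abs_variance_truncQ_sub_le hμ hinv hN M

theorem abs_integral_Q_sub_le [IsProbabilityMeasure μ] (hμ : μ (USp N) = 1)
    (hinv : ∀ g ∈ USp N, μ.map (fun A => g * A) = μ) (hN : 1 ≤ N) :
    |∫ A, Q N A ∂μ - 2 * Real.log (2 * N)
      - (2 * Real.eulerMascheroniConstant + 2 + Real.pi ^ 2 / 12)| ≤ 14 / (N : ℝ) := by
  have h := (((tendsto_integral_truncQ_pow hμ 1).sub_const (2 * Real.log (2 * N))).sub_const
    (2 * Real.eulerMascheroniConstant + 2 + Real.pi ^ 2 / 12)).abs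
  simp only [pow_one] at h
  refine le_of_tendsto h (eventually_atTop.2 ⟨2 * N ^ 2, fun M hM => ?_⟩)
  have h1 := abs_expectation_sub_le hN hM
  have e : ∫ A, truncQ M A ∂μ =
      2 * ∑ a ∈ Finset.Icc 1 M, (secondMoment N M a : ℝ) / (a : ℝ) ^ 2 := by
    rw [integral_truncQ hμ]
    congr 1
    refine Finset.sum_congr rfl fun a ha => ?_
    have : ∫ A, sqTrace a A ∂μ = secondMoment N M a := integral_sq hμ hinv (Finset.mem_Icc.1 ha).2
    rw [this]
  have e2 : (14 : ℝ) / N = 2 * (7 / N) := by ring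
  rw [e, e2]
  rw [abs_le] at h1 ⊢
  constructor <;> linarith [h1.1, h1.2]

end SymplecticHaar

/-- There is a universal constant `C > 0` such that for all `N ≥ 1` and `A` Haar-distributed
on `USp(2N)`: `|E[Q_N] − 2 log(2N) − (2γ + 2 + π²/12)| ≤ C/N` and
`|Var(Q_N) − (4π²/3 + 2 ζ(3))| ≤ C/N`. -/
theorem expectation_variance_asymptotics_symplectic :
    ∃ C : ℝ, 0 < C ∧ ∀ N : ℕ, 1 ≤ N →
      ∀ μ : Measure (Matrix (Fin (2 * N)) (Fin (2 * N)) ℂ), IsProbabilityMeasure μ →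
        μ (USp N) = 1 →
        (∀ g ∈ USp N, μ.map (fun A => g * A) = μ) →
        |(∫ A, Q N A ∂μ) - 2 * Real.log (2 * N)
            - (2 * Real.eulerMascheroniConstant + 2 + Real.pi ^ 2 / 12)| ≤ C / N ∧
        |variance (Q N) μ - (4 * Real.pi ^ 2 / 3 + 2 * (riemannZeta 3).re)| ≤ C / N := by
  refine ⟨160000, by norm_num, fun N hN μ _ hμ hinv => ⟨?_, ?_⟩⟩
  · refine (SymplecticHaar.abs_integral_Q_sub_le hμ hinv hN).trans ?_
    gcongr
    norm_num
  · exact SymplecticHaar.abs_variance_Q_sub_le hμ hinv hN
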